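/- Every dynamically central piecewise syndetic set A ⊆ ℕ is a set of polynomial multiple measurable recurrence for commuting transformations: for all k, ℓ ∈ ℕ, every probability space (X, μ) equipped with pairwise commuting measure-preserving maps T₁, …, T_k : X → X, every measurable set E ⊆ X with μ(E) > 0, and all polynomials p_{i,j} ∈ ℚ[x] (1 ≤ i ≤ k, 1 ≤ j ≤ ℓ) with p_{i,j}(0) = 0 and p_{i,j}(ℕ₀) ⊆ ℕ₀, there exists n ∈ A such that μ(⋂_{j=1}^{ℓ} (T₁^{p_{1,j}(n)} ∘ T₂^{p_{2,j}(n)} ∘ ⋯ ∘ T_k^{p_{k,j}(n)})⁻¹ E) > 0. -/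

import Mathlib

open Set

/-- `A − n` computed inside the positive integers. -/
def shiftN (A : Set ℕ+) (n : ℕ+) : Set ℕ+ := {m : ℕ+ | m + n ∈ A}

/-- `A − B := ⋃_{b ∈ B} (A − b)`. -/
def shiftSet (A B : Set ℕ+) : Set ℕ+ := ⋃ b ∈ B, shiftN A b

/-- A set of positive integers is syndetic if `A ∪ (A−1) ∪ ⋯ ∪ (A−N) = ℕ` for some `N`. -/
def Syndetic (A : Set ℕ+) : Prop :=
  ∃ N : ℕ+, (A ∪ ⋃ k ∈ {k : ℕ+ | k ≤ N}, shiftN A k) = Set.univ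

/-- A set of positive integers is thick if it contains a translate of every finite set. -/
def Thick (A : Set ℕ+) : Prop :=
  ∀ F : Finset ℕ+, ∃ n : ℕ+, ∀ f ∈ F, f + n ∈ A

/-- Piecewise syndetic: some finite union of translates `A ∪ (A−1) ∪ ⋯ ∪ (A−N)` is thick. -/
def PiecewiseSyndetic (A : Set ℕ+) : Prop :=
  ∃ N : ℕ+, Thick (A ∪ ⋃ k ∈ {k : ℕ+ | k ≤ N}, shiftN A k)

/-- A self-map of a topological space is minimal if every forward orbit
`{T^n x | n ∈ ℕ, n ≥ 1}` is dense. -/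
def MinimalMap {X : Type} [TopologicalSpace X] (T : X → X) : Prop :=
  ∀ x : X, Dense (Set.range fun n : ℕ+ => T^[(n : ℕ)] x)

/-- A minimal topological dynamical system: a nonempty compact metric space together with a
continuous map all of whose forward orbits are dense. -/
structure MinSystem : Type 1 where
  X : Type
  [met : MetricSpace X]
  [cpt : CompactSpace X]
  [nem : Nonempty X]
  T : X → X
  cont : Continuous T
  minimal : MinimalMap T

attribute [instance] MinSystem.met MinSystem.cpt MinSystem.nem

/-- `R(x,U)`: the set of (positive) return times of `x` to `U`. -/
def retTimes {X : Type} (T : X → X) (x : X) (U : Set X) : Set ℕ+ :=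
  {n : ℕ+ | T^[(n : ℕ)] x ∈ U}

/-- Dynamically syndetic sets. -/
def DynSyndetic (A : Set ℕ+) : Prop :=
  ∃ (S : MinSystem) (x : S.X) (U : Set S.X),
    IsOpen U ∧ U.Nonempty ∧ retTimes S.T x U ⊆ A

/-- Dynamically central syndetic sets. -/
def DynCentralSyndetic (A : Set ℕ+) : Prop :=
  ∃ (S : MinSystem) (x : S.X) (U : Set S.X),
    IsOpen U ∧ x ∈ U ∧ retTimes S.T x U ⊆ A

/-- Dynamically thick sets: `{T^n x | n ∈ A}` is dense for every minimal system and point. -/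
def DynThick (A : Set ℕ+) : Prop :=
  ∀ (S : MinSystem) (x : S.X), Dense ((fun n : ℕ+ => S.T^[(n : ℕ)] x) '' A)

/-- Sets of (minimal topological) pointwise recurrence. -/
def PointwiseRecurrent (A : Set ℕ+) : Prop :=
  ∀ (S : MinSystem) (x : S.X) (U : Set S.X), IsOpen U → x ∈ U →
    ∃ a ∈ A, S.T^[(a : ℕ)] x ∈ U

/-- A family: an upward-closed collection of subsets of the positive integers. -/
def UpwardClosed (F : Set (Set ℕ+)) : Prop :=
  ∀ ⦃A B : Set ℕ+⦄, A ∈ F → A ⊆ B → B ∈ F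

/-- A filter (in the combinatorial sense): an upward-closed collection closed under
finite intersections. -/
def IsFilterFamily (F : Set (Set ℕ+)) : Prop :=
  UpwardClosed F ∧ ∀ ⦃A B : Set ℕ+⦄, A ∈ F → B ∈ F → A ∩ B ∈ F

/-- A family all of whose members are syndetic. -/
def SyndeticFamily (F : Set (Set ℕ+)) : Prop := ∀ A ∈ F, Syndetic A

/-- `A − 𝔉 := {n | A − n ∈ 𝔉}`. -/
def famShift (A : Set ℕ+) (F : Set (Set ℕ+)) : Set ℕ+ := {n : ℕ+ | shiftN A n ∈ F}

/-- `𝔉 + 𝔊 := {A | A − 𝔊 ∈ 𝔉}`. -/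
def famSum (F G : Set (Set ℕ+)) : Set (Set ℕ+) := {A : Set ℕ+ | famShift A G ∈ F}

/-- A family is idempotent if `𝔉 ⊆ 𝔉 + 𝔉`. -/
def IdempotentFamily (F : Set (Set ℕ+)) : Prop := F ⊆ famSum F F

/-- A proper family: nonempty and not containing the empty set. -/
def ProperFamily (F : Set (Set ℕ+)) : Prop := F.Nonempty ∧ ∅ ∉ F

/-- Dynamically piecewise syndetic: the intersection of a dynamically syndetic set and a
dynamically thick set. -/
def DynPS (A : Set ℕ+) : Prop :=
  ∃ B C : Set ℕ+, DynSyndetic B ∧ DynThick C ∧ A = B ∩ C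

/-- Dynamically central piecewise syndetic: the intersection of a dynamically central
syndetic set and a set of pointwise recurrence. -/
def DynCentralPS (A : Set ℕ+) : Prop :=
  ∃ B C : Set ℕ+, DynCentralSyndetic B ∧ PointwiseRecurrent C ∧ A = B ∩ C

/-- The composition `T₁^[e 1] ∘ T₂^[e 2] ∘ ⋯ ∘ T_k^[e k]`. -/
def multiComp {X : Type} {k : ℕ} (T : Fin k → X → X) (e : Fin k → ℕ) : X → X :=
  (List.ofFn fun i => (T i)^[e i]).foldr (· ∘ ·) id

namespace PolyRec

section Poly

variable {G : Type*} [AddCommGroup G]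

/-- The forward difference of a sequence. -/
def dlt (v : ℕ → G) : ℕ → G := fun n => v (n + 1) - v n

/-- The translate of a sequence. -/
def tau (e : ℕ) (v : ℕ → G) : ℕ → G := fun n => v (n + e)

/-- A sequence is polynomial if some iterated difference vanishes. -/
def IsPoly (v : ℕ → G) : Prop := ∃ d, dlt^[d] v = 0

lemma dlt_zero : dlt (0 : ℕ → G) = 0 := by ext; simp [dlt]

lemma dlt_iter_zero (d : ℕ) : dlt^[d] (0 : ℕ → G) = 0 :=
  Function.iterate_fixed dlt_zero d

lemma dlt_add (v w : ℕ → G) : dlt (v + w) = dlt v + dlt w := by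
  ext n; simp only [dlt, Pi.add_apply]; abel

lemma dlt_sub (v w : ℕ → G) : dlt (v - w) = dlt v - dlt w := by
  ext n; simp only [dlt, Pi.sub_apply]; abel

lemma dlt_neg (v : ℕ → G) : dlt (-v) = - dlt v := by
  ext n; simp only [dlt, Pi.neg_apply]; abel

lemma dlt_const (c : G) : dlt (fun _ => c) = 0 := by ext; simp [dlt]

lemma dlt_tau (e : ℕ) (v : ℕ → G) : dlt (tau e v) = tau e (dlt v) := by
  ext n; simp only [dlt, tau]; rw [Nat.add_right_comm]

lemma dlt_iter_add (d : ℕ) (v w : ℕ → G) : dlt^[d] (v + w) = dlt^[d] v + dlt^[d] w := by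
  induction d generalizing v w with
  | zero => rfl
  | succ d ih => simp only [Function.iterate_succ_apply, dlt_add, ih]

lemma dlt_iter_sub (d : ℕ) (v w : ℕ → G) : dlt^[d] (v - w) = dlt^[d] v - dlt^[d] w := by
  induction d generalizing v w with
  | zero => rfl
  | succ d ih => simp only [Function.iterate_succ_apply, dlt_sub, ih]

lemma dlt_iter_neg (d : ℕ) (v : ℕ → G) : dlt^[d] (-v) = - dlt^[d] v := by
  induction d generalizing v with
  | zero => rfl
  | succ d ih => simp only [Function.iterate_succ_apply, dlt_neg, ih]

lemma dlt_iter_tau (d e : ℕ) (v : ℕ → G) : dlt^[d] (tau e v) = tau e (dlt^[d] v) := by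
  induction d generalizing v with
  | zero => rfl
  | succ d ih => simp only [Function.iterate_succ_apply, dlt_tau, ih]

lemma dlt_iter_const {d : ℕ} (hd : 1 ≤ d) (c : G) : dlt^[d] (fun _ => c) = 0 := by
  obtain ⟨d, rfl⟩ := Nat.exists_eq_add_of_le' hd
  rw [Function.iterate_succ_apply, dlt_const, dlt_iter_zero]

lemma dlt_dlt_iter (d : ℕ) (v : ℕ → G) : dlt (dlt^[d] v) = dlt^[d + 1] v :=
  (Function.iterate_succ_apply' _ _ _).symm

lemma dlt_iter_mono {v : ℕ → G} {d d' : ℕ} (h : dlt^[d] v = 0) (hd : d ≤ d') :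
    dlt^[d'] v = 0 := by
  obtain ⟨e, rfl⟩ := Nat.exists_eq_add_of_le' hd
  rw [Function.iterate_add_apply, h, dlt_iter_zero]

lemma eq_const_of_dlt_eq_zero {v : ℕ → G} (h : dlt v = 0) (n : ℕ) : v n = v 0 := by
  induction n with
  | zero => rfl
  | succ n ih => rw [← ih]; exact sub_eq_zero.1 (congrFun h n)

namespace IsPoly

variable {v w : ℕ → G}

lemma zero : IsPoly (0 : ℕ → G) := ⟨0, rfl⟩

lemma const (c : G) : IsPoly (fun _ : ℕ => c) := ⟨1, dlt_const c⟩

lemma add (hv : IsPoly v) (hw : IsPoly w) : IsPoly (v + w) := by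
  obtain ⟨d, hd⟩ := hv
  obtain ⟨d', hd'⟩ := hw
  exact ⟨max d d', by rw [dlt_iter_add, dlt_iter_mono hd (le_max_left _ _),
    dlt_iter_mono hd' (le_max_right _ _), add_zero]⟩

lemma neg (hv : IsPoly v) : IsPoly (-v) := by
  obtain ⟨d, hd⟩ := hv
  exact ⟨d, by rw [dlt_iter_neg, hd, neg_zero]⟩

lemma sub (hv : IsPoly v) (hw : IsPoly w) : IsPoly (v - w) := by
  rw [sub_eq_add_neg]; exact hv.add hw.neg

lemma tau (e : ℕ) (hv : IsPoly v) : IsPoly (tau e v) := by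
  obtain ⟨d, hd⟩ := hv
  exact ⟨d, by rw [dlt_iter_tau, hd]; rfl⟩

lemma dlt_iter (hv : IsPoly v) (n : ℕ) : IsPoly (dlt^[n] v) := by
  obtain ⟨d, hd⟩ := hv
  exact ⟨d, by rw [← Function.iterate_add_apply]; exact dlt_iter_mono hd (Nat.le_add_right _ _)⟩

lemma comp {H : Type*} [AddCommGroup H] (φ : G →+ H) (hv : IsPoly v) :
    IsPoly (fun n => φ (v n)) := by
  obtain ⟨d, hd⟩ := hv
  refine ⟨d, ?_⟩
  have : ∀ (d : ℕ) (v : ℕ → G), dlt^[d] (fun n => φ (v n)) = fun n => φ (dlt^[d] v n) := by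
    intro d
    induction d with
    | zero => intro v; rfl
    | succ d ih =>
      intro v
      rw [Function.iterate_succ_apply, Function.iterate_succ_apply, ← ih]
      congr 1
      ext n; simp [dlt]
  rw [this, hd]; ext; simp

/-- A polynomial sequence that vanishes eventually vanishes. -/
lemma eq_zero_of_tau (hv : IsPoly v) {e : ℕ} (h : PolyRec.tau e v = 0) : v = 0 := by
  induction e with
  | zero => exact h
  | succ e ih =>
    apply ih
    set u := PolyRec.tau e v with hu
    have hu1 : dlt u = -u := by
      ext n
      have : u (n + 1) = 0 := by
        have := congrFun h n
        simp only [PolyRec.tau, Pi.zero_apply] at this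
        rw [hu]; simp only [PolyRec.tau]; rw [← this]; congr 1; omega
      simp [dlt, this]
    obtain ⟨d, hd⟩ := hv.tau e
    rw [← hu] at hd
    clear_value u
    clear hu h ih
    induction d generalizing u with
    | zero => exact hd
    | succ d ih =>
      rw [Function.iterate_succ_apply, hu1, dlt_iter_neg, neg_eq_zero] at hd
      exact ih u hu1 hd

lemma tau_eq_zero (hv : IsPoly v) {e : ℕ} : PolyRec.tau e v = 0 ↔ v = 0 :=
  ⟨hv.eq_zero_of_tau, fun h => by rw [h]; rfl⟩

/-- A nonconstant polynomial sequence has a degree. -/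
lemma exists_deg (hv : IsPoly v) (h : dlt v ≠ 0) :
    ∃ d, 1 ≤ d ∧ dlt^[d + 1] v = 0 ∧ dlt^[d] v ≠ 0 := by
  classical
  have hv' : ∃ d, dlt^[d] v = 0 := hv
  refine ⟨Nat.find hv' - 1, ?_, ?_, ?_⟩
  · by_contra hlt
    apply h
    exact dlt_iter_mono (d := Nat.find hv') (d' := 1) (Nat.find_spec hv') (by omega)
  · exact dlt_iter_mono (Nat.find_spec hv') (by omega)
  · apply Nat.find_min hv'
    have : Nat.find hv' ≠ 0 := by
      intro h0
      exact h (dlt_iter_mono (d := Nat.find hv') (d' := 1) (Nat.find_spec hv') (by omega))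
    omega

end IsPoly

/-- `V'` consists of differences `τ_e v - v₁ + c`, with `v₁ ∈ V` of least degree among the
nonconstant elements of `V`. -/
def Derived (V V' : Finset (ℕ → G)) : Prop :=
  ∃ v₁ ∈ V, ∃ i, 1 ≤ i ∧ dlt^[i + 1] v₁ = 0 ∧ dlt^[i] v₁ ≠ 0 ∧
    (∀ v ∈ V, dlt v ≠ 0 → dlt^[i] v ≠ 0) ∧
    ∀ v' ∈ V', ∃ v ∈ V, ∃ e c, dlt v ≠ 0 ∧ v' = fun n => v (n + e) - v₁ n + c

lemma exists_min_deg {V : Finset (ℕ → G)} (hV : ∀ v ∈ V, IsPoly v)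
    (h : ∃ v ∈ V, dlt v ≠ 0) :
    ∃ v₁ ∈ V, dlt v₁ ≠ 0 ∧ ∃ i, 1 ≤ i ∧ dlt^[i + 1] v₁ = 0 ∧ dlt^[i] v₁ ≠ 0 ∧
      ∀ v ∈ V, dlt v ≠ 0 → dlt^[i] v ≠ 0 := by
  classical
  have hex : ∃ i, ∃ v ∈ V, 1 ≤ i ∧ dlt^[i + 1] v = 0 ∧ dlt^[i] v ≠ 0 := by
    obtain ⟨v, hv, h⟩ := h
    obtain ⟨d, hd⟩ := (hV v hv).exists_deg h
    exact ⟨d, v, hv, hd⟩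
  obtain ⟨v₁, hv₁, h1, h2, h3⟩ := Nat.find_spec hex
  refine ⟨v₁, hv₁, fun h0 => h3 (dlt_iter_mono (d := 1) h0 h1), _, h1, h2, h3, ?_⟩
  intro v hv hv0 hc
  obtain ⟨d, hd1, hd2, hd3⟩ := (hV v hv).exists_deg hv0
  have hlt : d < Nat.find hex := by
    by_contra hle
    exact hd3 (dlt_iter_mono hc (by omega))
  exact Nat.find_min hex hlt ⟨v, hv, hd1, hd2, hd3⟩

open Classical in
/-- The set of leading coefficients of the elements of degree `d`. -/
noncomputable def leadSet (d : ℕ) (V : Finset (ℕ → G)) : Finset G :=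
  (V.filter fun v => dlt^[d + 1] v = 0 ∧ dlt^[d] v ≠ 0).image fun v => dlt^[d] v 0

lemma mem_leadSet {d : ℕ} {V : Finset (ℕ → G)} {g : G} :
    g ∈ leadSet d V ↔ ∃ v ∈ V, dlt^[d + 1] v = 0 ∧ dlt^[d] v ≠ 0 ∧ dlt^[d] v 0 = g := by
  simp only [leadSet, Finset.mem_image, Finset.mem_filter, and_assoc]

lemma dlt_iter_derived {v v₁ : ℕ → G} {e d : ℕ} {c : G} (hd : 1 ≤ d) :
    dlt^[d] (fun n => v (n + e) - v₁ n + c) = tau e (dlt^[d] v) - dlt^[d] v₁ := by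
  have : (fun n => v (n + e) - v₁ n + c) = (tau e v - v₁) + fun _ => c := rfl
  rw [this, dlt_iter_add, dlt_iter_sub, dlt_iter_tau, dlt_iter_const hd, add_zero]

lemma leadSet_derived {V V' : Finset (ℕ → G)} (hV : ∀ v ∈ V, IsPoly v) (h : Derived V V') :
    ∃ i, 1 ≤ i ∧ (∃ v ∈ V, dlt^[i] v ≠ 0) ∧ (leadSet i V').card < (leadSet i V).card ∧
      ∀ d, i < d → (leadSet d V').card ≤ (leadSet d V).card := by
  classical
  obtain ⟨v₁, hv₁, i, hi, h1, h2, hmin, hV'⟩ := h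
  have hcst : ∀ {v : ℕ → G} {d : ℕ}, dlt^[d + 1] v = 0 → ∀ e, dlt^[d] v e = dlt^[d] v 0 := by
    intro v d hd
    apply eq_const_of_dlt_eq_zero
    rw [dlt_dlt_iter]
    exact hd
  refine ⟨i, hi, ⟨v₁, hv₁, h2⟩, ?_, fun d hd => Finset.card_le_card ?_⟩
  · have hl1 : dlt^[i] v₁ 0 ∈ leadSet i V := mem_leadSet.2 ⟨v₁, hv₁, h1, h2, rfl⟩
    have hsub : leadSet i V' ⊆ ((leadSet i V).erase (dlt^[i] v₁ 0)).image
        fun l => l - dlt^[i] v₁ 0 := by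
      intro g hg
      obtain ⟨v', hv', ha, hb, rfl⟩ := mem_leadSet.1 hg
      obtain ⟨v, hv, e, c, hv0, rfl⟩ := hV' v' hv'
      rw [dlt_iter_derived (by omega), h1, sub_zero,
        ((hV v hv).dlt_iter _).tau_eq_zero] at ha
      rw [dlt_iter_derived hi] at hb ⊢
      refine Finset.mem_image.2 ⟨dlt^[i] v 0, Finset.mem_erase.2 ⟨fun heq => hb ?_,
        mem_leadSet.2 ⟨v, hv, ha, hmin v hv hv0, rfl⟩⟩, ?_⟩
      · ext n
        simp only [Pi.sub_apply, tau, Pi.zero_apply]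
        rw [hcst ha, hcst h1, heq, sub_self]
      · simp only [Pi.sub_apply, tau]
        rw [hcst ha (0 + e)]
    calc _ ≤ _ := Finset.card_le_card hsub
      _ ≤ _ := Finset.card_image_le
      _ < _ := Finset.card_erase_lt_of_mem hl1
  · intro g hg
    obtain ⟨v', hv', ha, hb, rfl⟩ := mem_leadSet.1 hg
    obtain ⟨v, hv, e, c, hv0, rfl⟩ := hV' v' hv'
    rw [dlt_iter_derived (by omega), dlt_iter_mono h1 (by omega), sub_zero,
      ((hV v hv).dlt_iter _).tau_eq_zero] at ha
    rw [dlt_iter_derived (by omega), dlt_iter_mono h1 (by omega), sub_zero] at hb ⊢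
    refine mem_leadSet.2 ⟨v, hv, ha, fun h0 => hb (by rw [h0]; rfl), ?_⟩
    simp only [tau]
    rw [hcst ha (0 + e)]

lemma toLex_lt_of_le {D : ℕ} {w w' : Fin D → ℕ} (i : Fin D) (hi : w' i < w i)
    (h : ∀ j < i, w' j ≤ w j) : toLex w' < toLex w := by
  classical
  have hex : ∃ n, ∃ j : Fin D, j.1 = n ∧ w' j ≠ w j := ⟨i, i, rfl, hi.ne⟩
  obtain ⟨j, hj, hne⟩ := Nat.find_spec hex
  have hmin : ∀ l < j, w' l = w l := by
    intro l hl
    by_contra hc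
    exact Nat.find_min hex (m := l.1) (by rw [← hj]; exact hl) ⟨l, rfl, hc⟩
  refine ⟨j, hmin, ?_⟩
  rcases lt_trichotomy j i with hji | rfl | hji
  · exact lt_of_le_of_ne (h j hji) hne
  · exact hi
  · exact absurd (hmin i hji) hi.ne

/-- The PET induction principle. -/
theorem pet_induction {P : Finset (ℕ → G) → Prop}
    (step : ∀ V, (∀ v ∈ V, IsPoly v) →
      (∀ V', (∀ v ∈ V', IsPoly v) → Derived V V' → P V') → P V) :
    ∀ V, (∀ v ∈ V, IsPoly v) → P V := by
  classical
  intro V hV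
  obtain ⟨D, hD⟩ : ∃ D, ∀ v ∈ V, dlt^[D + 1] v = 0 := by
    choose! d hd using hV
    refine ⟨V.sup d, fun v hv => dlt_iter_mono (hd v hv) ?_⟩
    exact (Finset.le_sup hv).trans (Nat.le_succ _)
  let wt : Finset (ℕ → G) → Lex (Fin D → ℕ) :=
    fun V => toLex fun j => (leadSet (D - j.1) V).card
  have key : ∀ w : Lex (Fin D → ℕ), ∀ V : Finset (ℕ → G), wt V = w → (∀ v ∈ V, IsPoly v) →
      (∀ v ∈ V, dlt^[D + 1] v = 0) → P V := by
    intro w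
    induction w using WellFoundedLT.induction with
    | _ w ih =>
      intro V hw hV hD
      refine step V hV fun V' hV' hder => ih (wt V') ?_ V' rfl hV' ?_
      · obtain ⟨i, hi, ⟨v, hv, hne⟩, hlt, hle⟩ := leadSet_derived hV hder
        have hiD : i ≤ D := by
          by_contra hc
          exact hne (dlt_iter_mono (hD v hv) (by omega))
        rw [← hw]
        refine toLex_lt_of_le ⟨D - i, by omega⟩ ?_ ?_
        · have : D - (D - i) = i := by omega
          simpa [this] using hlt
        · intro j hj
          have hj' : j.1 < D - i := hj
          exact hle _ (by omega)
      · obtain ⟨v₁, hv₁, i, hi, h1, h2, hmin, hder⟩ := hder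
        intro v' hv'
        obtain ⟨v, hv, e, c, hv0, rfl⟩ := hder v' hv'
        rw [dlt_iter_derived (by omega), hD v hv, hD v₁ hv₁, sub_zero]
        rfl
  exact key _ V rfl hV hD

/-- In a torsion-free group, a polynomial sequence that is constant along a translation is
linear. -/
lemma dlt_dlt_eq_zero_of_tau_sub [IsAddTorsionFree G] {v : ℕ → G} (hv : IsPoly v) {k : ℕ}
    (hk : 1 ≤ k) (h : dlt (tau k v - v) = 0) : dlt (dlt v) = 0 := by
  by_contra hne
  have hne1 : dlt v ≠ 0 := fun h0 => hne (by rw [h0, dlt_zero])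
  obtain ⟨d, hd1, hd2, hd3⟩ := hv.exists_deg hne1
  have hd : 2 ≤ d := by
    by_contra hlt
    have : d = 1 := by omega
    subst this
    exact hne hd2
  set u := dlt^[d - 1] v with hu
  have hu2 : dlt (dlt u) = 0 := by
    rw [hu, dlt_dlt_iter, dlt_dlt_iter, show d - 1 + 1 + 1 = d + 1 by omega, hd2]
  have hu1 : dlt u ≠ 0 := by
    rw [hu, dlt_dlt_iter, show d - 1 + 1 = d by omega]
    exact hd3
  have h0 : tau k u - u = 0 := by
    rw [hu, ← dlt_iter_tau, ← dlt_iter_sub]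
    exact dlt_iter_mono (d := 1) h (by omega)
  have hlin : ∀ n, u n = u 0 + n • dlt u 0 := by
    intro n
    induction n with
    | zero => simp
    | succ n ih =>
      have : dlt u n = dlt u 0 := eq_const_of_dlt_eq_zero hu2 n
      have h2 : u (n + 1) = u n + dlt u n := by simp [dlt]
      rw [h2, ih, this, add_smul, one_smul, add_assoc]
  have h3 : k • dlt u 0 = 0 := by
    have := congrFun h0 0
    simp only [tau, Pi.sub_apply, zero_add, Pi.zero_apply, hlin k] at this
    simpa using this
  have h4 : dlt u 0 = 0 := by
    rcases smul_eq_zero.1 h3 with h | h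
    · omega
    · exact h
  apply hu1
  ext n
  rw [eq_const_of_dlt_eq_zero hu2 n, h4]; rfl

end Poly

end PolyRec

namespace PolyRec

section Game

variable {G : Type} [AddCommGroup G]

/-- The sums available after the number `n` has been played. -/
def nextS (S : Finset ℕ) (n : ℕ) : Finset ℕ := S ∪ S.image (· + n)

open Classical in
/-- The translates available after the number `n` has been played in answer to `U`. -/
noncomputable def nextQ (Q : Finset G) (U : Finset (ℕ → G)) (n : ℕ) : Finset G :=
  Finset.image₂ (fun q u => q + u n) Q U

lemma mem_nextS {S : Finset ℕ} {n t : ℕ} : t ∈ nextS S n ↔ t ∈ S ∨ ∃ s ∈ S, s + n = t := by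
  simp [nextS]

lemma mem_nextQ {Q : Finset G} {U : Finset (ℕ → G)} {n : ℕ} {g : G} :
    g ∈ nextQ Q U n ↔ ∃ q ∈ Q, ∃ u ∈ U, q + u n = g := by
  classical
  simp [nextQ, Finset.mem_image₂]

/-- The first player, who names finite sets of polynomials, can force the property `P`
against a second player who names positive integers. -/
inductive Win (P : Finset ℕ → Finset G → Prop) : Finset ℕ → Finset G → Prop
  | done {S Q} : P S Q → Win P S Q
  | step {S Q} (U : Finset (ℕ → G)) : (∀ u ∈ U, IsPoly u ∧ u 0 = 0) → 0 ∈ U →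
      (∀ n, 1 ≤ n → Win P (nextS S n) (nextQ Q U n)) → Win P S Q

namespace Win

variable {P P' : Finset ℕ → Finset G → Prop} {S : Finset ℕ} {Q : Finset G}

lemma bind (h : Win P S Q) (hP : ∀ S Q, P S Q → Win P' S Q) : Win P' S Q := by
  induction h with
  | done h => exact hP _ _ h
  | step U hU h0 _ ih => exact .step U hU h0 ih

lemma mono (h : Win P S Q) (hP : ∀ S Q, P S Q → P' S Q) : Win P' S Q :=
  h.bind fun S Q hSQ => .done (hP S Q hSQ)

lemma with_zero_mem (h : Win P S Q) (h0 : 0 ∈ S) : Win (fun S Q => 0 ∈ S ∧ P S Q) S Q := by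
  induction h with
  | done h => exact .done ⟨h0, h⟩
  | step U hU hU0 _ ih => exact .step U hU hU0 fun n hn => ih n hn (mem_nextS.2 (.inl h0))

/-- Playing along an invariant the second player can maintain. -/
lemma exists_of_invariant {I : Finset ℕ → Finset G → Prop} (h : Win P S Q) (hI : I S Q)
    (hstep : ∀ S Q (U : Finset (ℕ → G)), I S Q → (∀ u ∈ U, IsPoly u ∧ u 0 = 0) → 0 ∈ U →
      ∃ n, 1 ≤ n ∧ I (nextS S n) (nextQ Q U n)) :
    ∃ S Q, I S Q ∧ P S Q := by
  induction h with
  | done h => exact ⟨_, _, hI, h⟩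
  | step U hU hU0 _ ih =>
    obtain ⟨n, hn, hn'⟩ := hstep _ _ U hI hU hU0
    exact ih n hn hn'

lemma simulate {S₂ : Finset ℕ} {Q₂ : Finset G} (h : Win P S₂ Q₂) (S₁ : Finset ℕ)
    (Q₁ : Finset G) {v₁ : ℕ → G} (hv₁ : IsPoly v₁) :
    ∀ S Q, (∀ s₁ ∈ S₁, ∀ s₂ ∈ S₂, s₁ + s₂ ∈ S) →
      (∀ q₁ ∈ Q₁, ∀ q₂ ∈ Q₂, ∀ s ∈ S₂, q₁ + q₂ - v₁ s ∈ Q) →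
      Win (fun S Q => ∃ S₂ Q₂, P S₂ Q₂ ∧ (∀ s₁ ∈ S₁, ∀ s₂ ∈ S₂, s₁ + s₂ ∈ S) ∧
        ∀ q₁ ∈ Q₁, ∀ q₂ ∈ Q₂, ∀ s ∈ S₂, q₁ + q₂ - v₁ s ∈ Q) S Q := by
  classical
  induction h with
  | @done S₂ Q₂ h => exact fun S Q hS hQ => .done ⟨S₂, Q₂, h, hS, hQ⟩
  | @step S₂ Q₂ U hU hU0 _ ih =>
    intro S Q hS hQ
    refine .step (U ∪ Finset.image₂ (fun u s => u - (tau s v₁ - fun _ => v₁ s)) U S₂) ?_ ?_ ?_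
    · intro u hu
      rcases Finset.mem_union.1 hu with hu | hu
      · exact hU u hu
      · obtain ⟨u', hu', s, hs, rfl⟩ := Finset.mem_image₂.1 hu
        refine ⟨(hU u' hu').1.sub ((hv₁.tau s).sub (IsPoly.const _)), ?_⟩
        simp [tau, (hU u' hu').2]
    · exact Finset.mem_union_left _ hU0
    · intro n hn
      refine ih n hn _ _ ?_ ?_
      · intro s₁ hs₁ s₂ hs₂
        rcases mem_nextS.1 hs₂ with hs₂ | ⟨s, hs, rfl⟩
        · exact mem_nextS.2 (.inl (hS _ hs₁ _ hs₂))
        · exact mem_nextS.2 (.inr ⟨_, hS _ hs₁ _ hs, by omega⟩)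
      · intro q₁ hq₁ q₂ hq₂ s hs
        obtain ⟨q, hq, u, hu, rfl⟩ := mem_nextQ.1 hq₂
        rcases mem_nextS.1 hs with hs | ⟨s, hs', rfl⟩
        · refine mem_nextQ.2 ⟨_, hQ _ hq₁ _ hq _ hs, u, Finset.mem_union_left _ hu, ?_⟩
          abel
        · refine mem_nextQ.2 ⟨_, hQ _ hq₁ _ hq _ hs', _,
            Finset.mem_union_right _ (Finset.mem_image₂_of_mem hu hs'), ?_⟩
          simp only [Pi.sub_apply, tau, add_comm n s]
          abel

end Win

/-- Every colouring has a monochromatic configuration `a`, `a + v s` inside `Q`. -/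
def Mono (κ : Type) (V : Finset (ℕ → G)) (S : Finset ℕ) (Q : Finset G) : Prop :=
  ∀ c : G → κ, ∃ a ∈ Q, ∃ s ∈ S, s ≠ 0 ∧ ∀ v ∈ V, a + v s ∈ Q ∧ c (a + v s) = c a

/-- Every colouring has a monochromatic configuration or `l` colour-focused ones. -/
def Foc (κ : Type) (V : Finset (ℕ → G)) (l : ℕ) (S : Finset ℕ) (Q : Finset G) : Prop :=
  ∀ c : G → κ, (∃ a ∈ Q, ∃ s ∈ S, s ≠ 0 ∧ ∀ v ∈ V, a + v s ∈ Q ∧ c (a + v s) = c a) ∨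
    ∃ a ∈ Q, ∃ C : Finset κ, C.card = l ∧
      ∀ k ∈ C, ∃ s ∈ S, s ≠ 0 ∧ ∀ v ∈ V, a + v s ∈ Q ∧ c (a + v s) = k

lemma Foc.mono {κ : Type} [Fintype κ] {V : Finset (ℕ → G)} {S : Finset ℕ} {Q : Finset G}
    (h : Foc κ V (Fintype.card κ) S Q) : Mono κ V S Q := by
  intro c
  rcases h c with h | ⟨a, ha, C, hC, h⟩
  · exact h
  · obtain ⟨s, hs, hs0, h⟩ := h (c a) (by
      rw [(Finset.card_eq_iff_eq_univ C).1 hC]; exact Finset.mem_univ _)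
    exact ⟨a, ha, s, hs, hs0, h⟩

/-- The polynomials needed for one focusing step. -/
lemma foc_succ {κ : Type} {V V' : Finset (ℕ → G)} {v₁ : ℕ → G} {l : ℕ}
    {S₁ S₂ S : Finset ℕ} {Q₁ Q₂ Q : Finset G} (hV0 : ∀ v ∈ V, v 0 = 0) (hv₁ : v₁ 0 = 0)
    (hV' : ∀ v ∈ V, ∀ e ∈ S₁, (fun n => v (n + e) - v₁ n + (-v e)) ∈ V' ∨
      (fun n => v (n + e) - v₁ n + (-v e)) = 0)
    (h0 : 0 ∈ S₁) (h0' : 0 ∈ S₂) (h₁ : Foc κ V l S₁ Q₁) (h₂ : Mono (Q₁ → κ) V' S₂ Q₂)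
    (hS : ∀ s₁ ∈ S₁, ∀ s₂ ∈ S₂, s₁ + s₂ ∈ S)
    (hQ : ∀ q₁ ∈ Q₁, ∀ q₂ ∈ Q₂, ∀ s ∈ S₂, q₁ + q₂ - v₁ s ∈ Q) :
    Foc κ V (l + 1) S Q := by
  classical
  intro c
  obtain ⟨a₂, ha₂, s₂, hs₂, hs₂0, h₂⟩ := h₂ fun g q => c (g + q)
  have hQ' : ∀ q₁ ∈ Q₁, ∀ q₂ ∈ Q₂, q₁ + q₂ ∈ Q := by
    intro q₁ hq₁ q₂ hq₂
    have := hQ q₁ hq₁ q₂ hq₂ 0 h0'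
    rwa [hv₁, sub_zero] at this
  have hS' : ∀ s ∈ S₁, s ∈ S := fun s hs => hS s hs 0 h0'
  have key : ∀ v ∈ V, ∀ e ∈ S₁, ∀ q ∈ Q₁,
      q + a₂ - v₁ s₂ + (v (e + s₂) - v e) ∈ Q ∧
        c (q + a₂ - v₁ s₂ + (v (e + s₂) - v e)) = c (q + a₂) := by
    intro v hv e he q hq
    set w : ℕ → G := fun n => v (n + e) - v₁ n + (-v e) with hw
    have h3 : a₂ + w s₂ ∈ Q₂ ∧ c (a₂ + w s₂ + q) = c (a₂ + q) := by
      rcases hV' v hv e he with h | h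
      · exact ⟨(h₂ w h).1, congrFun (h₂ w h).2 ⟨q, hq⟩⟩
      · have : w s₂ = 0 := congrFun h s₂
        rw [this, add_zero]
        exact ⟨ha₂, rfl⟩
    have h4 : q + a₂ - v₁ s₂ + (v (e + s₂) - v e) = q + (a₂ + w s₂) := by
      rw [hw, add_comm e s₂]; simp only; abel
    rw [h4]
    refine ⟨hQ' _ hq _ h3.1, ?_⟩
    rw [add_comm q, h3.2, add_comm]
  rcases h₁ fun g => c (g + a₂) with ⟨a₁, ha₁, s, hs, hs0, h⟩ | ⟨a₁, ha₁, C, hC, h⟩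
  · refine .inl ⟨a₁ + a₂, hQ' _ ha₁ _ ha₂, s, hS' s hs, hs0, fun v hv => ?_⟩
    rw [add_right_comm]
    exact ⟨hQ' _ (h v hv).1 _ ha₂, (h v hv).2⟩
  · by_cases hmem : c (a₁ + a₂) ∈ C
    · obtain ⟨s, hs, hs0, h⟩ := h _ hmem
      refine .inl ⟨a₁ + a₂, hQ' _ ha₁ _ ha₂, s, hS' s hs, hs0, fun v hv => ?_⟩
      rw [add_right_comm]
      exact ⟨hQ' _ (h v hv).1 _ ha₂, (h v hv).2⟩
    · refine .inr ⟨a₁ + a₂ - v₁ s₂, hQ _ ha₁ _ ha₂ _ hs₂, insert (c (a₁ + a₂)) C, ?_, ?_⟩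
      · rw [Finset.card_insert_of_notMem hmem, hC]
      · intro k hk
        rcases Finset.mem_insert.1 hk with rfl | hk
        · refine ⟨s₂, by simpa using hS 0 h0 s₂ hs₂, hs₂0, fun v hv => ?_⟩
          have := key v hv 0 h0 a₁ ha₁
          rwa [hV0 v hv, zero_add, sub_zero] at this
        · obtain ⟨s, hs, hs0, h⟩ := h k hk
          refine ⟨s + s₂, hS s hs s₂ hs₂, by omega, fun v hv => ?_⟩
          have h5 := key v hv s hs (a₁ + v s) (h v hv).1
          have h6 : a₁ + v s + a₂ - v₁ s₂ + (v (s + s₂) - v s) =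
            a₁ + a₂ - v₁ s₂ + v (s + s₂) := by abel
          rw [h6, (h v hv).2] at h5
          exact h5

lemma dlt_ne_zero_of_ne_zero {v : ℕ → G} (h0 : v 0 = 0) (h : v ≠ 0) : dlt v ≠ 0 := by
  intro hd
  apply h
  ext n
  rw [eq_const_of_dlt_eq_zero hd, h0]; rfl

/-- The polynomial van der Waerden game. -/
theorem win_mono (V : Finset (ℕ → G)) (hV : ∀ v ∈ V, IsPoly v)
    (hV0 : ∀ v ∈ V, v 0 = 0 ∧ v ≠ 0) (κ : Type) [Finite κ] : Win (Mono κ V) {0} {0} := by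
  classical
  revert hV0 κ
  revert V
  refine pet_induction (P := fun V => (∀ v ∈ V, v 0 = 0 ∧ v ≠ 0) → ∀ (κ : Type) [Finite κ],
    Win (Mono κ V) {0} {0}) fun V hV ih hV0 κ _ => ?_
  cases nonempty_fintype κ
  rcases V.eq_empty_or_nonempty with rfl | ⟨v₀, hv₀⟩
  · refine .step {0} (by simp [IsPoly.zero]) (by simp) fun n hn => .done fun c => ?_
    exact ⟨0, mem_nextQ.2 ⟨0, by simp, 0, by simp, by simp⟩, n,
      mem_nextS.2 (.inr ⟨0, by simp, by simp⟩), by omega, by simp⟩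
  · have hd : ∀ v ∈ V, dlt v ≠ 0 := fun v hv => dlt_ne_zero_of_ne_zero (hV0 v hv).1 (hV0 v hv).2
    obtain ⟨v₁, hv₁, -, i, hi, hi1, hi2, hmin⟩ := exists_min_deg hV ⟨v₀, hv₀, hd v₀ hv₀⟩
    have hfoc : ∀ l, Win (fun S Q => 0 ∈ S ∧ Foc κ V l S Q) {0} {0} := by
      intro l
      induction l with
      | zero =>
        exact .done ⟨by simp, fun c => .inr ⟨0, by simp, ∅, rfl, by simp⟩⟩
      | succ l ihl =>
        refine ihl.bind fun S₁ Q₁ ⟨h0, h₁⟩ => ?_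
        let V' : Finset (ℕ → G) := (Finset.image₂
          (fun v e => fun n => v (n + e) - v₁ n + (-v e)) V S₁).erase 0
        have hpoly : ∀ v ∈ V', IsPoly v := by
          intro v' hv'
          obtain ⟨v, hv, e, he, rfl⟩ := Finset.mem_image₂.1 (Finset.mem_of_mem_erase hv')
          exact (((hV v hv).tau e).sub (hV v₁ hv₁)).add (IsPoly.const _)
        have hder : Derived V V' := by
          refine ⟨v₁, hv₁, i, hi, hi1, hi2, hmin, fun v' hv' => ?_⟩
          obtain ⟨v, hv, e, he, rfl⟩ := Finset.mem_image₂.1 (Finset.mem_of_mem_erase hv')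
          exact ⟨v, hv, e, _, hd v hv, rfl⟩
        have hwin := ih V' hpoly hder (by
          intro v' hv'
          refine ⟨?_, Finset.ne_of_mem_erase hv'⟩
          obtain ⟨v, hv, e, he, rfl⟩ := Finset.mem_image₂.1 (Finset.mem_of_mem_erase hv')
          simp [(hV0 v₁ hv₁).1]) (Q₁ → κ)
        refine (((hwin.with_zero_mem (by simp)).simulate S₁ Q₁ (hV v₁ hv₁) S₁ Q₁ (by simp)
          (by simp [(hV0 v₁ hv₁).1])).with_zero_mem h0).mono ?_
        rintro S Q ⟨h0S, S₂, Q₂, ⟨h0', h₂⟩, hS, hQ⟩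
        refine ⟨h0S, foc_succ (V' := V') (fun v hv => (hV0 v hv).1) (hV0 v₁ hv₁).1 ?_ h0 h0' h₁ h₂
          hS hQ⟩
        intro v hv e he
        by_cases hz : (fun n => v (n + e) - v₁ n + (-v e)) = 0
        · exact .inr hz
        · exact .inl (Finset.mem_erase.2 ⟨hz, Finset.mem_image₂_of_mem hv he⟩)
    exact (hfoc (Fintype.card κ)).mono fun S Q h => h.2.mono

end Game

end PolyRec

namespace PolyRec

section VanDerCorput

open MeasureTheory Filter Finset

lemma abs_sum_sub_sum_shift_le {y : ℕ → ℝ} (hy : ∀ n, |y n| ≤ 1) (N h : ℕ) :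
    |∑ n ∈ range N, y n - ∑ n ∈ range N, y (n + h)| ≤ 2 * h := by
  induction h with
  | zero => simp
  | succ h ih =>
    have h1 : ∑ n ∈ range N, y (n + h) - ∑ n ∈ range N, y (n + (h + 1)) = y h - y (N + h) := by
      have := Finset.sum_range_sub' (fun n => y (n + h)) N
      rw [← Finset.sum_sub_distrib]
      simp only [zero_add] at this
      rw [← this]
      refine Finset.sum_congr rfl fun n _ => ?_
      rw [show n + (h + 1) = n + 1 + h by ring]
    have h2 : |y h - y (N + h)| ≤ 2 := by
      have := abs_sub (y h) (y (N + h))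
      linarith [hy h, hy (N + h)]
    rw [← h1] at h2
    have := abs_sub_le (∑ n ∈ range N, y n) (∑ n ∈ range N, y (n + h))
      (∑ n ∈ range N, y (n + (h + 1)))
    push_cast
    linarith

lemma avg_sq_le {y : ℕ → ℝ} (hy : ∀ n, |y n| ≤ 1) {N H : ℕ} (hN : 1 ≤ N) (hH : 1 ≤ H) :
    ((∑ n ∈ range N, y n) / N) ^ 2 ≤ 8 * (H / N : ℝ) ^ 2 +
      2 / N * ∑ n ∈ range N, ((∑ h ∈ range H, y (n + h)) / H) ^ 2 := by
  have hN' : (0 : ℝ) < N := by exact_mod_cast hN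
  have hH' : (0 : ℝ) < H := by exact_mod_cast hH
  set A := ∑ n ∈ range N, y n with hA
  set z : ℕ → ℝ := fun n => (∑ h ∈ range H, y (n + h)) / H with hz
  have h1 : |A - ∑ n ∈ range N, z n| ≤ 2 * H := by
    have e1 : A - ∑ n ∈ range N, z n =
        (∑ h ∈ range H, (A - ∑ n ∈ range N, y (n + h))) / H := by
      rw [Finset.sum_sub_distrib, Finset.sum_const, card_range, nsmul_eq_mul, sub_div,
        mul_div_cancel_left₀ _ hH'.ne', Finset.sum_comm, hz, Finset.sum_div]
    rw [e1, abs_div, abs_of_pos hH', div_le_iff₀ hH']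
    refine (Finset.abs_sum_le_sum_abs _ _).trans ?_
    calc _ ≤ ∑ h ∈ range H, (2 * H : ℝ) := by
          refine Finset.sum_le_sum fun h hh => (abs_sum_sub_sum_shift_le hy N h).trans ?_
          have : (h : ℝ) ≤ H := by exact_mod_cast (Finset.mem_range.1 hh).le
          linarith
      _ = 2 * H * H := by rw [Finset.sum_const, card_range, nsmul_eq_mul]; ring
  have h2 : (∑ n ∈ range N, z n) ^ 2 ≤ N * ∑ n ∈ range N, z n ^ 2 := by
    simpa using sq_sum_le_card_mul_sum_sq (s := range N) (f := z)
  have h3 : A ^ 2 ≤ 8 * H ^ 2 + 2 * (N * ∑ n ∈ range N, z n ^ 2) := by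
    have h4 : (A - ∑ n ∈ range N, z n) ^ 2 ≤ (2 * H) ^ 2 := by
      rw [← sq_abs]; gcongr
    nlinarith [sq_nonneg (A - 2 * ∑ n ∈ range N, z n)]
  rw [div_pow, div_le_iff₀ (by positivity)]
  calc A ^ 2 ≤ _ := h3
    _ = (8 * (H / N : ℝ) ^ 2 + 2 / N * ∑ n ∈ range N, z n ^ 2) * N ^ 2 := by field_simp

lemma sum_symm_le {ρ : ℕ → ℝ} (hρ : ∀ k, 0 ≤ ρ k) (H h : ℕ) (hh : h < H) :
    ∑ h' ∈ range H, ρ ((h' - h) + (h - h')) ≤ 2 * ∑ k ∈ range H, ρ k := by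
  rw [← Finset.sum_range_add_sum_Ico _ hh.le, two_mul]
  refine add_le_add ?_ ?_
  · rw [← Finset.sum_range_reflect]
    calc _ = ∑ k ∈ range h, ρ (k + 1) := by
          refine Finset.sum_congr rfl fun k hk => ?_
          have := Finset.mem_range.1 hk
          congr 1; omega
      _ ≤ ∑ k ∈ range (h + 1), ρ k := by
          rw [Finset.sum_range_succ']
          linarith [hρ 0]
      _ ≤ _ := Finset.sum_le_sum_of_subset_of_nonneg (Finset.range_mono hh) fun k _ _ => hρ k
  · rw [Finset.sum_Ico_eq_sum_range]
    calc _ = ∑ k ∈ range (H - h), ρ k := by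
          refine Finset.sum_congr rfl fun k hk => ?_
          congr 1; omega
      _ ≤ _ := Finset.sum_le_sum_of_subset_of_nonneg (Finset.range_mono (by omega))
        fun k _ _ => hρ k

variable {X : Type*} [MeasurableSpace X] {μ : Measure X}

lemma integrable_of_abs_le [IsFiniteMeasure μ] {f : X → ℝ} (hf : Measurable f) {C : ℝ}
    (h : ∀ x, |f x| ≤ C) : Integrable f μ :=
  Integrable.of_bound hf.aestronglyMeasurable C (ae_of_all _ h)

/-- Van der Corput's inequality, uniformly over windows and over a class of sequences. -/
theorem van_der_corput [IsProbabilityMeasure μ] {ρ : ℕ → ℝ} (hρ : ∀ k, 0 ≤ ρ k) (hρ0 : ρ 0 = 1)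
    (hlim : Tendsto (fun H : ℕ => (∑ k ∈ range H, ρ k) / H) atTop (nhds 0))
    {C : Set (ℕ → X → ℝ)} (hmeas : ∀ x ∈ C, ∀ n, Measurable (x n))
    (hbd : ∀ x ∈ C, ∀ n a, |x n a| ≤ 1)
    (hcor : ∀ k, 1 ≤ k → ∀ ε > 0, ∃ L : ℕ, ∀ N ≥ L, ∀ x ∈ C, ∀ M,
      ∑ n ∈ range N, ∫ a, x (M + n) a * x (M + n + k) a ∂μ ≤ N * (ρ k + ε))
    {ε : ℝ} (hε : 0 < ε) :
    ∃ L : ℕ, ∀ N ≥ L, ∀ x ∈ C, ∀ M,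
      ∫ a, ((∑ n ∈ range N, x (M + n) a) / N) ^ 2 ∂μ ≤ ε := by
  obtain ⟨H, hH1, hH2⟩ : ∃ H : ℕ, 1 ≤ H ∧ (∑ k ∈ range H, ρ k) / H ≤ ε / 16 :=
    (((eventually_ge_atTop 1).and (hlim.eventually_le_const (by positivity))).exists)
  have hcor' : ∀ k, ∃ L : ℕ, ∀ N ≥ L, ∀ x ∈ C, ∀ M,
      ∑ n ∈ range N, ∫ a, x (M + n) a * x (M + n + k) a ∂μ ≤ N * (ρ k + ε / 8) := by
    intro k
    rcases Nat.eq_zero_or_pos k with rfl | hk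
    · refine ⟨0, fun N _ x hx M => ?_⟩
      calc _ ≤ ∑ n ∈ range N, (1 : ℝ) := by
            refine Finset.sum_le_sum fun n _ => ?_
            calc _ ≤ ∫ a, (1 : ℝ) ∂μ := by
                  refine integral_mono (integrable_of_abs_le (C := 1) (by
                    exact (hmeas x hx _).mul (hmeas x hx _)) fun a => ?_) (by simp) fun a => ?_
                  · rw [abs_mul]
                    exact mul_le_one₀ (hbd x hx _ _) (abs_nonneg _) (hbd x hx _ _)
                  · have := abs_le.1 (hbd x hx (M + n) a)
                    simp only [add_zero]
                    nlinarith
              _ = 1 := by simp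
        _ = N := by simp
        _ ≤ _ := by rw [hρ0]; nlinarith [(Nat.cast_nonneg N : (0 : ℝ) ≤ N)]
    · exact hcor k hk _ (by positivity)
  choose L hL using hcor'
  obtain ⟨L', hL'⟩ : ∃ L' : ℕ, ∀ N ≥ L', 8 * (H / N : ℝ) ^ 2 ≤ ε / 4 := by
    have : Tendsto (fun N : ℕ => 8 * (H / N : ℝ) ^ 2) atTop (nhds (8 * 0 ^ 2)) :=
      ((tendsto_const_div_atTop_nhds_zero_nat (H : ℝ)).pow 2).const_mul 8
    simp only [ne_eq, OfNat.ofNat_ne_zero, not_false_eq_true, zero_pow, mul_zero] at this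
    exact eventually_atTop.1 (this.eventually_le_const (by positivity))
  refine ⟨max (max L' 1) ((range H).sup L), fun N hN x hx M => ?_⟩
  have hN1 : 1 ≤ N := le_trans (le_trans (le_max_right _ _) (le_max_left _ _)) hN
  have hNL' : L' ≤ N := le_trans (le_trans (le_max_left _ _) (le_max_left _ _)) hN
  have hNL : ∀ k < H, L k ≤ N := fun k hk =>
    le_trans (le_trans (Finset.le_sup (Finset.mem_range.2 hk)) (le_max_right _ _)) hN
  have hN' : (0 : ℝ) < N := by exact_mod_cast hN1
  have hH' : (0 : ℝ) < H := by exact_mod_cast hH1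
  have hint : ∀ i j, Integrable (fun a => x i a * x j a) μ := fun i j =>
    integrable_of_abs_le (C := 1) ((hmeas x hx i).mul (hmeas x hx j)) fun a => by
      rw [abs_mul]; exact mul_le_one₀ (hbd x hx _ _) (abs_nonneg _) (hbd x hx _ _)
  have hexp : ∀ (s : Finset ℕ) (f : ℕ → ℕ) (c : ℝ) (a : X), ((∑ n ∈ s, x (f n) a) / c) ^ 2 =
      (∑ n ∈ s, ∑ m ∈ s, x (f n) a * x (f m) a) / c ^ 2 := by
    intro s f c a
    rw [div_pow, sq (∑ n ∈ s, x (f n) a), Finset.sum_mul_sum]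
  have hint2 : ∀ (s : Finset ℕ) (f : ℕ → ℕ) (c : ℝ),
      Integrable (fun a => ((∑ n ∈ s, x (f n) a) / c) ^ 2) μ := by
    intro s f c
    simp only [hexp]
    exact (integrable_finsetSum _ fun n _ => integrable_finsetSum _ fun m _ => hint _ _).div_const _
  have hpair : ∀ h < H, ∀ h' < H, ∑ n ∈ range N, ∫ a, x (M + n + h) a * x (M + n + h') a ∂μ ≤
      N * (ρ ((h' - h) + (h - h')) + ε / 8) := by
    have hle : ∀ h h', h ≤ h' → h' < H → ∑ n ∈ range N, ∫ a, x (M + n + h) a * x (M + n + h') a ∂μ ≤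
      N * (ρ ((h' - h) + (h - h')) + ε / 8) := by
      intro h h' hle hlt
      have := hL (h' - h) N (hNL _ (by omega)) x hx (M + h)
      rw [show h - h' = 0 by omega, add_zero]
      refine le_trans (le_of_eq ?_) this
      refine Finset.sum_congr rfl fun n _ => ?_
      rw [show M + n + h = M + h + n by omega, show M + n + h' = M + h + n + (h' - h) by omega]
    intro h hh h' hh'
    rcases le_total h h' with hl | hl
    · exact hle h h' hl hh'
    · rw [add_comm (h' - h)]
      simp only [mul_comm (x (M + _ + h) _)]
      exact hle h' h hl hh
  calc ∫ a, ((∑ n ∈ range N, x (M + n) a) / N) ^ 2 ∂μ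
      ≤ ∫ a, (8 * (H / N : ℝ) ^ 2 +
        2 / N * ∑ n ∈ range N, ((∑ h ∈ range H, x (M + n + h) a) / H) ^ 2) ∂μ := by
        refine integral_mono (hint2 _ _ _) ?_ fun a => ?_
        · exact (integrable_const _).add ((integrable_finsetSum _ fun n _ =>
            hint2 _ (fun h => M + n + h) _).const_mul _)
        · have := avg_sq_le (y := fun n => x (M + n) a) (fun n => hbd x hx _ a) hN1 hH1
          simpa only [add_assoc] using this
    _ = 8 * (H / N : ℝ) ^ 2 + 2 / N * ((∑ h ∈ range H, ∑ h' ∈ range H, ∑ n ∈ range N,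
          ∫ a, x (M + n + h) a * x (M + n + h') a ∂μ) / H ^ 2) := by
        rw [integral_add (integrable_const _) ((integrable_finsetSum _ fun n _ =>
            hint2 _ (fun h => M + n + h) _).const_mul _), integral_const, integral_const_mul,
          integral_finsetSum _ fun n _ => hint2 _ (fun h => M + n + h) _]
        simp only [probReal_univ, one_smul]
        congr 2
        have : ∀ n, ∫ a, ((∑ h ∈ range H, x (M + n + h) a) / H) ^ 2 ∂μ =
            (∑ h ∈ range H, ∑ h' ∈ range H, ∫ a, x (M + n + h) a * x (M + n + h') a ∂μ) / H ^ 2 := by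
          intro n
          simp only [hexp (range H) (fun h => M + n + h)]
          rw [integral_div, integral_finsetSum _ fun h _ => integrable_finsetSum _ fun m _ => hint _ _]
          congr 1
          refine Finset.sum_congr rfl fun h _ => ?_
          rw [integral_finsetSum _ fun m _ => hint _ _]
        simp only [this]
        rw [← Finset.sum_div, Finset.sum_comm]
        congr 1
        refine Finset.sum_congr rfl fun h _ => ?_
        rw [Finset.sum_comm]
    _ ≤ ε / 4 + 2 / N * ((∑ h ∈ range H, ∑ h' ∈ range H,
          N * (ρ ((h' - h) + (h - h')) + ε / 8)) / H ^ 2) := by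
        gcongr with h hh h' hh'
        · exact hL' N hNL'
        · exact hpair h (Finset.mem_range.1 hh) h' (Finset.mem_range.1 hh')
    _ ≤ ε / 4 + 2 / N * ((∑ h ∈ range H, N * (2 * ∑ k ∈ range H, ρ k + H * (ε / 8))) / H ^ 2) := by
        gcongr with h hh
        rw [← Finset.mul_sum, Finset.sum_add_distrib]
        gcongr
        · exact sum_symm_le hρ H h (Finset.mem_range.1 hh)
        · simp
    _ = ε / 4 + 4 * ((∑ k ∈ range H, ρ k) / H) + ε / 4 := by
        rw [Finset.sum_const, card_range, nsmul_eq_mul]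
        field_simp
        ring
    _ ≤ ε := by linarith

end VanDerCorput

end PolyRec

namespace PolyRec

section Kernel

open MeasureTheory ProbabilityTheory Filter

variable {X : Type} {m : MeasurableSpace X} [mX : MeasurableSpace X] [StandardBorelSpace X]
  {μ : Measure X} [IsProbabilityMeasure μ]

/-- The conditional expectation onto `m`, computed through the disintegration of `μ`. -/
noncomputable def ce {X : Type} (m : MeasurableSpace X) [mX : MeasurableSpace X]
    [StandardBorelSpace X] (μ : Measure X) [IsProbabilityMeasure μ] (f : X → ℝ) : X → ℝ :=
  fun x => ∫ y, f y ∂(condExpKernel μ m x)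

variable {f u : X → ℝ} {C D : ℝ}

omit [StandardBorelSpace X] in
lemma integrable_mul_of_abs_le (hf : Measurable f) (hC : ∀ x, |f x| ≤ C)
    (hu : Measurable u) (hD : ∀ x, |u x| ≤ D) : Integrable (fun x => f x * u x) μ :=
  integrable_of_abs_le (C := C * D) (hf.mul hu) fun x => by
    rw [abs_mul]
    exact mul_le_mul (hC x) (hD x) (abs_nonneg _) ((abs_nonneg _).trans (hC x))

lemma measurable_ce (hf : Measurable f) : Measurable[m] (ce m μ f) :=
  (hf.stronglyMeasurable.integral_condExpKernel).measurable

lemma measurable_ce' (hm : m ≤ mX) (hf : Measurable f) : Measurable (ce m μ f) :=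
  (measurable_ce hf).mono hm le_rfl

lemma abs_ce_le (hC : ∀ x, |f x| ≤ C) (x : X) : |ce m μ f x| ≤ C := by
  have := norm_integral_le_of_norm_le_const (μ := condExpKernel μ m x) (f := f) (C := C)
    (ae_of_all _ hC)
  simpa [ce] using this

lemma ce_ae_eq_condExp (hm : m ≤ mX) (hf : Measurable f) (hC : ∀ x, |f x| ≤ C) :
    ce m μ f =ᵐ[μ] μ[f | m] :=
  (condExp_ae_eq_integral_condExpKernel hm (integrable_of_abs_le hf hC)).symm

lemma integral_ce (hm : m ≤ mX) (hf : Measurable f) (hC : ∀ x, |f x| ≤ C) :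
    ∫ x, ce m μ f x ∂μ = ∫ x, f x ∂μ := by
  rw [integral_congr_ae (ce_ae_eq_condExp hm hf hC), integral_condExp hm]

lemma ce_mul (hm : m ≤ mX) (hf : Measurable f) (hC : ∀ x, |f x| ≤ C)
    (hu : Measurable[m] u) (hD : ∀ x, |u x| ≤ D) :
    ce m μ (fun x => u x * f x) =ᵐ[μ] fun x => u x * ce m μ f x := by
  have hu' : Measurable u := hu.mono hm le_rfl
  have h1 : ∀ x, |u x * f x| ≤ D * C := fun x => by
    rw [abs_mul]; exact mul_le_mul (hD x) (hC x) (abs_nonneg _) ((abs_nonneg _).trans (hD x))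
  have h2 := condExp_mul_of_stronglyMeasurable_left (μ := μ) (m := m) (f := u) (g := f)
    hu.stronglyMeasurable (integrable_of_abs_le (hu'.mul hf) h1) (integrable_of_abs_le hf hC)
  filter_upwards [ce_ae_eq_condExp hm (hu'.mul hf) h1, h2, ce_ae_eq_condExp hm hf hC]
    with x h3 h4 h5
  have h3' : ce m μ (fun x => u x * f x) x = (μ[u * f | m]) x := h3
  rw [h3', h4, Pi.mul_apply, h5]

lemma ce_of_measurable (hm : m ≤ mX) (hu : Measurable[m] u) (hD : ∀ x, |u x| ≤ D) :
    ce m μ u =ᵐ[μ] u := by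
  have hu' : Measurable u := hu.mono hm le_rfl
  refine (ce_ae_eq_condExp hm hu' hD).trans ?_
  rw [condExp_of_stronglyMeasurable hm hu.stronglyMeasurable (integrable_of_abs_le hu' hD)]

lemma integral_mul_ce (hm : m ≤ mX) (hf : Measurable f) (hC : ∀ x, |f x| ≤ C)
    (hu : Measurable[m] u) (hD : ∀ x, |u x| ≤ D) :
    ∫ x, u x * ce m μ f x ∂μ = ∫ x, u x * f x ∂μ := by
  rw [← integral_congr_ae (ce_mul hm hf hC hu hD)]
  refine integral_ce (C := D * C) hm ((hu.mono hm le_rfl).mul hf) fun x => ?_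
  rw [abs_mul]; exact mul_le_mul (hD x) (hC x) (abs_nonneg _) ((abs_nonneg _).trans (hD x))

lemma ce_unique (hm : m ≤ mX) (hf : Measurable f) (hC : ∀ x, |f x| ≤ C)
    (hu : Measurable[m] u) (hD : ∀ x, |u x| ≤ D)
    (h : ∀ s, MeasurableSet[m] s → ∫ x in s, u x ∂μ = ∫ x in s, f x ∂μ) :
    ce m μ f =ᵐ[μ] u := by
  refine (ce_ae_eq_condExp hm hf hC).trans ?_
  symm
  refine ae_eq_condExp_of_forall_setIntegral_eq hm (integrable_of_abs_le hf hC) ?_ ?_ ?_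
  · intro s _ _
    exact (integrable_of_abs_le (hu.mono hm le_rfl) hD).integrableOn
  · intro s hs _; exact h s hs
  · exact hu.aestronglyMeasurable

lemma ae_ae_ker (hm : m ≤ mX) {p : X → Prop} (h : ∀ᵐ x ∂μ, p x) :
    ∀ᵐ x ∂μ, ∀ᵐ y ∂(condExpKernel μ m x), p y := by
  have h1 : ∀ᵐ x ∂(condExpKernel μ m ∘ₘ μ.trim hm), p x := by
    rwa [condExpKernel_comp_trim]
  exact ae_of_ae_trim hm (Measure.ae_ae_of_ae_comp h1)

lemma ce_congr (hm : m ≤ mX) {g : X → ℝ} (h : f =ᵐ[μ] g) : ce m μ f =ᵐ[μ] ce m μ g := by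
  filter_upwards [ae_ae_ker hm h] with x hx
  exact integral_congr_ae hx

/-- An `m`-measurable function is constant on the fibres of the disintegration over `m`. -/
lemma ker_const (hm : m ≤ mX) (hu : Measurable[m] u) (hD : ∀ x, |u x| ≤ D) :
    ∀ᵐ x ∂μ, ∀ᵐ y ∂(condExpKernel μ m x), u y = u x := by
  have hu' : Measurable u := hu.mono hm le_rfl
  have hu2 : Measurable[m] fun x => u x * u x := hu.mul hu
  have hb : ∀ x, |u x * u x| ≤ D * D := fun x => by
    rw [abs_mul]; exact mul_le_mul (hD x) (hD x) (abs_nonneg _) ((abs_nonneg _).trans (hD x))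
  filter_upwards [ce_of_measurable (μ := μ) hm hu hD, ce_of_measurable (μ := μ) hm hu2 hb]
    with x h1 h2
  have i1 : Integrable u (condExpKernel μ m x) := integrable_of_abs_le hu' hD
  have i2 : Integrable (fun y => u y * u y) (condExpKernel μ m x) :=
    integrable_of_abs_le (hu'.mul hu') hb
  have h3 : ∫ y, (u y - u x) ^ 2 ∂(condExpKernel μ m x) = 0 := by
    have : ∀ y, (u y - u x) ^ 2 = u y * u y - 2 * u x * u y + u x * u x := fun y => by ring
    simp only [this]
    have i3 : Integrable (fun y => u y * u y - 2 * u x * u y) (condExpKernel μ m x) :=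
      i2.sub (i1.const_mul _)
    rw [integral_add i3 (integrable_const _), integral_sub i2 (i1.const_mul _),
      integral_const_mul, integral_const]
    simp only [probReal_univ, one_smul]
    change ce m μ u x = u x at h1
    change ce m μ (fun x => u x * u x) x = u x * u x at h2
    rw [show ∫ y, u y * u y ∂(condExpKernel μ m x) = u x * u x from h2,
      show ∫ y, u y ∂(condExpKernel μ m x) = u x from h1]
    ring
  have h4 := (integral_eq_zero_iff_of_nonneg (fun y => sq_nonneg (u y - u x)) (by
    refine integrable_of_abs_le (C := (2 * D) ^ 2) ((hu'.sub measurable_const).pow_const 2)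
      fun y => ?_
    rw [abs_pow]
    have := abs_sub (u y) (u x)
    have := hD y
    have := hD x
    gcongr
    linarith)).1 h3
  filter_upwards [h4] with y hy
  have : u y - u x = 0 := by simpa using hy
  linarith

variable {G : Type} [AddCommGroup G]

/-- A measure-preserving action of `G`. -/
structure Sys (G : Type) [AddCommGroup G] {X : Type} [MeasurableSpace X] (μ : Measure X) where
  T : G → X → X
  mp : ∀ g, MeasurePreserving (T g) μ μ
  zero : ∀ x, T 0 x = x
  add : ∀ g h x, T (g + h) x = T g (T h x)

/-- A factor: an invariant sub-σ-algebra. -/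
structure Sys.IsFactor {X : Type} (m : MeasurableSpace X) [mX : MeasurableSpace X]
    {μ : Measure X} (S : Sys G μ) : Prop where
  le : m ≤ mX
  meas : ∀ g, Measurable[m, m] (S.T g)

namespace Sys

omit [StandardBorelSpace X] [IsProbabilityMeasure μ] in
lemma meas (S : Sys G μ) (g : G) : Measurable (S.T g) := (S.mp g).measurable

omit [StandardBorelSpace X] [IsProbabilityMeasure μ] in
lemma neg_apply (S : Sys G μ) (g : G) (x : X) : S.T (-g) (S.T g x) = x := by
  rw [← S.add, neg_add_cancel, S.zero]

omit [StandardBorelSpace X] [IsProbabilityMeasure μ] in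
lemma apply_neg (S : Sys G μ) (g : G) (x : X) : S.T g (S.T (-g) x) = x := by
  rw [← S.add, add_neg_cancel, S.zero]

omit [StandardBorelSpace X] [IsProbabilityMeasure μ] in
lemma integral_comp (S : Sys G μ) (g : G) (f : X → ℝ) :
    ∫ x, f (S.T g x) ∂μ = ∫ x, f x ∂μ := by
  have he : MeasurableEmbedding (S.T g) :=
    MeasurableEquiv.measurableEmbedding
      { toFun := S.T g
        invFun := S.T (-g)
        left_inv := S.neg_apply g
        right_inv := S.apply_neg g
        measurable_toFun := S.meas g
        measurable_invFun := S.meas (-g) }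
  exact (S.mp g).integral_comp he f

omit [StandardBorelSpace X] [IsProbabilityMeasure μ] in
lemma ae_comp (S : Sys G μ) (g : G) {p : X → Prop} (h : ∀ᵐ x ∂μ, p x) : ∀ᵐ x ∂μ, p (S.T g x) :=
  (S.mp g).quasiMeasurePreserving.ae h

/-- Conditional expectation is equivariant. -/
lemma ce_comp (S : Sys G μ) (hm : S.IsFactor m) (hf : Measurable f) (hC : ∀ x, |f x| ≤ C) (g : G) :
    ce m μ (fun x => f (S.T g x)) =ᵐ[μ] fun x => ce m μ f (S.T g x) := by
  refine ce_unique (C := C) (D := C) hm.le (hf.comp (S.meas g)) (fun x => hC _)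
    ((measurable_ce hf).comp (hm.meas g)) (fun x => abs_ce_le hC _) fun s hs => ?_
  set i : X → ℝ := s.indicator 1 with hi
  have hs' : MeasurableSet s := hm.le _ hs
  have him : Measurable[m] i := Measurable.indicator (m := m) measurable_const hs
  have hib : ∀ x, |i x| ≤ 1 := fun x => by
    rw [hi]; by_cases h : x ∈ s <;> simp [h]
  have e1 : ∀ F : X → ℝ, ∫ x in s, F (S.T g x) ∂μ = ∫ x, i (S.T (-g) x) * F x ∂μ := by
    intro F
    rw [← integral_indicator hs', ← S.integral_comp g (fun x => i (S.T (-g) x) * F x)]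
    refine integral_congr_ae (ae_of_all _ fun x => ?_)
    simp only [S.neg_apply, hi]
    by_cases h : x ∈ s <;> simp [h]
  rw [e1, e1]
  exact integral_mul_ce (u := fun x => i (S.T (-g) x)) hm.le hf hC (him.comp (hm.meas (-g)))
    (fun x => hib _)

/-- The disintegration over a factor is equivariant. -/
lemma ker_map [Countable G] (S : Sys G μ) (hm : S.IsFactor m) :
    ∀ᵐ x ∂μ, ∀ g, condExpKernel μ m (S.T g x) = (condExpKernel μ m x).map (S.T g) := by
  rw [ae_all_iff]
  intro g
  let κ : Kernel X X := (condExpKernel μ m).comap id (measurable_id'' hm.le)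
  have hκ : ∀ x, κ x = condExpKernel μ m x := fun x => rfl
  have key : (κ.comap (S.T g) (S.meas g)) =ᵐ[μ] κ.map (S.T g) := by
    have : IsMarkovKernel (κ.map (S.T g)) := Kernel.IsMarkovKernel.map _ (S.meas g)
    refine Kernel.ae_eq_of_compProd_eq ?_
    refine Measure.ext_prod fun {s t} hs ht => ?_
    rw [Measure.compProd_apply_prod hs ht, Measure.compProd_apply_prod hs ht]
    refine setLIntegral_congr_fun_ae hs ?_
    set f : X → ℝ := t.indicator 1 with hf
    have hfm : Measurable f := measurable_one.indicator ht
    have hfb : ∀ x, |f x| ≤ 1 := fun x => by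
      rw [hf]; by_cases h : x ∈ t <;> simp [h]
    filter_upwards [S.ce_comp hm hfm hfb g] with x hx _
    rw [Kernel.comap_apply, Kernel.map_apply _ (S.meas g), Measure.map_apply (S.meas g) ht,
      hκ, hκ]
    have h1 : ce m μ f (S.T g x) = (condExpKernel μ m (S.T g x)).real t := by
      simp [ce, hf, integral_indicator_one ht]
    have h2 : ce m μ (fun x => f (S.T g x)) x = (condExpKernel μ m x).real (S.T g ⁻¹' t) := by
      have : (fun x => f (S.T g x)) = (S.T g ⁻¹' t).indicator 1 := rfl
      simp [ce, this, integral_indicator_one (S.meas g ht)]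
    rw [h1, h2] at hx
    exact ((measureReal_eq_measureReal_iff).1 hx).symm
  filter_upwards [key] with x hx
  rw [Kernel.comap_apply, Kernel.map_apply _ (S.meas g), hκ, hκ] at hx
  exact hx

end Sys

end Kernel

end PolyRec

namespace PolyRec

section WeakMixing

set_option linter.overlappingInstances false

open MeasureTheory ProbabilityTheory Filter

variable {X : Type} {m z : MeasurableSpace X} [mX : MeasurableSpace X] [StandardBorelSpace X]
  {μ : Measure X} [IsProbabilityMeasure μ] {G : Type} [AddCommGroup G]

lemma abs_prod_le_one {ι : Type*} {s : Finset ι} {a : ι → ℝ} (h : ∀ i ∈ s, |a i| ≤ 1) :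
    |∏ i ∈ s, a i| ≤ 1 := by
  rw [Finset.abs_prod]
  exact Finset.prod_le_one (fun i _ => abs_nonneg _) h

lemma abs_prod_le_of_mem {ι : Type*} {s : Finset ι} {a : ι → ℝ} (h : ∀ i ∈ s, |a i| ≤ 1)
    {j : ι} (hj : j ∈ s) : |∏ i ∈ s, a i| ≤ |a j| := by
  classical
  rw [← Finset.mul_prod_erase s a hj, abs_mul]
  exact mul_le_of_le_one_right (abs_nonneg _)
    (abs_prod_le_one fun i hi => h i (Finset.mem_of_mem_erase hi))

omit [StandardBorelSpace X] in
lemma abs_sum_integral_mul_le {N : ℕ} {u : X → ℝ} {y : ℕ → X → ℝ} (hu : Measurable u)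
    (hu1 : ∀ x, |u x| ≤ 1) (hy : ∀ n, Measurable (y n)) {C : ℝ} (hyC : ∀ n x, |y n x| ≤ C)
    {ε : ℝ} (hε : 0 < ε) (h : ∫ x, ((∑ n ∈ Finset.range N, y n x) / N) ^ 2 ∂μ ≤ ε ^ 2) :
    |∑ n ∈ Finset.range N, ∫ x, u x * y n x ∂μ| ≤ N * ε := by
  rcases Nat.eq_zero_or_pos N with rfl | hN
  · simp
  have hN' : (0 : ℝ) < N := by exact_mod_cast hN
  set s : X → ℝ := fun x => (∑ n ∈ Finset.range N, y n x) / N with hs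
  have hsm : Measurable s := (Finset.measurable_fun_sum _ fun n _ => hy n).div_const _
  have hsC : ∀ x, |s x| ≤ C := by
    intro x
    rw [hs]
    simp only [abs_div, Nat.abs_cast]
    rw [div_le_iff₀ hN']
    refine (Finset.abs_sum_le_sum_abs _ _).trans ?_
    calc _ ≤ ∑ n ∈ Finset.range N, C := Finset.sum_le_sum fun n _ => hyC n x
      _ = C * N := by rw [Finset.sum_const, Finset.card_range, nsmul_eq_mul, mul_comm]
  have hC : ∀ x : X, 0 ≤ C := fun x => (abs_nonneg _).trans (hsC x)
  rw [← integral_finsetSum _ fun n _ => integrable_mul_of_abs_le hu hu1 (hy n) (hyC n)]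
  have e1 : ∀ x, ∑ n ∈ Finset.range N, u x * y n x = N * (u x * s x) := by
    intro x
    rw [← Finset.mul_sum, hs]
    field_simp
  simp only [e1]
  rw [integral_const_mul, abs_mul, Nat.abs_cast]
  gcongr
  refine (abs_integral_le_integral_abs).trans ?_
  have hi2 : Integrable (fun x => s x ^ 2) μ :=
    integrable_of_abs_le (C := C ^ 2) (hsm.pow_const 2) fun x => by
      rw [abs_pow]; gcongr; exact hsC x
  calc ∫ x, |u x * s x| ∂μ ≤ ∫ x, (s x ^ 2 * (2 * ε)⁻¹ + ε / 2) ∂μ := by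
        refine integral_mono ?_ ((hi2.mul_const _).add (integrable_const _)) fun x => ?_
        · exact (integrable_mul_of_abs_le hu hu1 hsm hsC).abs
        · have h1 : |u x * s x| ≤ |s x| := by
            rw [abs_mul]; exact mul_le_of_le_one_left (abs_nonneg _) (hu1 x)
          have h2 : |s x| ≤ s x ^ 2 * (2 * ε)⁻¹ + ε / 2 := by
            rw [← sub_nonneg]
            have : s x ^ 2 * (2 * ε)⁻¹ + ε / 2 - |s x| = (|s x| - ε) ^ 2 * (2 * ε)⁻¹ := by
              rw [← sq_abs (s x)]; field_simp; ring
            rw [this]; positivity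
          exact h1.trans h2
    _ = (∫ x, s x ^ 2 ∂μ) * (2 * ε)⁻¹ + ε / 2 := by
        rw [integral_add (hi2.mul_const _) (integrable_const _), integral_mul_const,
          integral_const]
        simp
    _ ≤ ε ^ 2 * (2 * ε)⁻¹ + ε / 2 := by gcongr
    _ = ε := by field_simp; ring

namespace Sys

/-- Relative weak mixing of the extension `z` of `m` along the nonzero elements of `W`. -/
def RelMixing (m z : MeasurableSpace X) [mX : MeasurableSpace X] [StandardBorelSpace X]
    {μ : Measure X} [IsProbabilityMeasure μ] (S : Sys G μ) (W : AddSubgroup G) : Prop :=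
  ∀ f : X → ℝ, Measurable[z] f → (∀ x, |f x| ≤ 1) → ce m μ f =ᵐ[μ] 0 → ∀ g ∈ W, g ≠ 0 →
    Tendsto (fun N : ℕ =>
      (∑ n ∈ Finset.range N, ∫ x, |ce m μ (fun x => f x * f (S.T (n • g) x)) x| ∂μ) / N)
      atTop (nhds 0)

/-- Multiple averages along the polynomials `w i`, weighted by `m`-measurable functions, do not
see the difference between `f i` and its conditional expectation. -/
def AvgControlled (m : MeasurableSpace X) [mX : MeasurableSpace X] [StandardBorelSpace X]
    {μ : Measure X} [IsProbabilityMeasure μ] (S : Sys G μ)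
    {ι : Type} [Fintype ι] (w : ι → ℕ → G) (f f' : ι → X → ℝ) : Prop :=
  ∀ ε > 0, ∃ L : ℕ, ∀ N ≥ L, ∀ M, ∀ e : ℕ → X → ℝ, (∀ n, Measurable[m] (e n)) →
    (∀ n x, |e n x| ≤ 1) →
    ∫ x, ((∑ n ∈ Finset.range N, e (M + n) x *
      (∏ i, f i (S.T (w i (M + n)) x) - ∏ i, f' i (S.T (w i (M + n)) x))) / N) ^ 2 ∂μ ≤ ε

omit [StandardBorelSpace X] [IsProbabilityMeasure μ] in
lemma measurable_prod_comp {S : Sys G μ} (hz : S.IsFactor z) {ι : Type} [Fintype ι]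
    {f : ι → X → ℝ} (hf : ∀ i, Measurable[z] (f i)) (g : ι → G) :
    Measurable[z] fun x => ∏ i, f i (S.T (g i) x) :=
  Finset.measurable_fun_prod _ fun i _ => (hf i).comp (hz.meas (g i))

variable {S : Sys G μ} {W : AddSubgroup G}

/-- Correlations of products along polynomials, one step of the induction. -/
lemma correlation_le (hm : S.IsFactor m) (hz : S.IsFactor z)
    {ι : Type} [Fintype ι] [DecidableEq ι] {w : ι → ℕ → G} {f : ι → X → ℝ}
    (hf : ∀ i, Measurable[z] (f i)) (hf1 : ∀ i x, |f i x| ≤ 1) {lin : ι → Prop}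
    [DecidablePred lin] {c : ι → G} {k : ℕ} (hlin : ∀ i, lin i → ∀ n, w i (n + k) = k • c i + w i n)
    (i₀ i₁ : ι) {F : ι → X → ℝ}
    (hF : ∀ i, F i = if lin i then fun x => f i x * f i (S.T (k • c i) x) else f i)
    (hctl : S.AvgControlled m (ι := {i // i ≠ i₁} ⊕ {i // ¬ lin i})
      (Sum.elim (fun i => w i - w i₁) (fun i => tau k (w i) - w i₁))
      (Sum.elim (fun i => F i) (fun i => f i))
      (fun j => ce m μ ((Sum.elim (fun i => F i) (fun i => f i) :
        {i // i ≠ i₁} ⊕ {i // ¬ lin i} → X → ℝ) j)))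
    {ε : ℝ} (hε : 0 < ε) :
    ∃ L : ℕ, ∀ N ≥ L, ∀ M, ∀ e : ℕ → X → ℝ, (∀ n, Measurable[m] (e n)) →
      (∀ n x, |e n x| ≤ 1) →
      ∑ n ∈ Finset.range N, ∫ x, (e (M + n) x * ∏ i, f i (S.T (w i (M + n)) x)) *
        (e (M + n + k) x * ∏ i, f i (S.T (w i (M + n + k)) x)) ∂μ ≤
      N * (∫ x, |ce m μ (F i₀) x| ∂μ + ε) := by
  classical
  have hFm : ∀ i, Measurable[z] (F i) := by
    intro i; rw [hF]; split_ifs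
    · exact (hf i).mul ((hf i).comp (hz.meas _))
    · exact hf i
  have hF1 : ∀ i x, |F i x| ≤ 1 := by
    intro i x; rw [hF]; split_ifs
    · rw [abs_mul]; exact mul_le_one₀ (hf1 _ _) (abs_nonneg _) (hf1 _ _)
    · exact hf1 i x
  set w' : {i // i ≠ i₁} ⊕ {i // ¬ lin i} → ℕ → G :=
    Sum.elim (fun i => w i - w i₁) (fun i => tau k (w i) - w i₁) with hw'
  set g : {i // i ≠ i₁} ⊕ {i // ¬ lin i} → X → ℝ :=
    Sum.elim (fun i => F i) (fun i => f i) with hg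
  have hgm : ∀ j, Measurable[z] (g j) := by
    rintro (j | j)
    · exact hFm _
    · exact hf _
  have hg1 : ∀ j x, |g j x| ≤ 1 := by
    rintro (j | j) x
    · exact hF1 _ _
    · exact hf1 _ _
  obtain ⟨L, hL⟩ := hctl (ε ^ 2) (by positivity)
  refine ⟨L, fun N hN M e he he1 => ?_⟩
  set e' : ℕ → X → ℝ := fun n x => e n (S.T (-w i₁ n) x) * e (n + k) (S.T (-w i₁ n) x) with he'
  have he'm : ∀ n, Measurable[m] (e' n) := fun n =>
    ((he n).comp (hm.meas _)).mul ((he (n + k)).comp (hm.meas _))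
  have he'1 : ∀ n x, |e' n x| ≤ 1 := fun n x => by
    rw [he', abs_mul]; exact mul_le_one₀ (he1 _ _) (abs_nonneg _) (he1 _ _)
  have hsplit : ∀ n x, (e n (S.T (-w i₁ n) x) * ∏ i, f i (S.T (w i n) (S.T (-w i₁ n) x))) *
        (e (n + k) (S.T (-w i₁ n) x) * ∏ i, f i (S.T (w i (n + k)) (S.T (-w i₁ n) x))) =
      F i₁ x * (e' n x * ∏ j, g j (S.T (w' j n) x)) := by
    intro n x
    have hz1 : ∀ i, S.T (w i n) (S.T (-w i₁ n) x) = S.T ((w i - w i₁) n) x := by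
      intro i; rw [← S.add, Pi.sub_apply, sub_eq_add_neg]
    have hz2 : ∀ i, S.T (w i (n + k)) (S.T (-w i₁ n) x) = S.T ((tau k (w i) - w i₁) n) x := by
      intro i; rw [← S.add, Pi.sub_apply, sub_eq_add_neg]; rfl
    have hprod : (∏ i, f i (S.T ((w i - w i₁) n) x)) *
        ∏ i, f i (S.T ((tau k (w i) - w i₁) n) x) =
        F i₁ x * ∏ j, g j (S.T (w' j n) x) := by
      rw [← Finset.prod_mul_distrib, Fintype.prod_sum_type, ← mul_assoc]
      have e1 : ∀ i, f i (S.T ((w i - w i₁) n) x) * f i (S.T ((tau k (w i) - w i₁) n) x) =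
          F i (S.T ((w i - w i₁) n) x) *
            (if lin i then 1 else f i (S.T ((tau k (w i) - w i₁) n) x)) := by
        intro i
        rw [hF i]
        split_ifs with hl
        · rw [mul_one]
          congr 2
          rw [← S.add]
          congr 1
          simp only [Pi.sub_apply, tau, hlin i hl]
          abel
        · rfl
      simp only [e1]
      rw [Finset.prod_mul_distrib]
      congr 1
      · rw [Fintype.prod_eq_mul_prod_subtype_ne _ i₁]
        congr 1
        · simp [S.zero]
      · simp only [hg, hw', Sum.elim_inr]
        rw [← Fintype.prod_subtype_mul_prod_subtype lin]
        have : ∏ i : {i // lin i}, (if lin i.1 then (1 : ℝ) else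
            f i (S.T ((tau k (w i) - w i₁) n) x)) = 1 :=
          Finset.prod_eq_one fun i _ => by rw [if_pos i.2]
        rw [this, one_mul]
        exact Finset.prod_congr rfl fun i _ => by rw [if_neg i.2]
    simp only [hz1, hz2]
    calc _ = e' n x * ((∏ i, f i (S.T ((w i - w i₁) n) x)) *
        ∏ i, f i (S.T ((tau k (w i) - w i₁) n) x)) := by rw [he']; ring
      _ = _ := by rw [hprod]; ring
  set y : ℕ → X → ℝ := fun n x => e' n x *
    (∏ j, g j (S.T (w' j n) x) - ∏ j, ce m μ (g j) (S.T (w' j n) x)) with hy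
  set v : ℕ → X → ℝ := fun n x => e' n x * ∏ j, ce m μ (g j) (S.T (w' j n) x) with hv
  have hgm' : ∀ j, Measurable (g j) := fun j => (hgm j).mono hz.le le_rfl
  have hvm : ∀ n, Measurable[m] (v n) := fun n =>
    (he'm n).mul (measurable_prod_comp hm (fun j => measurable_ce (hgm' j)) _)
  have hv1 : ∀ n x, |v n x| ≤ 1 := fun n x => by
    rw [hv, abs_mul]
    exact mul_le_one₀ (he'1 _ _) (abs_nonneg _)
      (abs_prod_le_one fun j _ => abs_ce_le (hg1 j) _)
  have hym : ∀ n, Measurable (y n) := fun n => by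
    refine ((he'm n).mono hm.le le_rfl).mul (Measurable.sub ?_ ?_)
    · exact (measurable_prod_comp hz hgm _).mono hz.le le_rfl
    · exact (measurable_prod_comp hm (fun j => measurable_ce (hgm' j)) _).mono hm.le le_rfl
  have hy2 : ∀ n x, |y n x| ≤ 2 := fun n x => by
    rw [hy, abs_mul]
    have h1 := abs_sub (∏ j, g j (S.T (w' j n) x)) (∏ j, ce m μ (g j) (S.T (w' j n) x))
    have h2 : |∏ j, g j (S.T (w' j n) x)| ≤ 1 := abs_prod_le_one fun j _ => hg1 _ _
    have h3 : |∏ j, ce m μ (g j) (S.T (w' j n) x)| ≤ 1 :=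
      abs_prod_le_one fun j _ => abs_ce_le (hg1 j) _
    calc _ ≤ 1 * (2 : ℝ) := mul_le_mul (he'1 n x) (by linarith) (abs_nonneg _) zero_le_one
      _ = 2 := by norm_num
  have hFm' : Measurable (F i₁) := (hFm i₁).mono hz.le le_rfl
  have hint : ∀ n, ∫ x, (e n x * ∏ i, f i (S.T (w i n) x)) *
        (e (n + k) x * ∏ i, f i (S.T (w i (n + k)) x)) ∂μ =
      ∫ x, F i₁ x * y n x ∂μ + ∫ x, v n x * ce m μ (F i₁) x ∂μ := by
    intro n
    rw [← S.integral_comp (-w i₁ n), integral_mul_ce hm.le hFm' (hF1 i₁) (hvm n) (hv1 n),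
      ← integral_add (integrable_mul_of_abs_le hFm' (hF1 i₁) (hym n) (hy2 n))
        (integrable_mul_of_abs_le ((hvm n).mono hm.le le_rfl) (hv1 n) hFm' (hF1 i₁))]
    refine integral_congr_ae (ae_of_all _ fun x => ?_)
    simp only [hsplit]
    rw [hy, hv]; ring
  have hbound : ∀ n, ∫ x, v n x * ce m μ (F i₁) x ∂μ ≤ ∫ x, |ce m μ (F i₀) x| ∂μ := by
    intro n
    have hFm0 : Measurable (F i₀) := (hFm i₀).mono hz.le le_rfl
    have hb : ∀ x, |v n x * ce m μ (F i₁) x| ≤ |v n x| ∧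
        |v n x * ce m μ (F i₁) x| ≤ |ce m μ (F i₁) x| := fun x => by
      rw [abs_mul]
      exact ⟨mul_le_of_le_one_right (abs_nonneg _) (abs_ce_le (hF1 i₁) _),
        mul_le_of_le_one_left (abs_nonneg _) (hv1 n x)⟩
    have hi := integrable_mul_of_abs_le (μ := μ) ((hvm n).mono hm.le le_rfl) (hv1 n)
      (measurable_ce' (μ := μ) hm.le hFm') (abs_ce_le (μ := μ) (m := m) (hF1 i₁))
    have hi0 : Integrable (fun x => |ce m μ (F i₀) x|) μ :=
      (integrable_of_abs_le (C := 1) (measurable_ce' (μ := μ) hm.le hFm0)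
        (abs_ce_le (μ := μ) (m := m) (hF1 i₀))).abs
    by_cases h01 : i₀ = i₁
    · subst h01
      exact integral_mono hi hi0 fun x => (le_abs_self _).trans (hb x).2
    · rw [← S.integral_comp ((w i₀ - w i₁) n) fun x => |ce m μ (F i₀) x|]
      refine integral_mono hi ?_ fun x => ((le_abs_self _).trans (hb x).1).trans ?_
      · exact (integrable_of_abs_le (C := 1) ((measurable_ce' (μ := μ) hm.le hFm0).comp (S.meas _))
          fun x => abs_ce_le (μ := μ) (m := m) (hF1 i₀) _).abs
      · rw [hv, abs_mul]
        refine (mul_le_of_le_one_left (abs_nonneg _) (he'1 n x)).trans ?_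
        exact abs_prod_le_of_mem (a := fun j => ce m μ (g j) (S.T (w' j n) x))
          (fun j _ => abs_ce_le (hg1 j) _)
          (j := (Sum.inl ⟨i₀, h01⟩ : {i // i ≠ i₁} ⊕ {i // ¬ lin i})) (Finset.mem_univ _)
  simp only [hint]
  rw [Finset.sum_add_distrib, mul_add, add_comm]
  refine add_le_add ?_ ?_
  · calc _ ≤ ∑ n ∈ Finset.range N, ∫ x, |ce m μ (F i₀) x| ∂μ :=
          Finset.sum_le_sum fun n _ => hbound _
      _ = _ := by rw [Finset.sum_const, Finset.card_range, nsmul_eq_mul]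
  · exact (le_abs_self _).trans (abs_sum_integral_mul_le hFm' (hF1 i₁) (fun n => hym (M + n))
      (fun n => hy2 (M + n)) hε (hL N hN M e' he'm he'1))

end Sys

end WeakMixing

end PolyRec

namespace PolyRec

section WeakMixingInduction

set_option linter.overlappingInstances false

open MeasureTheory ProbabilityTheory Filter

variable {X : Type} {m z : MeasurableSpace X} [mX : MeasurableSpace X] [StandardBorelSpace X]
  {μ : Measure X} [IsProbabilityMeasure μ] {G : Type} [AddCommGroup G]

lemma add_nsmul_of_dlt_dlt {v : ℕ → G} (h : dlt (dlt v) = 0) (n k : ℕ) :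
    v (n + k) = k • dlt v 0 + v n := by
  induction k with
  | zero => simp
  | succ k ih =>
    have h1 : dlt v (n + k) = dlt v 0 := eq_const_of_dlt_eq_zero h _
    have h2 : v (n + (k + 1)) = dlt v (n + k) + v (n + k) := by simp [dlt, add_assoc]
    rw [h2, h1, ih, succ_nsmul]; abel

lemma finite_exceptional [IsAddTorsionFree G] {v w : ℕ → G} (hv : IsPoly v)
    (h : dlt (dlt v) ≠ 0) : {k : ℕ | dlt (tau k v - w) = 0}.Finite := by
  refine Set.Subsingleton.finite ?_
  have key : ∀ k k', k < k' → dlt (tau k v - w) = 0 → dlt (tau k' v - w) = 0 → False := by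
    intro k k' hk h1 h2
    obtain ⟨d, rfl⟩ := Nat.exists_eq_add_of_lt hk
    refine h (dlt_dlt_eq_zero_of_tau_sub hv (k := d + 1) (by omega) ?_)
    have hp : IsPoly (dlt (tau (d + 1) v - v)) := ((hv.tau _).sub hv).dlt_iter 1
    refine hp.eq_zero_of_tau (e := k) ?_
    rw [← dlt_tau]
    have : tau k (tau (d + 1) v - v) = (tau (k + d + 1) v - w) - (tau k v - w) := by
      ext n; simp [tau]; congr 1; ring
    rw [this, dlt_sub, h1, h2, sub_zero]
  intro k hk k' hk'
  by_contra hne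
  rcases lt_or_gt_of_ne hne with hl | hl
  · exact key k k' hl hk hk'
  · exact key k' k hl hk' hk

namespace Sys

variable {S : Sys G μ} {W : AddSubgroup G}

/-- Families of pairwise essentially distinct nonconstant polynomials with values in `W`. -/
structure GoodFamily (W : AddSubgroup G) {ι : Type} (w : ι → ℕ → G) : Prop where
  poly : ∀ i, IsPoly (w i)
  mem : ∀ i n, w i n ∈ W
  ne_zero : ∀ i, dlt (w i) ≠ 0
  ne : ∀ i j, i ≠ j → dlt (w i - w j) ≠ 0

/-- All good families enumerating `V` have controlled averages. -/
def Controlled (m z : MeasurableSpace X) [mX : MeasurableSpace X] [StandardBorelSpace X]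
    {μ : Measure X} [IsProbabilityMeasure μ] (S : Sys G μ) (W : AddSubgroup G)
    (V : Finset (ℕ → G)) : Prop :=
  ∀ (ι : Type) [Fintype ι] (w : ι → ℕ → G), Set.range w = V → GoodFamily W w →
    ∀ f : ι → X → ℝ, (∀ i, Measurable[z] (f i)) → (∀ i x, |f i x| ≤ 1) →
      S.AvgControlled m w f (fun i => ce m μ (f i))

lemma average_le_of_ce_eq_zero [IsAddTorsionFree G] (hm : S.IsFactor m) (hz : S.IsFactor z)
    (hW : S.RelMixing m z W) {V : Finset (ℕ → G)}
    (ih : ∀ V', (∀ v ∈ V', IsPoly v) → Derived V V' → S.Controlled m z W V')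
    {ι : Type} [Fintype ι] {w : ι → ℕ → G} (hwV : Set.range w = V) (hw : GoodFamily W w)
    {f : ι → X → ℝ} (hf : ∀ i, Measurable[z] (f i)) (hf1 : ∀ i x, |f i x| ≤ 1)
    (i₀ : ι) (h0 : ce m μ (f i₀) =ᵐ[μ] 0) {ε : ℝ} (hε : 0 < ε) :
    ∃ L : ℕ, ∀ N ≥ L, ∀ M, ∀ e : ℕ → X → ℝ, (∀ n, Measurable[m] (e n)) →
      (∀ n x, |e n x| ≤ 1) →
      ∫ x, ((∑ n ∈ Finset.range N, e (M + n) x *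
        ∏ i, f i (S.T (w i (M + n)) x)) / N) ^ 2 ∂μ ≤ ε := by
  classical
  have hVp : ∀ v ∈ V, IsPoly v := by
    intro v hv
    have : v ∈ Set.range w := by rw [hwV]; exact hv
    obtain ⟨i, rfl⟩ := this
    exact hw.poly i
  have hmemV : ∀ i, w i ∈ V := fun i => by
    have : w i ∈ Set.range w := ⟨i, rfl⟩
    rw [hwV] at this; exact this
  obtain ⟨v₁, hv₁, hdv₁, d, hd1, hd2, hd3, hd4⟩ := exists_min_deg hVp ⟨w i₀, hmemV i₀, hw.ne_zero i₀⟩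
  obtain ⟨i₁, rfl⟩ : ∃ i₁, w i₁ = v₁ := by
    have : v₁ ∈ Set.range w := by rw [hwV]; exact hv₁
    exact this
  set lin : ι → Prop := fun i => dlt (dlt (w i)) = 0 with hlin
  set c : ι → G := fun i => dlt (w i) 0 with hc
  set F : ℕ → ι → X → ℝ := fun k i =>
    if lin i then fun x => f i x * f i (S.T (k • c i) x) else f i with hF
  set Exc : Set ℕ := {k | ∃ i j, ¬ lin i ∧ dlt (tau k (w i) - w j) = 0} with hExc
  have hfin : Exc.Finite := by
    have : Exc ⊆ ⋃ i, ⋃ j, {k | ¬ lin i ∧ dlt (tau k (w i) - w j) = 0} := by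
      rintro k ⟨i, j, h⟩
      simp only [Set.mem_iUnion]
      exact ⟨i, j, h⟩
    refine Set.Finite.subset (Set.finite_iUnion fun i => Set.finite_iUnion fun j => ?_) this
    by_cases hi : lin i
    · convert Set.finite_empty using 1
      ext k; simp [hi]
    · exact (finite_exceptional (hw.poly i) hi).subset fun k hk => hk.2
  set a : ℕ → ℝ := fun k => ∫ x, |ce m μ (F k i₀) x| ∂μ with ha
  have ha0 : ∀ k, 0 ≤ a k := fun k => integral_nonneg fun x => abs_nonneg _
  set ρ : ℕ → ℝ := fun k => if k = 0 ∨ k ∈ Exc then 1 else a k with hρ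
  have hρ0 : ∀ k, 0 ≤ ρ k := fun k => by
    rw [hρ]; dsimp only; split_ifs
    · exact zero_le_one
    · exact ha0 k
  have halim : Tendsto (fun N : ℕ => (∑ k ∈ Finset.range N, a k) / N) atTop (nhds 0) := by
    by_cases hl : lin i₀
    · have hcW : c i₀ ∈ W := by
        rw [hc]; exact W.sub_mem (hw.mem _ _) (hw.mem _ _)
      have hc0 : c i₀ ≠ 0 := by
        intro h
        apply hw.ne_zero i₀
        ext n
        rw [eq_const_of_dlt_eq_zero hl n]
        exact h
      have := hW (f i₀) (hf i₀) (hf1 i₀) h0 (c i₀) hcW hc0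
      simpa only [ha, hF, if_pos hl] using this
    · have : ∀ k, a k = 0 := by
        intro k
        simp only [ha, hF, if_neg hl]
        rw [integral_congr_ae (g := fun _ => 0)]
        · simp
        · filter_upwards [h0] with x hx
          rw [hx]; simp
      simp only [this]
      simp
  have hρlim : Tendsto (fun N : ℕ => (∑ k ∈ Finset.range N, ρ k) / N) atTop (nhds 0) := by
    set D : Finset ℕ := insert 0 hfin.toFinset with hD
    have h1 : Tendsto (fun N : ℕ => (∑ k ∈ Finset.range N, a k) / N + (D.card : ℝ) / N)
        atTop (nhds 0) := by
      simpa using halim.add (tendsto_const_div_atTop_nhds_zero_nat (D.card : ℝ))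
    refine squeeze_zero (fun N => div_nonneg (Finset.sum_nonneg fun k _ => hρ0 k)
      (Nat.cast_nonneg _)) (fun N => ?_) h1
    rw [← add_div]
    gcongr
    have h2 : ∀ k, ρ k ≤ a k + if k ∈ D then 1 else 0 := by
      intro k
      have : (k = 0 ∨ k ∈ Exc) ↔ k ∈ D := by simp [hD]
      rw [hρ]; dsimp only; simp only [this]
      split_ifs
      · linarith [ha0 k]
      · linarith
    calc ∑ k ∈ Finset.range N, ρ k ≤ ∑ k ∈ Finset.range N, (a k + if k ∈ D then 1 else 0) :=
          Finset.sum_le_sum fun k _ => h2 k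
      _ ≤ _ := by
        rw [Finset.sum_add_distrib, Finset.sum_ite, Finset.sum_const_zero, add_zero,
          Finset.sum_const, nsmul_eq_mul, mul_one]
        gcongr
        intro k hk
        exact (Finset.mem_filter.1 hk).2
  set C : Set (ℕ → X → ℝ) := {y | ∃ e : ℕ → X → ℝ, (∀ n, Measurable[m] (e n)) ∧
      (∀ n x, |e n x| ≤ 1) ∧ y = fun n x => e n x * ∏ i, f i (S.T (w i n) x)} with hCdef
  have hfm : ∀ n, Measurable fun x => ∏ i, f i (S.T (w i n) x) := fun n =>
    (measurable_prod_comp hz hf _).mono hz.le le_rfl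
  suffices hcor : ∀ k, 1 ≤ k → ∀ ε > 0, ∃ L : ℕ, ∀ N ≥ L, ∀ y ∈ C, ∀ M,
      ∑ n ∈ Finset.range N, ∫ x, y (M + n) x * y (M + n + k) x ∂μ ≤ N * (ρ k + ε) by
    have hCm : ∀ y ∈ C, ∀ n, Measurable (y n) := by
      rintro y ⟨e, he, he1, rfl⟩ n
      exact ((he n).mono hm.le le_rfl).mul (hfm n)
    have hC1 : ∀ y ∈ C, ∀ n x, |y n x| ≤ 1 := by
      rintro y ⟨e, he, he1, rfl⟩ n x
      rw [abs_mul]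
      exact mul_le_one₀ (he1 _ _) (abs_nonneg _) (abs_prod_le_one fun i _ => hf1 i _)
    obtain ⟨L, hL⟩ := van_der_corput (μ := μ) hρ0 (by simp [hρ]) hρlim hCm hC1 hcor hε
    exact ⟨L, fun N hN M e he he1 => hL N hN _ ⟨e, he, he1, rfl⟩ M⟩
  · intro k hk ε' hε'
    by_cases hkE : k ∈ Exc
    · refine ⟨0, fun N _ y hy M => ?_⟩
      obtain ⟨e, he, he1, rfl⟩ := hy
      have hρk : ρ k = 1 := by rw [hρ]; simp [hkE]
      have hb : ∀ n x, |e n x * ∏ i, f i (S.T (w i n) x)| ≤ 1 := fun n x => by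
        rw [abs_mul]
        exact mul_le_one₀ (he1 _ _) (abs_nonneg _) (abs_prod_le_one fun i _ => hf1 i _)
      have hi : ∀ n n', ∫ x, (e n x * ∏ i, f i (S.T (w i n) x)) *
          (e n' x * ∏ i, f i (S.T (w i n') x)) ∂μ ≤ 1 := by
        intro n n'
        have := norm_integral_le_of_norm_le_const (μ := μ) (C := 1)
          (f := fun x => (e n x * ∏ i, f i (S.T (w i n) x)) *
          (e n' x * ∏ i, f i (S.T (w i n') x))) (ae_of_all _ fun x => by
            rw [Real.norm_eq_abs, abs_mul]
            exact mul_le_one₀ (hb _ _) (abs_nonneg _) (hb _ _))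
        simp only [probReal_univ, mul_one] at this
        exact (le_abs_self _).trans this
      calc _ ≤ ∑ n ∈ Finset.range N, (1 : ℝ) := Finset.sum_le_sum fun n _ => hi _ _
        _ = N * 1 := by simp
        _ ≤ _ := by gcongr; rw [hρk]; linarith
    · have hρk : ρ k = a k := by
        rw [hρ]; dsimp only; rw [if_neg]
        rintro (h | h)
        · omega
        · exact hkE h
      set w' : {i // i ≠ i₁} ⊕ {i // ¬ lin i} → ℕ → G :=
        Sum.elim (fun i => w i - w i₁) (fun i => tau k (w i) - w i₁) with hw'
      have hgood : GoodFamily W w' := by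
        have htau : ∀ i n, tau k (w i) n ∈ W := fun i n => hw.mem i _
        have hE2 : ∀ i j, ¬ lin i → dlt (tau k (w i) - w j) ≠ 0 := fun i j hi h =>
          hkE ⟨i, j, hi, h⟩
        refine ⟨?_, ?_, ?_, ?_⟩
        · rintro (i | i)
          · exact (hw.poly _).sub (hw.poly _)
          · exact ((hw.poly _).tau k).sub (hw.poly _)
        · rintro (i | i) n
          · exact W.sub_mem (hw.mem _ _) (hw.mem _ _)
          · exact W.sub_mem (htau _ _) (hw.mem _ _)
        · rintro (i | i)
          · exact hw.ne _ _ i.2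
          · exact hE2 _ _ i.2
        · rintro (i | i) (j | j) hij
          · simp only [hw', Sum.elim_inl, sub_sub_sub_cancel_right]
            exact hw.ne _ _ fun h => hij (by rw [Subtype.ext h])
          · simp only [hw', Sum.elim_inl, Sum.elim_inr, sub_sub_sub_cancel_right]
            rw [← neg_sub, dlt_neg, neg_ne_zero]
            exact hE2 _ _ j.2
          · simp only [hw', Sum.elim_inl, Sum.elim_inr, sub_sub_sub_cancel_right]
            exact hE2 _ _ i.2
          · simp only [hw', Sum.elim_inr, sub_sub_sub_cancel_right]
            have h1 : tau k (w i) - tau k (w j) = tau k (w i - w j) := rfl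
            rw [h1, dlt_tau]
            intro h
            have hp : IsPoly (dlt (w i.1 - w j.1)) := ((hw.poly _).sub (hw.poly _)).dlt_iter 1
            exact hw.ne i.1 j.1 (fun h' => hij (by rw [Subtype.ext h'])) (hp.eq_zero_of_tau h)
      set V' : Finset (ℕ → G) := (Set.finite_range w').toFinset with hV'
      have hder : Derived V V' := by
        refine ⟨w i₁, hmemV _, d, hd1, hd2, hd3, hd4, fun v' hv' => ?_⟩
        rw [hV', Set.Finite.mem_toFinset] at hv'
        obtain ⟨j, rfl⟩ := hv'
        rcases j with j | j
        · exact ⟨w j, hmemV _, 0, 0, hw.ne_zero _, by ext n; simp [hw']⟩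
        · exact ⟨w j, hmemV _, k, 0, hw.ne_zero _, by ext n; simp [hw', tau]⟩
      have hV'p : ∀ v ∈ V', IsPoly v := by
        intro v hv
        rw [hV', Set.Finite.mem_toFinset] at hv
        obtain ⟨j, rfl⟩ := hv
        exact hgood.poly j
      have hF1 : ∀ i x, |F k i x| ≤ 1 := by
        intro i x; simp only [hF]; split_ifs
        · rw [abs_mul]; exact mul_le_one₀ (hf1 _ _) (abs_nonneg _) (hf1 _ _)
        · exact hf1 i x
      have hFm : ∀ i, Measurable[z] (F k i) := by
        intro i; simp only [hF]; split_ifs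
        · exact (hf i).mul ((hf i).comp (hz.meas _))
        · exact hf i
      have hctl := ih V' hV'p hder _ w' (by rw [hV', Set.Finite.coe_toFinset]) hgood
        (Sum.elim (fun i => F k i) (fun i => f i))
        (by rintro (j | j); exacts [hFm _, hf _]) (by rintro (j | j) x; exacts [hF1 _ _, hf1 _ _])
      obtain ⟨L, hL⟩ := correlation_le hm hz hf hf1 (lin := lin) (c := c) (k := k)
        (fun i hi n => add_nsmul_of_dlt_dlt hi n k) i₀ i₁ (F := F k) (fun i => rfl) hctl hε'
      refine ⟨L, fun N hN y hy M => ?_⟩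
      obtain ⟨e, he, he1, rfl⟩ := hy
      rw [hρk]
      exact hL N hN M e he he1

end Sys

end WeakMixingInduction

end PolyRec

namespace PolyRec

section WeakMixingConclusion

set_option linter.overlappingInstances false

open MeasureTheory ProbabilityTheory Filter

variable {X : Type} {m z : MeasurableSpace X} [mX : MeasurableSpace X] [StandardBorelSpace X]
  {μ : Measure X} [IsProbabilityMeasure μ] {G : Type} [AddCommGroup G]

omit [StandardBorelSpace X] in
lemma integrable_average_sq {q : ℕ → X → ℝ} (hq : ∀ n, Measurable (q n)) {C : ℝ}
    (hC : ∀ n x, |q n x| ≤ C) (N : ℕ) :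
    Integrable (fun x => ((∑ n ∈ Finset.range N, q n x) / N) ^ 2) μ := by
  refine integrable_of_abs_le (C := (N * C / N) ^ 2)
    (((Finset.measurable_fun_sum _ fun n _ => hq n).div_const _).pow_const 2) fun x => ?_
  rw [abs_pow, abs_div, Nat.abs_cast]
  gcongr
  refine (Finset.abs_sum_le_sum_abs _ _).trans ?_
  refine (Finset.sum_le_sum fun n _ => hC n x).trans_eq ?_
  simp

omit [StandardBorelSpace X] in
lemma integral_average_add_sq_le {p q : ℕ → X → ℝ} (hp : ∀ n, Measurable (p n))
    (hq : ∀ n, Measurable (q n)) {C : ℝ} (hpC : ∀ n x, |p n x| ≤ C) (hqC : ∀ n x, |q n x| ≤ C)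
    (N : ℕ) :
    ∫ x, ((∑ n ∈ Finset.range N, (p n x + q n x)) / N) ^ 2 ∂μ ≤
      2 * ∫ x, ((∑ n ∈ Finset.range N, p n x) / N) ^ 2 ∂μ +
      2 * ∫ x, ((∑ n ∈ Finset.range N, q n x) / N) ^ 2 ∂μ := by
  have i1 := integrable_average_sq (μ := μ) hp hpC N
  have i2 := integrable_average_sq (μ := μ) hq hqC N
  have i3 := integrable_average_sq (μ := μ) (q := fun n x => p n x + q n x) (C := C + C)
    (fun n => (hp n).add (hq n))
    (fun n x => (abs_add_le _ _).trans (add_le_add (hpC n x) (hqC n x))) N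
  rw [← integral_const_mul, ← integral_const_mul, ← integral_add (i1.const_mul 2) (i2.const_mul 2)]
  refine integral_mono i3 ((i1.const_mul 2).add (i2.const_mul 2)) fun x => ?_
  simp only [Finset.sum_add_distrib, add_div]
  nlinarith [sq_nonneg ((∑ n ∈ Finset.range N, p n x) / N - (∑ n ∈ Finset.range N, q n x) / N)]

namespace Sys

variable {S : Sys G μ} {W : AddSubgroup G}

lemma AvgControlled.trans (hm : S.IsFactor m) {ι : Type} [Fintype ι] {w : ι → ℕ → G}
    {f f' f'' : ι → X → ℝ} (hf : ∀ i, Measurable (f i)) (hf' : ∀ i, Measurable (f' i))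
    (hf'' : ∀ i, Measurable (f'' i)) (hf1 : ∀ i x, |f i x| ≤ 1) (hf'1 : ∀ i x, |f' i x| ≤ 1)
    (hf''1 : ∀ i x, |f'' i x| ≤ 1) (h1 : S.AvgControlled m w f f')
    (h2 : S.AvgControlled m w f' f'') : S.AvgControlled m w f f'' := by
  intro ε hε
  obtain ⟨L1, hL1⟩ := h1 (ε / 4) (by positivity)
  obtain ⟨L2, hL2⟩ := h2 (ε / 4) (by positivity)
  refine ⟨max L1 L2, fun N hN M e he he1 => ?_⟩
  have hpm : ∀ {F : ι → X → ℝ}, (∀ i, Measurable (F i)) → ∀ n,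
      Measurable fun x => ∏ i, F i (S.T (w i n) x) := fun hF n =>
    Finset.measurable_fun_prod _ fun i _ => (hF i).comp (S.meas _)
  have hp1 : ∀ {F : ι → X → ℝ}, (∀ i x, |F i x| ≤ 1) → ∀ n x,
      |∏ i, F i (S.T (w i n) x)| ≤ 1 := fun hF n x => abs_prod_le_one fun i _ => hF i _
  have hdm : ∀ {F F' : ι → X → ℝ}, (∀ i, Measurable (F i)) → (∀ i, Measurable (F' i)) → ∀ n,
      Measurable fun x => e (M + n) x * (∏ i, F i (S.T (w i (M + n)) x) -
        ∏ i, F' i (S.T (w i (M + n)) x)) := fun hF hF' n =>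
    ((he _).mono hm.le le_rfl).mul ((hpm hF _).sub (hpm hF' _))
  have hd1 : ∀ {F F' : ι → X → ℝ}, (∀ i x, |F i x| ≤ 1) → (∀ i x, |F' i x| ≤ 1) → ∀ n x,
      |e (M + n) x * (∏ i, F i (S.T (w i (M + n)) x) - ∏ i, F' i (S.T (w i (M + n)) x))| ≤
        2 := fun hF hF' n x => by
    rw [abs_mul]
    refine (mul_le_mul (he1 _ _) ((abs_sub _ _).trans (add_le_add (hp1 hF _ _) (hp1 hF' _ _)))
      (abs_nonneg _) zero_le_one).trans ?_
    norm_num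
  have := integral_average_add_sq_le (μ := μ) (hdm hf hf') (hdm hf' hf'') (hd1 hf1 hf'1)
    (hd1 hf'1 hf''1) N
  have e1 := hL1 N (le_of_max_le_left hN) M e he he1
  have e2 := hL2 N (le_of_max_le_right hN) M e he he1
  refine le_trans (le_of_eq ?_) (this.trans (by linarith))
  refine integral_congr_ae (ae_of_all _ fun x => ?_)
  dsimp only
  congr 2
  refine Finset.sum_congr rfl fun n _ => ?_
  ring

lemma controlled [IsAddTorsionFree G] (hm : S.IsFactor m) (hz : S.IsFactor z)
    (hmz : m ≤ z) (hW : S.RelMixing m z W) : ∀ V : Finset (ℕ → G), (∀ v ∈ V, IsPoly v) →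
      S.Controlled m z W V := by
  refine pet_induction fun V hV ih => ?_
  intro ι _ w hwV hw f hf hf1
  classical
  have hfX : ∀ i, Measurable (f i) := fun i => (hf i).mono hz.le le_rfl
  set F : Finset ι → ι → X → ℝ := fun s i => if i ∈ s then ce m μ (f i) else f i with hF
  have hFm : ∀ s i, Measurable[z] (F s i) := fun s i => by
    simp only [hF]; split_ifs
    · exact (measurable_ce (hfX i)).mono hmz le_rfl
    · exact hf i
  have hF1 : ∀ s i x, |F s i x| ≤ 1 := fun s i x => by
    simp only [hF]; split_ifs
    · exact abs_ce_le (hf1 i) x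
    · exact hf1 i x
  have hFX : ∀ s i, Measurable (F s i) := fun s i => (hFm s i).mono hz.le le_rfl
  have key : ∀ s : Finset ι, S.AvgControlled m w f (F s) := by
    intro s
    induction s using Finset.induction_on with
    | empty =>
      intro ε hε
      refine ⟨0, fun N _ M e _ _ => ?_⟩
      simp [hF, hε.le]
    | insert a s ha ihs =>
      refine ihs.trans hm hfX (hFX s) (hFX _) hf1 (hF1 s) (hF1 _) ?_
      intro ε hε
      set h : ι → X → ℝ := fun i => if i = a then fun x => (f a x - ce m μ (f a) x) / 2
        else F s i with hh
      have hhm : ∀ i, Measurable[z] (h i) := fun i => by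
        simp only [hh]; split_ifs
        · exact ((hf a).sub ((measurable_ce (hfX a)).mono hmz le_rfl)).div_const 2
        · exact hFm s i
      have hh1 : ∀ i x, |h i x| ≤ 1 := fun i x => by
        simp only [hh]; split_ifs
        · have h1 := abs_sub (f a x) (ce m μ (f a) x)
          have h2 := hf1 a x
          have h3 := abs_ce_le (μ := μ) (m := m) (hf1 a) x
          rw [abs_div, abs_two]; linarith
        · exact hF1 s i x
      have hh0 : ce m μ (h a) =ᵐ[μ] 0 := by
        have hca := measurable_ce' (μ := μ) hm.le (hfX a)
        have hcb := abs_ce_le (μ := μ) (m := m) (hf1 a)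
        filter_upwards [ce_of_measurable (μ := μ) hm.le (measurable_ce (m := m) (hfX a)) hcb]
          with x hx
        have e1 : ce m μ (h a) x = (ce m μ (f a) x - ce m μ (ce m μ (f a)) x) / 2 := by
          simp only [hh, if_true]
          unfold ce
          rw [integral_div, integral_sub (integrable_of_abs_le (hfX a) (hf1 a))]
          exact integrable_of_abs_le hca hcb
        rw [e1, hx]; simp
      obtain ⟨L, hL⟩ := average_le_of_ce_eq_zero hm hz hW ih hwV hw hhm hh1 a hh0
        (ε := ε / 4) (by positivity)
      refine ⟨L, fun N hN M e he he1 => ?_⟩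
      have e1 : ∀ n x, ∏ i, F s i (S.T (w i n) x) - ∏ i, F (insert a s) i (S.T (w i n) x) =
          2 * ∏ i, h i (S.T (w i n) x) := by
        intro n x
        rw [← Finset.mul_prod_erase Finset.univ (fun i => F s i (S.T (w i n) x))
            (Finset.mem_univ a),
          ← Finset.mul_prod_erase Finset.univ (fun i => F (insert a s) i (S.T (w i n) x))
            (Finset.mem_univ a),
          ← Finset.mul_prod_erase Finset.univ (fun i => h i (S.T (w i n) x))
            (Finset.mem_univ a)]
        have p1 : ∏ i ∈ Finset.univ.erase a, F (insert a s) i (S.T (w i n) x) =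
            ∏ i ∈ Finset.univ.erase a, F s i (S.T (w i n) x) :=
          Finset.prod_congr rfl fun i hi => by
            have := Finset.ne_of_mem_erase hi
            simp [hF, this]
        have p2 : ∏ i ∈ Finset.univ.erase a, h i (S.T (w i n) x) =
            ∏ i ∈ Finset.univ.erase a, F s i (S.T (w i n) x) :=
          Finset.prod_congr rfl fun i hi => by
            have := Finset.ne_of_mem_erase hi
            simp [hh, this]
        rw [p1, p2]
        simp only [hF, hh, ha, Finset.mem_insert_self, if_true, if_false]
        ring
      simp only [e1]
      have e2 : ∀ x, ((∑ n ∈ Finset.range N, e (M + n) x *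
          (2 * ∏ i, h i (S.T (w i (M + n)) x))) / N) ^ 2 =
          4 * ((∑ n ∈ Finset.range N, e (M + n) x * ∏ i, h i (S.T (w i (M + n)) x)) / N) ^ 2 := by
        intro x
        have : ∀ n, e (M + n) x * (2 * ∏ i, h i (S.T (w i (M + n)) x)) =
          2 * (e (M + n) x * ∏ i, h i (S.T (w i (M + n)) x)) := fun n => by ring
        simp only [this]
        rw [← Finset.mul_sum]; ring
      simp only [e2]
      rw [integral_const_mul]
      linarith [hL N hN M e he he1]
  have := key Finset.univ
  simpa [hF] using this

lemma GoodFamily.avgControlled [IsAddTorsionFree G] (hm : S.IsFactor m) (hz : S.IsFactor z)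
    (hmz : m ≤ z) (hW : S.RelMixing m z W) {ι : Type} [Fintype ι] {w : ι → ℕ → G}
    (hw : GoodFamily W w) {f : ι → X → ℝ} (hf : ∀ i, Measurable[z] (f i))
    (hf1 : ∀ i x, |f i x| ≤ 1) : S.AvgControlled m w f (fun i => ce m μ (f i)) := by
  refine controlled hm hz hmz hW (Set.finite_range w).toFinset ?_ ι w (by simp) hw f hf hf1
  intro v hv
  rw [Set.Finite.mem_toFinset] at hv
  obtain ⟨i, rfl⟩ := hv
  exact hw.poly i

/-- Along a good family, products become conditionally independent over `m`, in uniform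
density. -/
lemma GoodFamily.average_defect_le [IsAddTorsionFree G] (hm : S.IsFactor m) (hz : S.IsFactor z)
    (hmz : m ≤ z) (hW : S.RelMixing m z W) {ι : Type} [Fintype ι] {w : ι → ℕ → G}
    (hw : GoodFamily W w) {f₀ : X → ℝ} (hf₀ : Measurable[z] f₀) (hf₀1 : ∀ x, |f₀ x| ≤ 1)
    {f : ι → X → ℝ} (hf : ∀ i, Measurable[z] (f i))
    (hf1 : ∀ i x, |f i x| ≤ 1) {ε : ℝ} (hε : 0 < ε) :
    ∃ L : ℕ, ∀ N ≥ L, ∀ M, ∑ n ∈ Finset.range N,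
      ∫ x, (ce m μ (fun x => f₀ x * (∏ i, f i (S.T (w i (M + n)) x) -
        ∏ i, ce m μ (f i) (S.T (w i (M + n)) x))) x) ^ 2 ∂μ ≤ N * ε := by
  obtain ⟨L, hL⟩ := hw.avgControlled hm hz hmz hW hf hf1 ((ε / 2) ^ 2) (by positivity)
  refine ⟨L, fun N hN M => ?_⟩
  have hfX : ∀ i, Measurable (f i) := fun i => (hf i).mono hz.le le_rfl
  have hf₀X : Measurable f₀ := hf₀.mono hz.le le_rfl
  set r : ℕ → X → ℝ := fun n x => ∏ i, f i (S.T (w i n) x) -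
    ∏ i, ce m μ (f i) (S.T (w i n) x) with hr
  have hrm : ∀ n, Measurable (r n) := fun n =>
    ((measurable_prod_comp hz hf _).mono hz.le le_rfl).sub
      ((measurable_prod_comp hm (fun i => measurable_ce (hfX i)) _).mono hm.le le_rfl)
  have hr2 : ∀ n x, |r n x| ≤ 2 := fun n x => by
    refine ((abs_sub _ _).trans (add_le_add (abs_prod_le_one fun i _ => hf1 i _)
      (abs_prod_le_one fun i _ => abs_ce_le (hf1 i) _))).trans (by norm_num)
  have hgm : ∀ n, Measurable fun x => f₀ x * r n x := fun n => hf₀X.mul (hrm n)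
  have hg2 : ∀ n x, |f₀ x * r n x| ≤ 2 := fun n x => by
    rw [abs_mul]
    exact (mul_le_mul (hf₀1 x) (hr2 n x) (abs_nonneg _) zero_le_one).trans (by norm_num)
  set e : ℕ → X → ℝ := fun n x => ce m μ (fun x => f₀ x * r n x) x / 2 with he
  have hem : ∀ n, Measurable[m] (e n) := fun n => (measurable_ce (hgm n)).div_const 2
  have he1 : ∀ n x, |e n x| ≤ 1 := fun n x => by
    have := abs_ce_le (μ := μ) (m := m) (hg2 n) x
    rw [he, abs_div, abs_two]; linarith
  have hemX : ∀ n, Measurable (e n) := fun n => (hem n).mono hm.le le_rfl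
  have e1 : ∀ n, ∫ x, (ce m μ (fun x => f₀ x * r n x) x) ^ 2 ∂μ =
      2 * ∫ x, f₀ x * (e n x * r n x) ∂μ := by
    intro n
    have h1 : ∀ x, (ce m μ (fun x => f₀ x * r n x) x) ^ 2 =
        2 * (e n x * ce m μ (fun x => f₀ x * r n x) x) := fun x => by rw [he]; ring
    simp only [h1]
    rw [integral_const_mul, integral_mul_ce hm.le (hgm n) (hg2 n) (hem n) (he1 n)]
    congr 1
    refine integral_congr_ae (ae_of_all _ fun x => ?_)
    dsimp only; ring
  have hL' := hL N hN M e hem he1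
  have := abs_sum_integral_mul_le (μ := μ) (N := N) hf₀X hf₀1
    (y := fun n x => e (M + n) x * r (M + n) x) (fun n => (hemX _).mul (hrm _)) (C := 2)
    (fun n x => by
      rw [abs_mul]
      exact (mul_le_mul (he1 _ x) (hr2 _ x) (abs_nonneg _) zero_le_one).trans (by norm_num))
    (by positivity : 0 < ε / 2) hL'
  calc _ = ∑ n ∈ Finset.range N, 2 * ∫ x, f₀ x * (e (M + n) x * r (M + n) x) ∂μ :=
        Finset.sum_congr rfl fun n _ => e1 _
    _ = 2 * ∑ n ∈ Finset.range N, ∫ x, f₀ x * (e (M + n) x * r (M + n) x) ∂μ := by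
        rw [Finset.mul_sum]
    _ ≤ 2 * (N * (ε / 2)) := by
        have := (le_abs_self _).trans this
        linarith
    _ = N * ε := by ring

end Sys

end WeakMixingConclusion

end PolyRec

namespace PolyRec

section Hilbert

open Filter RealInnerProductSpace

variable {E : Type} [NormedAddCommGroup E] [InnerProductSpace ℝ E]
  {G : Type} [AddCommGroup G]

/-- An action of `G` by isometries. -/
structure IsoAction (U : G → E →ₗᵢ[ℝ] E) : Prop where
  zero : ∀ x, U 0 x = x
  add : ∀ g h x, U (g + h) x = U g (U h x)

/-- The closed convex hull of the orbit of `ξ` under `H`. -/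
def hull (U : G → E →ₗᵢ[ℝ] E) (H : AddSubgroup G) (ξ : E) : Set E :=
  closure (convexHull ℝ ((fun h => U h ξ) '' (H : Set G)))

namespace IsoAction

variable {U : G → E →ₗᵢ[ℝ] E} {H : AddSubgroup G} {ξ η : E}

lemma inner_left (hU : IsoAction U) (g : G) (x y : E) : ⟪U g x, y⟫ = ⟪x, U (-g) y⟫ := by
  rw [← (U (-g)).inner_map_map (U g x), ← hU.add, neg_add_cancel, hU.zero]

lemma exists_invariant [CompleteSpace E] (hU : IsoAction U) (h0 : (0 : E) ∉ hull U H ξ) :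
    ∃ K ∈ hull U H ξ, (∀ h ∈ H, U h K = K) ∧ 0 < ⟪K, ξ⟫ := by
  set C := hull U H ξ with hC
  have hconv : Convex ℝ C := (convex_convexHull ℝ _).closure
  have hclosed : IsClosed C := isClosed_closure
  have hξ : ξ ∈ C := subset_closure (subset_convexHull ℝ _ ⟨0, H.zero_mem, hU.zero ξ⟩)
  obtain ⟨K, hK, hmin⟩ := exists_norm_eq_iInf_of_complete_convex ⟨ξ, hξ⟩ hclosed.isComplete hconv 0
  rw [norm_eq_iInf_iff_real_inner_le_zero hconv hK] at hmin
  have hle : ∀ w ∈ C, ‖K‖ ^ 2 ≤ ⟪K, w⟫ := by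
    intro w hw
    have := hmin w hw
    rw [zero_sub, inner_neg_left, inner_sub_right, real_inner_self_eq_norm_sq] at this
    linarith
  have hKpos : 0 < ‖K‖ := norm_pos_iff.2 fun h => h0 (h ▸ hK)
  refine ⟨K, hK, fun h hh => ?_, lt_of_lt_of_le (by positivity) (hle ξ hξ)⟩
  have hinv : U h K ∈ C := by
    have h1 : Set.MapsTo (U h) (convexHull ℝ ((fun h => U h ξ) '' (H : Set G)))
        (convexHull ℝ ((fun h => U h ξ) '' (H : Set G))) := by
      intro x hx
      have : U h x ∈ (U h).toLinearMap '' (convexHull ℝ ((fun h => U h ξ) '' (H : Set G))) :=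
        ⟨x, hx, rfl⟩
      rw [LinearMap.image_convexHull] at this
      refine convexHull_mono ?_ this
      rintro _ ⟨_, ⟨g, hg, rfl⟩, rfl⟩
      exact ⟨h + g, H.add_mem hh hg, hU.add h g ξ⟩
    exact map_mem_closure (U h).continuous hK h1
  have h1 := hle _ hinv
  have h2 : ‖U h K - K‖ ^ 2 ≤ 0 := by
    rw [norm_sub_sq_real, (U h).norm_map, real_inner_comm]
    linarith
  have h3 : ‖U h K - K‖ = 0 := by nlinarith [norm_nonneg (U h K - K)]
  exact sub_eq_zero.1 (norm_eq_zero.1 h3)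

lemma nsmul_fixed (hU : IsoAction U) {g : G} (h : U g η = η) (k : ℤ) : U (k • g) η = η := by
  have hneg : U (-g) η = η := by
    conv_lhs => rw [← h]
    rw [← hU.add, neg_add_cancel, hU.zero]
  induction k using Int.induction_on with
  | zero => rw [zero_smul, hU.zero]
  | succ n ih => rw [add_smul, one_smul, hU.add, h, ih]
  | pred n ih => rw [sub_smul, one_smul, sub_eq_add_neg, hU.add, hneg, ih]

/-- The mean ergodic theorem. -/
lemma exists_mean [CompleteSpace E] (hU : IsoAction U) (g : G) (ξ : E) :
    ∃ η, U g η = η ∧ ⟪ξ, η⟫ = ‖η‖ ^ 2 ∧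
      Tendsto (fun N : ℕ => (N : ℝ)⁻¹ • ∑ n ∈ Finset.range N, U (n • g) ξ) atTop (nhds η) := by
  set f : E →L[ℝ] E := (U g).toContinuousLinearMap
  have hf : ‖f‖ ≤ 1 := (U g).norm_toContinuousLinearMap_le
  have ht := f.tendsto_birkhoffAverage_orthogonalProjection hf ξ
  set η : E := ((f.eqLocus (1 : E →L[ℝ] E)).orthogonalProjectionOnto ξ : E) with hη
  have hfix : U g η = η := by
    have := ((f.eqLocus (1 : E →L[ℝ] E)).orthogonalProjectionOnto ξ).2
    exact this
  have hiter : ∀ n : ℕ, f^[n] ξ = U (n • g) ξ := by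
    intro n
    induction n with
    | zero => rw [zero_smul, hU.zero]; rfl
    | succ n ih => rw [Function.iterate_succ_apply', ih, add_smul, one_smul, add_comm, hU.add]; rfl
  have ht' : Tendsto (fun N : ℕ => (N : ℝ)⁻¹ • ∑ n ∈ Finset.range N, U (n • g) ξ) atTop
      (nhds η) := by
    refine ht.congr fun N => ?_
    simp [birkhoffAverage, birkhoffSum, hiter]
  refine ⟨η, hfix, ?_, ht'⟩
  have h1 := ht'.inner (𝕜 := ℝ) (tendsto_const_nhds (x := η))
  rw [real_inner_self_eq_norm_sq] at h1
  refine tendsto_nhds_unique (f := fun N : ℕ =>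
    ⟪(N : ℝ)⁻¹ • ∑ n ∈ Finset.range N, U (n • g) ξ, η⟫) ?_ h1
  refine tendsto_const_nhds.congr' ?_
  filter_upwards [eventually_gt_atTop 0] with N hN
  have hN' : (N : ℝ) ≠ 0 := by exact_mod_cast hN.ne'
  rw [real_inner_smul_left, sum_inner]
  have : ∀ n : ℕ, ⟪U (n • g) ξ, η⟫ = ⟪ξ, η⟫ := fun n => by
    rw [hU.inner_left]
    have := hU.nsmul_fixed hfix (-(n : ℤ))
    rw [neg_smul, natCast_zsmul] at this
    rw [this]
  simp [this, hN']

lemma tendsto_inner_mean [CompleteSpace E] {g : G}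
    (h : Tendsto (fun N : ℕ => (N : ℝ)⁻¹ • ∑ n ∈ Finset.range N, U (n • g) ξ) atTop (nhds η))
    (a : G) (y : E) :
    Tendsto (fun N : ℕ => (∑ n ∈ Finset.range N, ⟪y, U a (U (n • g) ξ)⟫) / N) atTop
      (nhds ⟪y, U a η⟫) := by
  have h1 := ((U a).continuous.tendsto η).comp h
  have h2 := (tendsto_const_nhds (x := y)).inner (𝕜 := ℝ) h1
  refine h2.congr fun N => ?_
  simp only [Function.comp_def, map_smul, map_sum, real_inner_smul_right, inner_sum]
  rw [div_eq_inv_mul]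

lemma tendsto_of_zero_mem_hull [CompleteSpace E] (hU : IsoAction U) {g : G}
    (h0 : (0 : E) ∈ hull U (H ⊔ AddSubgroup.zmultiples g) ξ) (hξ : ‖ξ‖ ≤ 1)
    (hpos : ∀ a b, 0 ≤ ⟪U a ξ, U b ξ⟫)
    (hPH : ∀ c > 0, ∃ c' > 0, ∀ n : ℕ, c ≤ ⟪ξ, U (n • g) ξ⟫ → ∀ (ι : Type) [Fintype ι]
      (l : ι → ℝ) (h : ι → G), (∀ j, 0 ≤ l j) → ∑ j, l j = 1 → (∀ j, h j ∈ H) →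
      c' ≤ ∑ j, ∑ j', l j * l j' * ⟪U (h j') ξ, U (h j) (U (n • g) ξ)⟫) :
    Tendsto (fun N : ℕ => (∑ n ∈ Finset.range N, ⟪ξ, U (n • g) ξ⟫) / N) atTop (nhds 0) := by
  obtain ⟨η, hfix, hin, ht⟩ := hU.exists_mean g ξ
  have h1 := tendsto_inner_mean ht 0 ξ
  simp only [hU.zero] at h1
  by_cases hη : η = 0
  · simpa [hη] using h1
  exfalso
  have hηpos : 0 < ‖η‖ ^ 2 := by have := norm_pos_iff.2 hη; positivity
  have hη1 : ‖η‖ ≤ 1 := by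
    have := real_inner_le_norm ξ η
    rw [hin] at this
    have hp := norm_pos_iff.2 hη
    nlinarith
  obtain ⟨c', hc', hq⟩ := hPH (‖η‖ ^ 2 / 2) (by positivity)
  set ε := c' * (‖η‖ ^ 2 / 2) / 2 with hε
  have hεpos : 0 < ε := by positivity
  obtain ⟨z, hz, hzε⟩ := Metric.mem_closure_iff.1 h0 ε hεpos
  rw [dist_zero_left] at hzε
  obtain ⟨ι, _, l, w, hl0, hl1, hw, rfl⟩ := mem_convexHull_iff_exists_fintype.1 hz
  choose γ hγ hγw using hw
  have hγ' : ∀ j, ∃ h ∈ H, ∃ k : ℤ, h + k • g = γ j := by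
    intro j
    obtain ⟨h, hh, y, hy, e⟩ := AddSubgroup.mem_sup.1 (hγ j)
    obtain ⟨k, rfl⟩ := AddSubgroup.mem_zmultiples_iff.1 hy
    exact ⟨h, hh, k, e⟩
  choose h hh k hk using hγ'
  have hred : ∀ j' a, ⟪U (γ j') ξ, U a η⟫ = ⟪U (h j') ξ, U a η⟫ := by
    intro j' a
    have hf := hU.nsmul_fixed hfix (-(k j'))
    rw [← hk, add_comm, hU.add, hU.inner_left, ← hU.add, add_comm, hU.add]
    rw [neg_smul] at hf
    rw [hf]
  set Q : ℝ := ∑ j, ∑ j', l j * l j' * ⟪U (h j') ξ, U (h j) η⟫ with hQ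
  have hQle : Q ≤ ε := by
    have e1 : Q = ⟪∑ j', l j' • U (γ j') ξ, ∑ j, l j • U (h j) η⟫ := by
      rw [hQ, inner_sum]
      refine Finset.sum_congr rfl fun j _ => ?_
      rw [sum_inner]
      refine Finset.sum_congr rfl fun j' _ => ?_
      rw [real_inner_smul_left, real_inner_smul_right, hred]; ring
    have e2 : ‖∑ j, l j • U (h j) η‖ ≤ 1 := by
      refine (norm_sum_le _ _).trans ?_
      rw [← hl1]
      refine Finset.sum_le_sum fun j _ => ?_
      rw [norm_smul, (U _).norm_map, Real.norm_of_nonneg (hl0 j)]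
      exact mul_le_of_le_one_right (hl0 j) hη1
    have e3 : ∑ j', l j' • U (γ j') ξ = ∑ j', l j' • w j' :=
      Finset.sum_congr rfl fun j _ => by rw [← hγw j]
    rw [e1, e3]
    refine (real_inner_le_norm _ _).trans ?_
    calc _ ≤ ε * 1 := mul_le_mul hzε.le e2 (norm_nonneg _) hεpos.le
      _ = ε := mul_one _
  have hlim : Tendsto (fun N : ℕ => (∑ n ∈ Finset.range N,
      ∑ j, ∑ j', l j * l j' * ⟪U (h j') ξ, U (h j) (U (n • g) ξ)⟫) / N) atTop (nhds Q) := by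
    have : ∀ N : ℕ, (∑ n ∈ Finset.range N,
        ∑ j, ∑ j', l j * l j' * ⟪U (h j') ξ, U (h j) (U (n • g) ξ)⟫) / N =
        ∑ j, ∑ j', l j * l j' * ((∑ n ∈ Finset.range N,
          ⟪U (h j') ξ, U (h j) (U (n • g) ξ)⟫) / N) := by
      intro N
      rw [Finset.sum_comm, Finset.sum_div]
      refine Finset.sum_congr rfl fun j _ => ?_
      rw [Finset.sum_comm, Finset.sum_div]
      refine Finset.sum_congr rfl fun j' _ => ?_
      rw [← Finset.mul_sum, mul_div_assoc]
    simp only [this]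
    exact tendsto_finsetSum _ fun j _ => tendsto_finsetSum _ fun j' _ =>
      (tendsto_inner_mean ht _ _).const_mul _
  have hlow : ∀ n : ℕ, c' * (⟪ξ, U (n • g) ξ⟫ - ‖η‖ ^ 2 / 2) ≤
      ∑ j, ∑ j', l j * l j' * ⟪U (h j') ξ, U (h j) (U (n • g) ξ)⟫ := by
    intro n
    by_cases hc : ‖η‖ ^ 2 / 2 ≤ ⟪ξ, U (n • g) ξ⟫
    · refine le_trans ?_ (hq n hc ι l h hl0 hl1 hh)
      have h2 : ⟪ξ, U (n • g) ξ⟫ ≤ 1 := by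
        refine (real_inner_le_norm _ _).trans ?_
        rw [(U _).norm_map]
        exact mul_le_one₀ hξ (norm_nonneg _) hξ
      refine mul_le_of_le_one_right hc'.le ?_
      linarith
    · refine le_trans (b := 0) ?_ (Finset.sum_nonneg fun j _ => Finset.sum_nonneg fun j' _ => ?_)
      · exact mul_nonpos_of_nonneg_of_nonpos hc'.le (by linarith)
      · refine mul_nonneg (mul_nonneg (hl0 _) (hl0 _)) ?_
        rw [← hU.add]
        exact hpos _ _
  have hlim2 : Tendsto (fun N : ℕ => c' * ((∑ n ∈ Finset.range N, ⟪ξ, U (n • g) ξ⟫) / N -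
      ‖η‖ ^ 2 / 2)) atTop (nhds (c' * (⟪ξ, η⟫ - ‖η‖ ^ 2 / 2))) :=
    (h1.sub tendsto_const_nhds).const_mul c'
  have hle : c' * (⟪ξ, η⟫ - ‖η‖ ^ 2 / 2) ≤ Q := by
    refine le_of_tendsto_of_tendsto hlim2 hlim ?_
    filter_upwards [eventually_gt_atTop 0] with N hN
    have hN' : (0 : ℝ) < N := by exact_mod_cast hN
    rw [le_div_iff₀ hN']
    calc _ = ∑ n ∈ Finset.range N, c' * (⟪ξ, U (n • g) ξ⟫ - ‖η‖ ^ 2 / 2) := by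
          rw [← Finset.mul_sum, Finset.sum_sub_distrib]
          simp; field_simp
      _ ≤ _ := Finset.sum_le_sum fun n _ => hlow n
  rw [hin] at hle
  have : c' * (‖η‖ ^ 2 / 2) ≤ ε := by
    calc _ = c' * (‖η‖ ^ 2 - ‖η‖ ^ 2 / 2) := by ring
      _ ≤ _ := hle.trans hQle
  rw [hε] at this
  have : 0 < c' * (‖η‖ ^ 2 / 2) := by positivity
  linarith

lemma false_of_nsmul_mem [CompleteSpace E] (hU : IsoAction U) {g : G} {k : ℕ} (hk : 1 ≤ k)
    (hkg : k • g ∈ H) (hpos : ∀ a b, 0 ≤ ⟪U a ξ, U b ξ⟫)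
    (ht : Tendsto (fun N : ℕ => (∑ n ∈ Finset.range N, ⟪ξ, U (n • g) ξ⟫) / N) atTop (nhds 0))
    {c' : ℝ} (hc' : 0 < c') (hPH : ∀ (ι : Type) [Fintype ι]
      (l : ι → ℝ) (h : ι → G), (∀ j, 0 ≤ l j) → ∑ j, l j = 1 → (∀ j, h j ∈ H) →
      c' ≤ ∑ j, ∑ j', l j * l j' * ⟪U (h j') ξ, U (h j) ξ⟫) : False := by
  obtain ⟨η, hfix, hin, hm⟩ := hU.exists_mean (k • g) ξ
  have hsq : ∀ N : ℕ, 0 < N →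
      c' ≤ ‖(N : ℝ)⁻¹ • ∑ n ∈ Finset.range N, U (n • (k • g)) ξ‖ ^ 2 := by
    intro N hN
    have hN' : (N : ℝ) ≠ 0 := by exact_mod_cast hN.ne'
    have := hPH (Fin N) (fun _ => (N : ℝ)⁻¹) (fun n => n.1 • (k • g)) (fun _ => by positivity)
      (by simp [hN']) (fun n => H.nsmul_mem hkg _)
    refine this.trans_eq ?_
    rw [← real_inner_self_eq_norm_sq, real_inner_smul_left, real_inner_smul_right, inner_sum,
      Finset.sum_range, Finset.mul_sum, Finset.mul_sum]
    refine Finset.sum_congr rfl fun j _ => ?_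
    rw [sum_inner, Finset.sum_range, Finset.mul_sum, Finset.mul_sum]
    refine Finset.sum_congr rfl fun j' _ => ?_
    ring
  have h1 : c' ≤ ‖η‖ ^ 2 := by
    refine ge_of_tendsto ((hm.norm).pow 2) ?_
    filter_upwards [eventually_gt_atTop 0] with N hN using hsq N hN
  have h2 := tendsto_inner_mean hm 0 ξ
  simp only [hU.zero] at h2
  have h3 : Tendsto (fun N : ℕ => (k : ℝ) *
      ((∑ n ∈ Finset.range (N * k), ⟪ξ, U (n • g) ξ⟫) / (N * k : ℕ))) atTop (nhds (k * 0)) := by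
    have hNk : Tendsto (fun N : ℕ => N * k) atTop atTop :=
      tendsto_atTop_mono (fun N => Nat.le_mul_of_pos_right N (by omega)) tendsto_id
    exact (ht.comp hNk).const_mul (k : ℝ)
  have h4 : ⟪ξ, η⟫ ≤ k * 0 := by
    refine le_of_tendsto_of_tendsto h2 h3 ?_
    filter_upwards [eventually_gt_atTop 0] with N hN
    have hN' : (0 : ℝ) < N := by exact_mod_cast hN
    have hk' : (0 : ℝ) < k := by exact_mod_cast hk
    have e1 : ∑ n ∈ Finset.range N, ⟪ξ, U (n • (k • g)) ξ⟫ ≤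
        ∑ n ∈ Finset.range (N * k), ⟪ξ, U (n • g) ξ⟫ := by
      have e2 : ∑ n ∈ Finset.range N, ⟪ξ, U (n • (k • g)) ξ⟫ =
          ∑ n ∈ (Finset.range N).image (· * k), ⟪ξ, U (n • g) ξ⟫ := by
        rw [Finset.sum_image fun a _ b _ hab => Nat.eq_of_mul_eq_mul_right (by omega) hab]
        exact Finset.sum_congr rfl fun n _ => by rw [mul_smul]
      rw [e2]
      refine Finset.sum_le_sum_of_subset_of_nonneg ?_ fun n _ _ => ?_
      · intro n hn
        obtain ⟨a, ha, rfl⟩ := Finset.mem_image.1 hn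
        rw [Finset.mem_range] at ha ⊢
        exact Nat.mul_lt_mul_of_pos_right ha (by omega)
      · have := hpos 0 (n • g)
        rwa [hU.zero] at this
    calc _ ≤ (∑ n ∈ Finset.range (N * k), ⟪ξ, U (n • g) ξ⟫) / N := by gcongr
      _ = _ := by push_cast; field_simp
  rw [hin, mul_zero] at h4
  linarith

end IsoAction

end Hilbert

end PolyRec

namespace PolyRec

section RelSquare

set_option linter.overlappingInstances false

open MeasureTheory ProbabilityTheory Filter RealInnerProductSpace

variable {G : Type} [AddCommGroup G] {X : Type} {m : MeasurableSpace X}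
  [mX : MeasurableSpace X] [StandardBorelSpace X] {μ : Measure X} [IsProbabilityMeasure μ]

/-- The disintegration kernel over `m`, with the full σ-algebra on its source. -/
noncomputable def relKer (μ : Measure X) [IsProbabilityMeasure μ] (hm : m ≤ mX) : Kernel X X :=
  (condExpKernel μ m).comap id (measurable_id'' hm)

lemma relKer_apply (hm : m ≤ mX) (x : X) : relKer μ hm x = condExpKernel μ m x := rfl

instance (hm : m ≤ mX) : IsMarkovKernel (relKer μ hm) := by
  unfold relKer; infer_instance

/-- The relatively independent square over `m`. -/
noncomputable def relSq (μ : Measure X) [IsProbabilityMeasure μ] (hm : m ≤ mX) :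
    Measure (X × X) := μ ⊗ₘ relKer μ hm

instance (hm : m ≤ mX) : IsProbabilityMeasure (relSq μ hm) := by
  unfold relSq; infer_instance

variable {φ ψ : X × X → ℝ} {C D : ℝ}

lemma integral_relSq (hm : m ≤ mX) (hφ : Measurable φ) (hC : ∀ p, |φ p| ≤ C) :
    ∫ p, φ p ∂(relSq μ hm) = ∫ x, ∫ y, φ (x, y) ∂(condExpKernel μ m x) ∂μ := by
  have h : Integrable φ (μ ⊗ₘ relKer μ hm) := integrable_of_abs_le hφ hC
  rw [relSq, Measure.integral_compProd h]
  simp only [relKer_apply]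

lemma ae_relSq (hm : m ≤ mX) {p : X × X → Prop} (h : ∀ᵐ q ∂(relSq μ hm), p q) :
    ∀ᵐ x ∂μ, ∀ᵐ y ∂(condExpKernel μ m x), p (x, y) := by
  have h' : ∀ᵐ q ∂(μ ⊗ₘ relKer μ hm), p q := h
  have h2 := Measure.ae_ae_of_ae_compProd h'
  filter_upwards [h2] with x hx
  rw [relKer_apply] at hx
  exact hx

lemma integral_relSq_mul (hm : m ≤ mX) {f : X → ℝ} (hf : Measurable f) (hC : ∀ x, |f x| ≤ C) :
    ∫ p, f p.1 * f p.2 ∂(relSq μ hm) = ∫ x, (ce m μ f x) ^ 2 ∂μ := by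
  rw [integral_relSq (C := C * C) hm (by fun_prop) fun p => by
    rw [abs_mul]; exact mul_le_mul (hC _) (hC _) (abs_nonneg _) ((abs_nonneg _).trans (hC p.1))]
  simp_rw [integral_const_mul]
  change ∫ x, f x * ce m μ f x ∂μ = _
  simp_rw [mul_comm (f _)]
  rw [← integral_mul_ce hm hf hC (measurable_ce hf) (abs_ce_le hC)]
  simp_rw [pow_two]

/-- A bounded function as an element of `L²`. -/
noncomputable def bLp (hm : m ≤ mX) (hφ : Measurable φ) (hC : ∀ p, |φ p| ≤ C) :
    Lp ℝ 2 (relSq μ hm) :=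
  (MemLp.of_bound hφ.aestronglyMeasurable C (ae_of_all _ hC)).toLp φ

lemma coeFn_bLp (hm : m ≤ mX) (hφ : Measurable φ) (hC : ∀ p, |φ p| ≤ C) :
    bLp (μ := μ) hm hφ hC =ᵐ[relSq μ hm] φ := MemLp.coeFn_toLp _

lemma inner_bLp (hm : m ≤ mX) (hφ : Measurable φ) (hC : ∀ p, |φ p| ≤ C)
    (hψ : Measurable ψ) (hD : ∀ p, |ψ p| ≤ D) :
    ⟪bLp (μ := μ) hm hφ hC, bLp hm hψ hD⟫ = ∫ p, φ p * ψ p ∂(relSq μ hm) := by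
  rw [L2.inner_def]
  refine integral_congr_ae ?_
  filter_upwards [coeFn_bLp (μ := μ) hm hφ hC, coeFn_bLp (μ := μ) hm hψ hD] with p h1 h2
  rw [h1, h2]
  simp [mul_comm]

lemma norm_sub_bLp_sq (hm : m ≤ mX) (K : Lp ℝ 2 (relSq μ hm)) (hφ : Measurable φ)
    (hC : ∀ p, |φ p| ≤ C) :
    ‖K - bLp hm hφ hC‖ ^ 2 = ∫ p, (K p - φ p) ^ 2 ∂(relSq μ hm) := by
  rw [← real_inner_self_eq_norm_sq, L2.inner_def]
  refine integral_congr_ae ?_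
  filter_upwards [coeFn_bLp (μ := μ) hm hφ hC, Lp.coeFn_sub K (bLp hm hφ hC)] with p h1 h2
  rw [h2, Pi.sub_apply, h1]
  simp [pow_two]

namespace Sys

/-- The diagonal action on the square. -/
def sq (S : Sys G μ) (g : G) (p : X × X) : X × X := (S.T g p.1, S.T g p.2)

variable [Countable G] (S : Sys G μ) (hm : S.IsFactor m)

include hm in
lemma mp_sq (g : G) :
    MeasurePreserving (S.sq g) (relSq μ hm.le) (relSq μ hm.le) := by
  have hmeas : Measurable (S.sq g) :=
    ((S.meas g).comp measurable_fst).prodMk ((S.meas g).comp measurable_snd)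
  refine ⟨hmeas, ?_⟩
  ext s hs
  rw [Measure.map_apply hmeas hs, relSq, Measure.compProd_apply (hmeas hs),
    Measure.compProd_apply hs]
  rw [← (S.mp g).lintegral_comp (Kernel.measurable_kernel_prodMk_left hs)]
  refine lintegral_congr_ae ?_
  filter_upwards [S.ker_map hm] with x hx
  rw [relKer_apply, relKer_apply, hx g, Measure.map_apply (S.meas g) (measurable_prodMk_left hs)]
  rfl

/-- The action on `L²` of the square. -/
noncomputable def relIso (g : G) : Lp ℝ 2 (relSq μ hm.le) →ₗᵢ[ℝ] Lp ℝ 2 (relSq μ hm.le) :=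
  Lp.compMeasurePreservingₗᵢ ℝ (S.sq g) (S.mp_sq hm g)

lemma coeFn_relIso (g : G) (K : Lp ℝ 2 (relSq μ hm.le)) :
    S.relIso hm g K =ᵐ[relSq μ hm.le] fun p => K (S.sq g p) :=
  Lp.coeFn_compMeasurePreserving K (S.mp_sq hm g)

lemma isoAction_relIso : IsoAction (S.relIso hm) where
  zero K := by
    refine Lp.ext ((S.coeFn_relIso hm 0 K).trans ?_)
    filter_upwards with p
    simp only [sq, S.zero]
  add g h K := by
    refine Lp.ext ((S.coeFn_relIso hm (g + h) K).trans ?_)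
    filter_upwards [S.coeFn_relIso hm g (S.relIso hm h K),
      (S.mp_sq hm g).quasiMeasurePreserving.ae (S.coeFn_relIso hm h K)] with p h1 h2
    rw [h1, h2]
    simp only [sq, add_comm g h, S.add]

/-- The tensor square of the translate of a function. -/
def tens (f : X → ℝ) (g : G) (p : X × X) : ℝ := f (S.T g p.1) * f (S.T g p.2)

omit [StandardBorelSpace X] [IsProbabilityMeasure μ] [Countable G] in
lemma measurable_tens {f : X → ℝ} (hf : Measurable f) (g : G) : Measurable (S.tens f g) :=
  ((hf.comp (S.meas g)).comp measurable_fst).mul ((hf.comp (S.meas g)).comp measurable_snd)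

omit [StandardBorelSpace X] [IsProbabilityMeasure μ] [Countable G] in
lemma abs_tens_le {f : X → ℝ} (hf1 : ∀ x, |f x| ≤ 1) (g : G) (p : X × X) :
    |S.tens f g p| ≤ 1 := by
  rw [tens, abs_mul]
  exact mul_le_one₀ (hf1 _) (abs_nonneg _) (hf1 _)

/-- The tensor square as an element of `L²`. -/
noncomputable def xi {f : X → ℝ} (hf : Measurable f) (hf1 : ∀ x, |f x| ≤ 1) :
    Lp ℝ 2 (relSq μ hm.le) :=
  bLp hm.le (S.measurable_tens hf 0) (S.abs_tens_le hf1 0)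

variable {f : X → ℝ} (hf : Measurable f) (hf1 : ∀ x, |f x| ≤ 1)

lemma relIso_xi (g : G) : S.relIso hm g (S.xi hm hf hf1) =
    bLp hm.le (S.measurable_tens hf g) (S.abs_tens_le hf1 g) := by
  refine Lp.ext ((S.coeFn_relIso hm g _).trans ?_)
  filter_upwards [(S.mp_sq hm g).quasiMeasurePreserving.ae
    (coeFn_bLp (μ := μ) hm.le (S.measurable_tens hf 0) (S.abs_tens_le hf1 0)),
    coeFn_bLp (μ := μ) hm.le (S.measurable_tens hf g) (S.abs_tens_le hf1 g)] with p h1 h2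
  rw [h2, xi, h1]
  simp only [tens, sq, S.zero]

lemma inner_relIso_xi (a b : G) :
    ⟪S.relIso hm a (S.xi hm hf hf1), S.relIso hm b (S.xi hm hf hf1)⟫ =
      ∫ x, (ce m μ (fun y => f (S.T a y) * f (S.T b y)) x) ^ 2 ∂μ := by
  have h := integral_relSq_mul (μ := μ) (C := 1) hm.le (f := fun y => f (S.T a y) * f (S.T b y))
    ((hf.comp (S.meas a)).mul (hf.comp (S.meas b))) fun x => by
      rw [abs_mul]
      exact mul_le_one₀ (hf1 _) (abs_nonneg _) (hf1 _)
  rw [relIso_xi, relIso_xi, inner_bLp, ← h]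
  refine integral_congr_ae (ae_of_all _ fun p => ?_)
  simp only [tens]; ring

end Sys

end RelSquare

end PolyRec

namespace PolyRec

section Interface

set_option linter.overlappingInstances false

open MeasureTheory ProbabilityTheory Filter RealInnerProductSpace

variable {G : Type} [AddCommGroup G] {X : Type} {m : MeasurableSpace X}
  [mX : MeasurableSpace X] [StandardBorelSpace X] {μ : Measure X} [IsProbabilityMeasure μ]

lemma abs_convex_le {ι : Type} [Fintype ι] {l v : ι → ℝ} (hl : ∀ j, 0 ≤ l j) (hl1 : ∑ j, l j = 1)
    (hv : ∀ j, |v j| ≤ 1) : |∑ j, l j * v j| ≤ 1 := by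
  refine (Finset.abs_sum_le_sum_abs _ _).trans ?_
  rw [← hl1]
  refine Finset.sum_le_sum fun j _ => ?_
  rw [abs_mul, abs_of_nonneg (hl j)]
  exact mul_le_of_le_one_right (hl j) (hv j)

/-- Clipping to `[-1, 1]`. -/
noncomputable def clip (a : ℝ) : ℝ := max (-1) (min 1 a)

lemma abs_clip_le (a : ℝ) : |clip a| ≤ 1 :=
  abs_le.2 ⟨le_max_left _ _, max_le (by norm_num) (min_le_left _ _)⟩

lemma clip_of_abs_le {a : ℝ} (h : |a| ≤ 1) : clip a = a := by
  obtain ⟨h1, h2⟩ := abs_le.1 h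
  rw [clip, min_eq_right h2, max_eq_right h1]

lemma abs_clip_sub_le (a b : ℝ) : |clip a - clip b| ≤ |a - b| := by
  unfold clip
  refine (abs_max_sub_max_le_max _ _ _ _).trans ?_
  rw [sub_self, abs_zero, max_eq_right (abs_nonneg _)]
  refine (abs_min_sub_min_le_max _ _ _ _).trans ?_
  rw [sub_self, abs_zero, max_eq_right (abs_nonneg _)]

lemma measurable_clip : Measurable clip := by unfold clip; fun_prop

namespace Sys

/-- The tensor square of `f` has `0` in the closed convex hull of its `H`-orbit. -/
def ZeroMem (m : MeasurableSpace X) [mX : MeasurableSpace X] [StandardBorelSpace X]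
    {μ : Measure X} [IsProbabilityMeasure μ] (S : Sys G μ) (H : AddSubgroup G) (f : X → ℝ) : Prop :=
  ∀ ε > 0, ∃ (ι : Type) (_ : Fintype ι) (l : ι → ℝ) (h : ι → G),
    (∀ j, 0 ≤ l j) ∧ ∑ j, l j = 1 ∧ (∀ j, h j ∈ H) ∧
    ∑ j, ∑ j', l j * l j' *
      ∫ x, (ce m μ (fun y => f (S.T (h j) y) * f (S.T (h j') y)) x) ^ 2 ∂μ ≤ ε

variable [Countable G] (S : Sys G μ) (hm : S.IsFactor m) {H : AddSubgroup G}
  {f : X → ℝ} (hf : Measurable f) (hf1 : ∀ x, |f x| ≤ 1)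

lemma norm_sq_sum_relIso {ι : Type} [Fintype ι] (l : ι → ℝ) (h : ι → G) :
    ‖∑ j, l j • S.relIso hm (h j) (S.xi hm hf hf1)‖ ^ 2 = ∑ j, ∑ j', l j * l j' *
      ∫ x, (ce m μ (fun y => f (S.T (h j) y) * f (S.T (h j') y)) x) ^ 2 ∂μ := by
  rw [← real_inner_self_eq_norm_sq, sum_inner]
  refine Finset.sum_congr rfl fun j _ => ?_
  rw [inner_sum]
  refine Finset.sum_congr rfl fun j' _ => ?_
  rw [real_inner_smul_left, real_inner_smul_right, inner_relIso_xi, mul_assoc]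

lemma zero_mem_hull_iff :
    (0 : Lp ℝ 2 (relSq μ hm.le)) ∈ hull (S.relIso hm) H (S.xi hm hf hf1) ↔ S.ZeroMem m H f := by
  rw [hull, Metric.mem_closure_iff]
  constructor
  · intro h ε hε
    obtain ⟨y, hy, hd⟩ := h (Real.sqrt ε) (Real.sqrt_pos.2 hε)
    obtain ⟨ι, hι, l, z, hl, hl1, hz, rfl⟩ := mem_convexHull_iff_exists_fintype.1 hy
    choose h hh hz using hz
    refine ⟨ι, hι, l, h, hl, hl1, hh, ?_⟩
    rw [← S.norm_sq_sum_relIso hm hf hf1]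
    simp only [← hz, dist_zero_left] at hd
    exact (Real.lt_sqrt (norm_nonneg _)).1 hd |>.le
  · intro h ε hε
    obtain ⟨ι, hι, l, g, hl, hl1, hg, hle⟩ := h ((ε / 2) ^ 2) (by positivity)
    rw [← S.norm_sq_sum_relIso hm hf hf1] at hle
    refine ⟨_, mem_convexHull_iff_exists_fintype.2 ⟨ι, hι, l, _, hl, hl1,
      fun j => ⟨g j, hg j, rfl⟩, rfl⟩, ?_⟩
    rw [dist_zero_left]
    have := abs_le_of_sq_le_sq hle (by positivity)
    rw [abs_of_nonneg (norm_nonneg _)] at this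
    exact this.trans_lt (by linarith)

include hm hf hf1 in
/-- If `0` is not in the hull, there is an invariant kernel correlating with `f ⊗ f`. -/
lemma exists_kernel (h0 : ¬ S.ZeroMem m H f) :
    ∃ k : X × X → ℝ, Measurable k ∧ (∀ p, |k p| ≤ 1) ∧
      (∀ h ∈ H, ∀ᵐ p ∂(relSq μ hm.le), k (S.sq h p) = k p) ∧
      0 < ∫ p, k p * S.tens f 0 p ∂(relSq μ hm.le) ∧
      ∀ ε > 0, ∃ (ι : Type) (_ : Fintype ι) (l : ι → ℝ) (h : ι → G),
        (∀ j, 0 ≤ l j) ∧ ∑ j, l j = 1 ∧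
        ∫ p, (k p - ∑ j, l j * S.tens f (h j) p) ^ 2 ∂(relSq μ hm.le) ≤ ε := by
  rw [← S.zero_mem_hull_iff hm hf hf1] at h0
  obtain ⟨K, hK, hinv, hpos⟩ := (S.isoAction_relIso hm).exists_invariant h0
  have hKm : Measurable (fun p => K p) := (Lp.stronglyMeasurable K).measurable
  have happ : ∀ ε > 0, ∃ (ι : Type) (_ : Fintype ι) (l : ι → ℝ) (h : ι → G),
        (∀ j, 0 ≤ l j) ∧ ∑ j, l j = 1 ∧
        ∫ p, (clip (K p) - ∑ j, l j * S.tens f (h j) p) ^ 2 ∂(relSq μ hm.le) ≤ ε ^ 2 ∧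
        ∃ b : ∀ p, |∑ j, l j * S.tens f (h j) p| ≤ 1,
        ‖K - bLp hm.le (Finset.measurable_sum _ fun j _ =>
          (S.measurable_tens hf (h j)).const_mul (l j)) b‖ ≤ ε := by
    intro ε hε
    obtain ⟨y, hy, hd⟩ := Metric.mem_closure_iff.1 hK ε hε
    obtain ⟨ι, hι, l, z, hl, hl1, hz, rfl⟩ := mem_convexHull_iff_exists_fintype.1 hy
    choose h hh hz using hz
    have b : ∀ p, |∑ j, l j * S.tens f (h j) p| ≤ 1 := fun p =>
      abs_convex_le hl hl1 fun j => S.abs_tens_le hf1 _ p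
    have hmeas : Measurable fun p => ∑ j, l j * S.tens f (h j) p :=
      Finset.measurable_sum _ fun j _ => (S.measurable_tens hf (h j)).const_mul (l j)
    have he : ∑ j, l j • z j = bLp hm.le hmeas b := by
      refine Lp.ext ?_
      have h1 : ∀ᵐ p ∂(relSq μ hm.le), ∀ j,
          S.relIso hm (h j) (S.xi hm hf hf1) p = S.tens f (h j) p := by
        rw [ae_all_iff]
        intro j
        rw [relIso_xi]
        exact coeFn_bLp _ _ _
      have h2 : ∀ᵐ p ∂(relSq μ hm.le), ∀ j, (l j • z j : Lp ℝ 2 (relSq μ hm.le)) p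
          = l j * z j p := by
        rw [ae_all_iff]
        intro j
        filter_upwards [Lp.coeFn_smul (l j) (z j)] with p hp
        rw [hp]; rfl
      filter_upwards [h1, h2, coeFn_bLp (μ := μ) hm.le hmeas b,
        Lp.coeFn_finsetSum Finset.univ fun j => l j • z j] with p h1 h2 h3 h4
      rw [h4, h3, Finset.sum_apply]
      refine Finset.sum_congr rfl fun j _ => ?_
      rw [h2 j, ← hz j, h1 j]
    rw [dist_eq_norm, he] at hd
    refine ⟨ι, hι, l, h, hl, hl1, ?_, b, hd.le⟩
    have h3 : ‖K - bLp hm.le hmeas b‖ ^ 2 ≤ ε ^ 2 := by gcongr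
    refine le_trans ?_ h3
    rw [norm_sub_bLp_sq]
    have hL : MemLp (fun p => K p - ∑ j, l j * S.tens f (h j) p) 2 (relSq μ hm.le) :=
      (Lp.memLp K).sub (MemLp.of_bound hmeas.aestronglyMeasurable 1 (ae_of_all _ b))
    refine integral_mono_of_nonneg (ae_of_all _ fun p => sq_nonneg _) hL.integrable_sq
      (ae_of_all _ fun p => ?_)
    have := abs_clip_sub_le (K p) (∑ j, l j * S.tens f (h j) p)
    rw [clip_of_abs_le (b p)] at this
    exact sq_le_sq.2 this
  have hkm : Measurable fun p => clip (K p) := measurable_clip.comp hKm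
  have hkK : K = bLp hm.le hkm fun p => abs_clip_le _ := by
    rw [← sub_eq_zero, ← norm_le_zero_iff]
    refine le_of_forall_pos_le_add fun ε hε => ?_
    obtain ⟨ι, hι, l, h, hl, hl1, h1, b, h2⟩ := happ (ε / 2) (by positivity)
    set Φ := bLp (μ := μ) hm.le (Finset.measurable_sum _ fun j _ =>
          (S.measurable_tens hf (h j)).const_mul (l j)) b with hΦ
    have h3 : ‖bLp (μ := μ) hm.le hkm (fun p => abs_clip_le (K p)) - Φ‖ ^ 2 ≤ (ε / 2) ^ 2 := by
      rw [hΦ, norm_sub_bLp_sq]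
      refine le_trans (integral_congr_ae ?_).le h1
      filter_upwards [coeFn_bLp (μ := μ) hm.le hkm fun p => abs_clip_le (K p)] with p hp
      rw [hp]
    have h4 := abs_le_of_sq_le_sq h3 (by positivity)
    rw [abs_of_nonneg (norm_nonneg _)] at h4
    rw [norm_sub_rev] at h4
    have := norm_sub_le_norm_sub_add_norm_sub K Φ (bLp hm.le hkm fun p => abs_clip_le (K p))
    linarith
  refine ⟨fun p => clip (K p), hkm, fun p => abs_clip_le _, fun h hh => ?_, ?_, fun ε hε => ?_⟩
  · have h1 := S.coeFn_relIso hm h K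
    rw [hinv h hh] at h1
    filter_upwards [h1] with p hp
    rw [← hp]
  · rw [hkK, xi, inner_bLp] at hpos
    exact hpos
  · obtain ⟨ι, hι, l, h, hl, hl1, h1, -⟩ := happ (Real.sqrt ε) (Real.sqrt_pos.2 hε)
    rw [Real.sq_sqrt hε.le] at h1
    exact ⟨ι, hι, l, h, hl, hl1, h1⟩

variable {S}

lemma norm_xi_le : ‖S.xi hm hf hf1‖ ≤ 1 := by
  have : ‖S.xi hm hf hf1‖ ^ 2 ≤ 1 := by
    have h := S.inner_relIso_xi hm hf hf1 0 0
    rw [(S.isoAction_relIso hm).zero, real_inner_self_eq_norm_sq] at h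
    rw [h]
    have : ∀ x, (ce m μ (fun y => f (S.T 0 y) * f (S.T 0 y)) x) ^ 2 ≤ 1 := fun x => by
      rw [sq_le_one_iff_abs_le_one]
      refine abs_ce_le (μ := μ) (m := m) (fun y => ?_) x
      rw [abs_mul]
      exact mul_le_one₀ (hf1 _) (abs_nonneg _) (hf1 _)
    calc _ ≤ ∫ _, (1 : ℝ) ∂μ := integral_mono_of_nonneg (ae_of_all _ fun _ => sq_nonneg _)
          (integrable_const _) (ae_of_all _ this)
      _ = 1 := by simp
  exact (sq_le_one_iff₀ (norm_nonneg _)).1 this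

include hm hf hf1 in
/-- Vanishing of correlations along `g` from `ZeroMem` and a uniform lower bound. -/
lemma ZeroMem.tendsto {g : G} (h0 : S.ZeroMem m (H ⊔ AddSubgroup.zmultiples g) f)
    (hPH : ∀ c > 0, ∃ c' > 0, ∀ u : X → ℝ, Measurable u → (∀ x, |u x| ≤ 1) →
      c ≤ ∫ x, (ce m μ (fun y => f y * u y) x) ^ 2 ∂μ →
      ∀ (ι : Type) [Fintype ι] (l : ι → ℝ) (h : ι → G), (∀ j, 0 ≤ l j) → ∑ j, l j = 1 →
      (∀ j, h j ∈ H) → c' ≤ ∑ j, ∑ j', l j * l j' *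
        ∫ x, (ce m μ (fun y => f (S.T (h j') y) * u (S.T (h j) y)) x) ^ 2 ∂μ) :
    Tendsto (fun N : ℕ => (∑ n ∈ Finset.range N,
      ∫ x, (ce m μ (fun y => f y * f (S.T (n • g) y)) x) ^ 2 ∂μ) / N) atTop (nhds 0) := by
  have hU := S.isoAction_relIso hm
  have hin : ∀ g : G, ⟪S.xi hm hf hf1, S.relIso hm g (S.xi hm hf hf1)⟫ =
      ∫ x, (ce m μ (fun y => f y * f (S.T g y)) x) ^ 2 ∂μ := fun g => by
    have := S.inner_relIso_xi hm hf hf1 0 g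
    rw [hU.zero] at this
    simpa only [S.zero] using this
  simp only [← hin]
  refine hU.tendsto_of_zero_mem_hull ((S.zero_mem_hull_iff hm hf hf1).2 h0) (norm_xi_le hm hf hf1)
    (fun a b => ?_) fun c hc => ?_
  · rw [inner_relIso_xi]
    exact integral_nonneg fun _ => sq_nonneg _
  · obtain ⟨c', hc', h⟩ := hPH c hc
    refine ⟨c', hc', fun n hn ι _ l h' hl hl1 hh => ?_⟩
    rw [hin] at hn
    refine (h (fun y => f (S.T (n • g) y)) (hf.comp (S.meas _)) (fun x => hf1 _) hn ι l h' hl hl1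
      hh).trans_eq ?_
    refine Finset.sum_congr rfl fun j _ => Finset.sum_congr rfl fun j' _ => ?_
    rw [← hU.add, inner_relIso_xi, add_comm (h' j)]
    simp only [S.add]

include hm hf hf1 in
lemma false_of_tendsto {g : G} {k : ℕ} (hk : 1 ≤ k) (hkg : k • g ∈ H)
    (ht : Tendsto (fun N : ℕ => (∑ n ∈ Finset.range N,
      ∫ x, (ce m μ (fun y => f y * f (S.T (n • g) y)) x) ^ 2 ∂μ) / N) atTop (nhds 0))
    {c' : ℝ} (hc' : 0 < c')
    (hPH : ∀ (ι : Type) [Fintype ι] (l : ι → ℝ) (h : ι → G), (∀ j, 0 ≤ l j) → ∑ j, l j = 1 →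
      (∀ j, h j ∈ H) → c' ≤ ∑ j, ∑ j', l j * l j' *
        ∫ x, (ce m μ (fun y => f (S.T (h j') y) * f (S.T (h j) y)) x) ^ 2 ∂μ) : False := by
  have hU := S.isoAction_relIso hm
  have hin : ∀ g : G, ⟪S.xi hm hf hf1, S.relIso hm g (S.xi hm hf hf1)⟫ =
      ∫ x, (ce m μ (fun y => f y * f (S.T g y)) x) ^ 2 ∂μ := fun g => by
    have := S.inner_relIso_xi hm hf hf1 0 g
    rw [hU.zero] at this
    simpa only [S.zero] using this
  simp only [← hin] at ht
  refine hU.false_of_nsmul_mem hk hkg (fun a b => ?_) ht hc' fun ι _ l h hl hl1 hh => ?_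
  · rw [inner_relIso_xi]
    exact integral_nonneg fun _ => sq_nonneg _
  · simp only [inner_relIso_xi]
    exact hPH ι l h hl hl1 hh

end Sys

end Interface

end PolyRec

namespace PolyRec

section BM

set_option linter.overlappingInstances false

open MeasureTheory ProbabilityTheory Filter

/-- Bounded measurable functions. -/
structure BM {X : Type} [MeasurableSpace X] (f : X → ℝ) : Prop where
  meas : Measurable f
  bdd : ∃ C, ∀ x, |f x| ≤ C

namespace BM

variable {X : Type} [MeasurableSpace X] {f g : X → ℝ}

lemma const (c : ℝ) : BM fun _ : X => c := ⟨measurable_const, |c|, fun _ => le_rfl⟩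

lemma of_le_one (hf : Measurable f) (h : ∀ x, |f x| ≤ 1) : BM f := ⟨hf, 1, h⟩

lemma add (hf : BM f) (hg : BM g) : BM fun x => f x + g x := by
  obtain ⟨C, hC⟩ := hf.bdd
  obtain ⟨D, hD⟩ := hg.bdd
  exact ⟨hf.meas.add hg.meas, C + D, fun x => (abs_add_le _ _).trans (add_le_add (hC x) (hD x))⟩

lemma mul (hf : BM f) (hg : BM g) : BM fun x => f x * g x := by
  obtain ⟨C, hC⟩ := hf.bdd
  obtain ⟨D, hD⟩ := hg.bdd
  refine ⟨hf.meas.mul hg.meas, C * D, fun x => ?_⟩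
  rw [abs_mul]
  exact mul_le_mul (hC x) (hD x) (abs_nonneg _) ((abs_nonneg _).trans (hC x))

lemma const_mul (hf : BM f) (c : ℝ) : BM fun x => c * f x := (const c).mul hf

lemma sub (hf : BM f) (hg : BM g) : BM fun x => f x - g x := by
  have := hf.add (hg.const_mul (-1))
  simpa [sub_eq_add_neg] using this

lemma sq (hf : BM f) : BM fun x => f x ^ 2 := by simpa [pow_two] using hf.mul hf

lemma abs (hf : BM f) : BM fun x => |f x| := by
  obtain ⟨C, hC⟩ := hf.bdd
  exact ⟨hf.meas.abs, C, fun x => by rw [abs_abs]; exact hC x⟩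

lemma sum {ι : Type*} {s : Finset ι} {f : ι → X → ℝ} (hf : ∀ i ∈ s, BM (f i)) :
    BM fun x => ∑ i ∈ s, f i x := by
  classical
  induction s using Finset.induction_on with
  | empty => simpa using const (X := X) 0
  | insert a s ha ih =>
    simp only [Finset.sum_insert ha]
    exact (hf a (by simp)).add (ih fun i hi => hf i (by simp [hi]))

lemma comp {Y : Type} [MeasurableSpace Y] (hf : BM f) {T : Y → X} (hT : Measurable T) :
    BM fun x => f (T x) := by
  obtain ⟨C, hC⟩ := hf.bdd
  exact ⟨hf.meas.comp hT, C, fun x => hC _⟩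

lemma indicator {s : Set X} (hs : MeasurableSet s) : BM (s.indicator (fun _ => (1 : ℝ))) :=
  ⟨measurable_const.indicator hs, 1, fun x => by by_cases h : x ∈ s <;> simp [h]⟩

lemma integrable {μ : Measure X} [IsFiniteMeasure μ] (hf : BM f) : Integrable f μ := by
  obtain ⟨C, hC⟩ := hf.bdd
  exact integrable_of_abs_le hf.meas hC

lemma integral_mono {μ : Measure X} [IsFiniteMeasure μ] (hf : BM f) (hg : BM g)
    (h : ∀ x, f x ≤ g x) : ∫ x, f x ∂μ ≤ ∫ x, g x ∂μ :=
  MeasureTheory.integral_mono hf.integrable hg.integrable h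

lemma sq_integral_le {μ : Measure X} [IsProbabilityMeasure μ] (hf : BM f) :
    (∫ x, f x ∂μ) ^ 2 ≤ ∫ x, f x ^ 2 ∂μ := by
  set c := ∫ x, f x ∂μ with hc
  have h : 0 ≤ ∫ x, (f x - c) ^ 2 ∂μ := integral_nonneg fun _ => sq_nonneg _
  have e : ∫ x, (f x - c) ^ 2 ∂μ = ∫ x, f x ^ 2 ∂μ - 2 * c * c + c ^ 2 := by
    simp_rw [sub_sq]
    rw [integral_add ((hf.sq.sub ((hf.const_mul 2).mul (const c))).integrable)
      (const (c ^ 2)).integrable, integral_sub hf.sq.integrable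
      ((hf.const_mul 2).mul (const c)).integrable]
    simp_rw [mul_comm (2 * f _) c, integral_const_mul]
    rw [← hc]
    simp; ring
  nlinarith

lemma sq_integral_mul_le {μ : Measure X} [IsProbabilityMeasure μ] (hf : BM f)
    (hg : BM g) (hg1 : ∀ x, |g x| ≤ 1) :
    (∫ x, f x * g x ∂μ) ^ 2 ≤ ∫ x, f x ^ 2 ∂μ := by
  refine (hf.mul hg).sq_integral_le.trans ?_
  refine integral_mono (hf.mul hg).sq hf.sq fun x => ?_
  rw [mul_pow]
  exact mul_le_of_le_one_right (sq_nonneg _) ((sq_le_one_iff_abs_le_one _).2 (hg1 x))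

variable {X : Type} {m : MeasurableSpace X} [mX : MeasurableSpace X] [StandardBorelSpace X]
  {μ : Measure X} [IsProbabilityMeasure μ] {f g : X → ℝ}

lemma ce' (hm : m ≤ mX) (hf : BM f) : BM (ce m μ f) := by
  obtain ⟨C, hC⟩ := hf.bdd
  exact ⟨measurable_ce' hm hf.meas, C, abs_ce_le hC⟩

lemma ce_mono (hf : BM f) (hg : BM g) (h : ∀ x, f x ≤ g x) (x : X) :
    ce m μ f x ≤ ce m μ g x := integral_mono hf hg h

lemma ce_add (hf : BM f) (hg : BM g) (x : X) :
    ce m μ (fun y => f y + g y) x = ce m μ f x + ce m μ g x :=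
  integral_add hf.integrable hg.integrable

lemma ce_sub (hf : BM f) (hg : BM g) (x : X) :
    ce m μ (fun y => f y - g y) x = ce m μ f x - ce m μ g x :=
  integral_sub hf.integrable hg.integrable

lemma integral_ce' (hm : m ≤ mX) (hf : BM f) : ∫ x, ce m μ f x ∂μ = ∫ x, f x ∂μ := by
  obtain ⟨C, hC⟩ := hf.bdd
  exact integral_ce hm hf.meas hC

/-- Markov's inequality. -/
lemma measureReal_gt_le {Y : Type} [MeasurableSpace Y] {μ : Measure Y} [IsFiniteMeasure μ]
    {f : Y → ℝ} (hf : BM f) (h0 : ∀ x, 0 ≤ f x) {t : ℝ} (ht : 0 < t) :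
    μ.real {x | t < f x} ≤ (∫ x, f x ∂μ) / t := by
  have h1 := mul_meas_ge_le_integral_of_nonneg (μ := μ) (ae_of_all _ h0) hf.integrable t
  rw [le_div_iff₀ ht, mul_comm]
  refine le_trans ?_ h1
  refine mul_le_mul_of_nonneg_left (measureReal_mono fun x hx => ?_) ht.le
  simp only [Set.mem_ofPred_eq] at hx ⊢
  exact hx.le

end BM

lemma ce_const_mul {X : Type} {m : MeasurableSpace X} [mX : MeasurableSpace X]
    [StandardBorelSpace X] {μ : Measure X} [IsProbabilityMeasure μ] (f : X → ℝ) (c : ℝ) (x : X) :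
    ce m μ (fun y => c * f y) x = c * ce m μ f x :=
  integral_const_mul _ _

end BM

section AP

set_option linter.overlappingInstances false

open MeasureTheory ProbabilityTheory Filter

variable {G : Type} [AddCommGroup G] {X : Type} {m : MeasurableSpace X}
  [mX : MeasurableSpace X] [StandardBorelSpace X] {μ : Measure X} [IsProbabilityMeasure μ]

namespace Sys

/-- Functions that are almost periodic relative to `m` along `H`. -/
structure AP (m : MeasurableSpace X) [mX : MeasurableSpace X] [StandardBorelSpace X]
    {μ : Measure X} [IsProbabilityMeasure μ] (S : Sys G μ) (H : AddSubgroup G)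
    (F : X → ℝ) : Prop where
  bm : BM F
  approx : ∀ ε > 0, ∀ δ > 0, ∃ (κ : Type) (_ : Finite κ) (g : κ → X → ℝ) (B : Set X),
    (∀ i, BM (g i)) ∧ MeasurableSet[m] B ∧ μ.real Bᶜ ≤ δ ∧
    ∀ᵐ x ∂μ, x ∈ B → ∀ h ∈ H, ∃ i, ce m μ (fun y => (F (S.T h y) - g i y) ^ 2) x ≤ ε

variable {S : Sys G μ} {H : AddSubgroup G} {F F' : X → ℝ}

lemma AP.comp₂ (hF : S.AP m H F) (hF' : S.AP m H F') {Φ : ℝ → ℝ → ℝ}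
    {L : ℝ} (hL : 0 < L)
    (hΦ : ∀ a b a' b', |Φ a b - Φ a' b'| ≤ L * (|a - a'| + |b - b'|)) :
    S.AP m H (fun x => Φ (F x) (F' x)) := by
  have hcont : Continuous fun p : ℝ × ℝ => Φ p.1 p.2 := by
    rw [Metric.continuous_iff]
    intro p ε hε
    refine ⟨ε / (2 * L), by positivity, fun q hq => ?_⟩
    rw [Real.dist_eq]
    have h1 : |q.1 - p.1| < ε / (2 * L) := by
      rw [← Real.dist_eq]; exact (le_max_left _ _).trans_lt hq
    have h2 : |q.2 - p.2| < ε / (2 * L) := by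
      rw [← Real.dist_eq]; exact (le_max_right _ _).trans_lt hq
    calc _ ≤ L * (|q.1 - p.1| + |q.2 - p.2|) := hΦ _ _ _ _
      _ < L * (ε / (2 * L) + ε / (2 * L)) := by gcongr
      _ = ε := by field_simp; ring
  have hBM : ∀ {f g : X → ℝ}, BM f → BM g → BM fun x => Φ (f x) (g x) := by
    intro f g hf hg
    obtain ⟨C, hC⟩ := hf.bdd
    obtain ⟨D, hD⟩ := hg.bdd
    refine ⟨hcont.measurable.comp (hf.meas.prodMk hg.meas), |Φ 0 0| + L * (C + D), fun x => ?_⟩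
    have h1 := hΦ (f x) (g x) 0 0
    have h2 : |Φ (f x) (g x)| ≤ |Φ 0 0| + |Φ (f x) (g x) - Φ 0 0| := by
      have := abs_add_le (Φ 0 0) (Φ (f x) (g x) - Φ 0 0)
      rwa [add_sub_cancel] at this
    rw [sub_zero, sub_zero] at h1
    have h3 : L * (|f x| + |g x|) ≤ L * (C + D) := by
      have := hC x; have := hD x; gcongr
    linarith
  refine ⟨hBM hF.bm hF'.bm, fun ε hε δ hδ => ?_⟩
  obtain ⟨κ, _, g, B, hg, hB, hBδ, hgB⟩ := hF.approx (ε / (4 * L ^ 2)) (by positivity) (δ / 2)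
    (by positivity)
  obtain ⟨κ', _, g', B', hg', hB', hBδ', hgB'⟩ := hF'.approx (ε / (4 * L ^ 2)) (by positivity)
    (δ / 2) (by positivity)
  refine ⟨κ × κ', inferInstance, fun i x => Φ (g i.1 x) (g' i.2 x), B ∩ B',
    fun i => hBM (hg _) (hg' _), hB.inter hB', ?_, ?_⟩
  · rw [Set.compl_inter]
    exact (measureReal_union_le _ _).trans (by linarith)
  · filter_upwards [hgB, hgB'] with x h1 h2 hx h hh
    obtain ⟨i, hi⟩ := h1 hx.1 h hh
    obtain ⟨i', hi'⟩ := h2 hx.2 h hh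
    refine ⟨(i, i'), ?_⟩
    have b1 : BM fun y => (F (S.T h y) - g i y) ^ 2 := ((hF.bm.comp (S.meas h)).sub (hg i)).sq
    have b2 : BM fun y => (F' (S.T h y) - g' i' y) ^ 2 := ((hF'.bm.comp (S.meas h)).sub (hg' i')).sq
    calc _ ≤ ce m μ (fun y => (2 * L ^ 2) * ((F (S.T h y) - g i y) ^ 2 +
          (F' (S.T h y) - g' i' y) ^ 2)) x := by
          refine BM.ce_mono (((hBM hF.bm hF'.bm).comp (S.meas h)).sub (hBM (hg i) (hg' i'))).sq
            ((b1.add b2).const_mul _) (fun y => ?_) x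
          have h3 := hΦ (F (S.T h y)) (F' (S.T h y)) (g i y) (g' i' y)
          rw [← sq_abs]
          set a := F (S.T h y) - g i y
          set b := F' (S.T h y) - g' i' y
          calc _ ≤ (L * (|a| + |b|)) ^ 2 := by gcongr
            _ ≤ _ := by
              rw [← sq_abs a, ← sq_abs b]
              nlinarith [mul_nonneg (sq_nonneg L) (sq_nonneg (|a| - |b|))]
      _ ≤ ε := by
          rw [ce_const_mul, BM.ce_add b1 b2]
          calc _ ≤ 2 * L ^ 2 * (ε / (4 * L ^ 2) + ε / (4 * L ^ 2)) := by gcongr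
            _ = ε := by field_simp; ring

lemma AP.comp_T [Countable G] (hm : S.IsFactor m) (hF : S.AP m H F) (a : G) :
    S.AP m H (fun x => F (S.T a x)) := by
  refine ⟨hF.bm.comp (S.meas a), fun ε hε δ hδ => ?_⟩
  obtain ⟨κ, _, g, B, hg, hB, hBδ, hgB⟩ := hF.approx ε hε δ hδ
  refine ⟨κ, inferInstance, fun i x => g i (S.T a x), S.T a ⁻¹' B, fun i => (hg i).comp (S.meas a),
    hm.meas a hB, ?_, ?_⟩
  · rw [← Set.preimage_compl, measureReal_def,
      (S.mp a).measure_preimage (hm.le _ hB).compl.nullMeasurableSet]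
    exact hBδ
  · have h2 : ∀ᵐ x ∂μ, ∀ h i, ce m μ (fun y => (F (S.T h (S.T a y)) - g i (S.T a y)) ^ 2) x =
        ce m μ (fun y => (F (S.T h y) - g i y) ^ 2) (S.T a x) := by
      rw [ae_all_iff]; intro h
      rw [ae_all_iff]; intro i
      have b1 : BM fun y => (F (S.T h y) - g i y) ^ 2 := ((hF.bm.comp (S.meas h)).sub (hg i)).sq
      obtain ⟨C, hC⟩ := b1.bdd
      exact S.ce_comp hm b1.meas hC a
    filter_upwards [S.ae_comp a hgB, h2] with x h1 h2 hx h hh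
    obtain ⟨i, hi⟩ := h1 hx h hh
    refine ⟨i, ?_⟩
    rw [← h2] at hi
    simpa only [← S.add, add_comm a h] using hi

lemma AP.indicator_of_measurable [Countable G] (hm : S.IsFactor m) {B : Set X}
    (hB : MeasurableSet[m] B) : S.AP m H (B.indicator fun _ => (1 : ℝ)) := by
  refine ⟨BM.indicator (hm.le _ hB), fun ε hε δ hδ => ?_⟩
  refine ⟨Bool, inferInstance, fun b _ => if b then 1 else 0, Set.univ, fun b => BM.const _,
    MeasurableSet.univ, by simpa using hδ.le, ?_⟩
  have h2 : ∀ᵐ x ∂μ, ∀ h, ∀ᵐ y ∂(condExpKernel μ m x),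
      B.indicator (fun _ => (1 : ℝ)) (S.T h y) = B.indicator (fun _ => (1 : ℝ)) (S.T h x) := by
    rw [ae_all_iff]; intro h
    refine ker_const (D := 1) hm.le ?_ fun x => ?_
    · exact (Measurable.indicator (m := m) measurable_const hB).comp (hm.meas h)
    · by_cases h : S.T h x ∈ B <;> simp [h]
  classical
  filter_upwards [h2] with x hx _ h hh
  refine ⟨decide (S.T h x ∈ B), ?_⟩
  have : ce m μ (fun y => (B.indicator (fun _ => (1 : ℝ)) (S.T h y) -
      if (decide (S.T h x ∈ B)) = true then 1 else 0) ^ 2) x = 0 := by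
    refine integral_eq_zero_of_ae ?_
    filter_upwards [hx h] with y hy
    rw [hy]
    by_cases h : S.T h x ∈ B <;> simp [h]
  rw [this]
  exact hε.le

end Sys

end AP

end PolyRec

namespace PolyRec

section FiberOp

set_option linter.overlappingInstances false

open MeasureTheory ProbabilityTheory Filter

variable {G : Type} [AddCommGroup G] {X : Type} {m : MeasurableSpace X}
  [mX : MeasurableSpace X] [StandardBorelSpace X] {μ : Measure X} [IsProbabilityMeasure μ]

/-- Integration of a kernel along the fibres of `m`. -/
noncomputable def fiberInt (m : MeasurableSpace X) [mX : MeasurableSpace X]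
    [StandardBorelSpace X] (μ : Measure X) [IsProbabilityMeasure μ] (φ : X × X → ℝ) : X → ℝ :=
  fun x => ∫ y, φ (x, y) ∂(condExpKernel μ m x)

lemma bm_fiberInt (hm : m ≤ mX) {φ : X × X → ℝ} (hφ : BM φ) : BM (fiberInt m μ φ) := by
  obtain ⟨C, hC⟩ := hφ.bdd
  refine ⟨(hφ.meas.stronglyMeasurable.integral_kernel_prod_right' (κ := relKer μ hm)).measurable,
    C, fun x => ?_⟩
  have := norm_integral_le_of_norm_le_const (μ := condExpKernel μ m x) (f := fun y => φ (x, y))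
    (C := C) (ae_of_all _ fun y => hC _)
  simpa [fiberInt] using this

/-- Rounding a number of absolute value at most one. -/
lemma exists_round {M : ℕ} (hM : 0 < M) {c : ℝ} (hc : |c| ≤ 1) :
    ∃ i : Finset.Icc (-(M : ℤ)) M, |c - (i : ℤ) / M| ≤ 1 / M := by
  have hM' : (0 : ℝ) < M := by exact_mod_cast hM
  obtain ⟨h1, h2⟩ := abs_le.1 hc
  refine ⟨⟨⌊c * M⌋, Finset.mem_Icc.2 ⟨?_, ?_⟩⟩, ?_⟩
  · rw [Int.le_floor]; push_cast; nlinarith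
  · have : ((⌊c * M⌋ : ℤ) : ℝ) ≤ M := (Int.floor_le _).trans (by nlinarith)
    exact_mod_cast this
  · have h3 := Int.floor_le (c * M)
    have h4 := Int.lt_floor_add_one (c * M)
    have : c - (⌊c * M⌋ : ℤ) / M = (c * M - ⌊c * M⌋) / M := by field_simp
    rw [this, abs_div, abs_of_pos hM']
    gcongr
    rw [abs_le]
    constructor <;> linarith

namespace Sys

variable {S : Sys G μ} {H : AddSubgroup G}

lemma fiberInt_comp [Countable G] (hm : S.IsFactor m) {k : X × X → ℝ}
    (hinv : ∀ h ∈ H, ∀ᵐ p ∂(relSq μ hm.le), k (S.sq h p) = k p) {f : X → ℝ}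
    {h : G} (hh : h ∈ H) :
    ∀ᵐ x ∂μ, fiberInt m μ (fun p => k p * f p.2) (S.T h x) =
      fiberInt m μ (fun p => k p * f (S.T h p.2)) x := by
  filter_upwards [S.ker_map hm, ae_relSq hm.le (hinv h hh)] with x h1 h2
  have he : MeasurableEmbedding (S.T h) :=
    MeasurableEquiv.measurableEmbedding
      { toFun := S.T h
        invFun := S.T (-h)
        left_inv := S.neg_apply h
        right_inv := S.apply_neg h
        measurable_toFun := S.meas h
        measurable_invFun := S.meas (-h) }
  rw [fiberInt, h1 h, he.integral_map]
  refine integral_congr_ae ?_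
  filter_upwards [h2] with y hy
  simp only [sq] at hy
  simp only [hy]

lemma AP.of_kernel [Countable G] (hm : S.IsFactor m) {k : X × X → ℝ} (hk : Measurable k)
    (hk1 : ∀ p, |k p| ≤ 1)
    (hinv : ∀ h ∈ H, ∀ᵐ p ∂(relSq μ hm.le), k (S.sq h p) = k p)
    {f : X → ℝ} (hf : Measurable f) (hf1 : ∀ x, |f x| ≤ 1)
    (happ : ∀ ε > 0, ∃ (ι : Type) (_ : Fintype ι) (l : ι → ℝ) (h : ι → G),
        (∀ j, 0 ≤ l j) ∧ ∑ j, l j = 1 ∧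
        ∫ p, (k p - ∑ j, l j * S.tens f (h j) p) ^ 2 ∂(relSq μ hm.le) ≤ ε) :
    S.AP m H (fiberInt m μ fun p => k p * f p.2) := by
  have bk : BM k := .of_le_one hk hk1
  have bf : BM f := .of_le_one hf hf1
  have bF : BM (fiberInt m μ fun p => k p * f p.2) :=
    bm_fiberInt hm.le (bk.mul (bf.comp measurable_snd))
  refine ⟨bF, fun ε hε δ hδ => ?_⟩
  obtain ⟨ι, _, l, a, hl, hl1, hle⟩ := happ (δ * (ε / 4)) (by positivity)
  set q : X × X → ℝ := fun p => k p - ∑ j, l j * S.tens f (a j) p with hq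
  have btens : ∀ g, BM (S.tens f g) := fun g =>
    .of_le_one (S.measurable_tens hf g) (S.abs_tens_le hf1 g)
  have bq : BM q := bk.sub (.sum fun j _ => (btens _).const_mul _)
  set D := fiberInt m μ fun p => q p ^ 2 with hD
  have bD : BM D := bm_fiberInt hm.le bq.sq
  have hDint : ∫ x, D x ∂μ ≤ δ * (ε / 4) := by
    obtain ⟨C, hC⟩ := bq.sq.bdd
    rw [integral_relSq hm.le bq.sq.meas hC] at hle
    exact hle
  have hD0 : ∀ x, 0 ≤ D x := fun x => integral_nonneg fun _ => sq_nonneg _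
  obtain ⟨M, hM⟩ := exists_nat_gt (max 1 (2 / Real.sqrt ε))
  have hM0 : 0 < M := by
    have := (le_max_left _ _).trans_lt hM
    exact_mod_cast (zero_lt_one.trans this)
  have hM0' : (0 : ℝ) < M := by exact_mod_cast hM0
  have hMe : (1 / M : ℝ) ^ 2 ≤ ε / 4 := by
    have h1 := (le_max_right _ _).trans_lt hM
    have hs := Real.sqrt_pos.2 hε
    have h2 : (1 / M : ℝ) ≤ Real.sqrt ε / 2 := by
      rw [div_le_div_iff₀ hM0' (by norm_num)]
      rw [div_lt_iff₀ hs] at h1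
      linarith
    calc (1 / M : ℝ) ^ 2 ≤ (Real.sqrt ε / 2) ^ 2 := by gcongr
      _ = ε / 4 := by rw [div_pow, Real.sq_sqrt hε.le]; norm_num
  have bfT : ∀ g, BM fun y => f (S.T g y) := fun g => bf.comp (S.meas g)
  set c : G → ι → X → ℝ := fun h j => ce m μ (fun y => f (S.T (a j) y) * f (S.T h y)) with hc
  have hc1 : ∀ h j x, |c h j x| ≤ 1 := fun h j x =>
    abs_ce_le (μ := μ) (m := m) (fun y => by
      rw [abs_mul]; exact mul_le_one₀ (hf1 _) (abs_nonneg _) (hf1 _)) x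
  refine ⟨ι → Finset.Icc (-(M : ℤ)) M, inferInstance,
    fun i x => ∑ j, l j * ((i j : ℤ) / M : ℝ) * f (S.T (a j) x), {x | ce m μ D x ≤ ε / 4},
    fun i => .sum fun j _ => (bfT _).const_mul _,
    measurableSet_le (measurable_ce bD.meas) measurable_const, ?_, ?_⟩
  · have : {x | ce m μ D x ≤ ε / 4}ᶜ = {x | ε / 4 < ce m μ D x} := by
      ext x; simp
    rw [this]
    refine ((bD.ce' hm.le).measureReal_gt_le (fun x => integral_nonneg hD0) (by positivity)).trans ?_
    rw [bD.integral_ce' hm.le, div_le_iff₀ (by positivity)]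
    exact hDint
  · have hA : ∀ᵐ x ∂μ, ∀ h ∈ H, ∀ᵐ y ∂(condExpKernel μ m x),
        fiberInt m μ (fun p => k p * f p.2) (S.T h y) =
          fiberInt m μ (fun p => k p * f (S.T h p.2)) y := by
      rw [ae_all_iff]; intro h
      by_cases hh : h ∈ H
      · filter_upwards [ae_ae_ker hm.le (fiberInt_comp (f := f) hm hinv hh)] with x hx _ using hx
      · exact ae_of_all _ fun x hx => absurd hx hh
    have hB : ∀ᵐ x ∂μ, ∀ h j, ∀ᵐ y ∂(condExpKernel μ m x), c h j y = c h j x := by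
      rw [ae_all_iff]; intro h
      rw [ae_all_iff]; intro j
      exact ker_const hm.le (measurable_ce ((bfT _).mul (bfT _)).meas) (hc1 h j)
    filter_upwards [hA, hB] with x hxA hxB hx h hh
    choose i hi using fun j => exists_round hM0 (hc1 h j x)
    refine ⟨i, ?_⟩
    set F := fiberInt m μ fun p => k p * f p.2
    have hkey : ∀ᵐ y ∂(condExpKernel μ m x),
        (F (S.T h y) - ∑ j, l j * ((i j : ℤ) / M : ℝ) * f (S.T (a j) y)) ^ 2 ≤
          2 * D y + 2 * (ε / 4) := by
      filter_upwards [hxA h hh, ae_all_iff.2 (hxB h)] with y hy1 hy2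
      have e1 : F (S.T h y) - ∑ j, l j * c h j x * f (S.T (a j) y) =
          ∫ y', q (y, y') * f (S.T h y') ∂(condExpKernel μ m y) := by
        rw [hy1]
        have : ∀ y', q (y, y') * f (S.T h y') = k (y, y') * f (S.T h y') -
            ∑ j, (l j * f (S.T (a j) y)) * (f (S.T (a j) y') * f (S.T h y')) := fun y' => by
          rw [hq]
          simp only [tens, sub_mul, Finset.sum_mul]
          congr 1
          exact Finset.sum_congr rfl fun j _ => by ring
        simp_rw [this]
        have bky : BM fun y' => k (y, y') := bk.comp measurable_prodMk_left
        rw [integral_sub ((bky.mul (bfT h)).integrable) (BM.integrable (.sum fun j _ =>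
          ((bfT _).mul (bfT h)).const_mul _)), integral_finsetSum _ fun j _ =>
          (((bfT _).mul (bfT h)).const_mul _).integrable]
        simp_rw [integral_const_mul]
        congr 1
        refine Finset.sum_congr rfl fun j _ => ?_
        rw [← hy2 j, hc]
        simp only [ce]
        ring
      have e2 : (F (S.T h y) - ∑ j, l j * c h j x * f (S.T (a j) y)) ^ 2 ≤ D y := by
        rw [e1]
        exact BM.sq_integral_mul_le (bq.comp measurable_prodMk_left) (bfT h) fun y' => hf1 _
      have e3 : |∑ j, l j * c h j x * f (S.T (a j) y) -
          ∑ j, l j * ((i j : ℤ) / M : ℝ) * f (S.T (a j) y)| ≤ 1 / M := by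
        rw [← Finset.sum_sub_distrib]
        refine (Finset.abs_sum_le_sum_abs _ _).trans ?_
        calc _ ≤ ∑ j, l j * (1 / M) := by
              refine Finset.sum_le_sum fun j _ => ?_
              rw [show l j * c h j x * f (S.T (a j) y) - l j * ((i j : ℤ) / M : ℝ) * f (S.T (a j) y)
                = l j * ((c h j x - (i j : ℤ) / M) * f (S.T (a j) y)) by ring, abs_mul,
                abs_of_nonneg (hl j), abs_mul]
              refine mul_le_mul_of_nonneg_left ?_ (hl j)
              exact (mul_le_of_le_one_right (abs_nonneg _) (hf1 _)).trans (hi j)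
          _ = 1 / M := by rw [← Finset.sum_mul, hl1, one_mul]
      have e4 : (∑ j, l j * c h j x * f (S.T (a j) y) -
          ∑ j, l j * ((i j : ℤ) / M : ℝ) * f (S.T (a j) y)) ^ 2 ≤ ε / 4 := by
        rw [← sq_abs]
        exact le_trans (by gcongr) hMe
      set A1 := F (S.T h y)
      set A2 := ∑ j, l j * c h j x * f (S.T (a j) y)
      set A3 := ∑ j, l j * ((i j : ℤ) / M : ℝ) * f (S.T (a j) y)
      nlinarith [sq_nonneg ((A1 - A2) - (A2 - A3))]
    have bR : BM fun y => 2 * D y + 2 * (ε / 4) := (bD.const_mul 2).add (.const _)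
    have bL : BM fun y => (F (S.T h y) - ∑ j, l j * ((i j : ℤ) / M : ℝ) * f (S.T (a j) y)) ^ 2 :=
      ((bF.comp (S.meas h)).sub (.sum fun j _ => (bfT _).const_mul _)).sq
    calc _ ≤ ∫ y, 2 * D y + 2 * (ε / 4) ∂(condExpKernel μ m x) :=
          integral_mono_ae bL.integrable bR.integrable hkey
      _ = 2 * ce m μ D x + 2 * (ε / 4) := by
          rw [integral_add (bD.const_mul 2).integrable (BM.const _).integrable,
            integral_const_mul]
          simp [ce]
      _ ≤ ε := by
          have hx' : ce m μ D x ≤ ε / 4 := hx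
          linarith

end Sys

end FiberOp

end PolyRec

namespace PolyRec

section ApAlg

set_option linter.overlappingInstances false

open MeasureTheory ProbabilityTheory Filter

variable {G : Type} [AddCommGroup G] {X : Type} {m : MeasurableSpace X}
  [mX : MeasurableSpace X] [StandardBorelSpace X] {μ : Measure X} [IsProbabilityMeasure μ]

namespace Sys

/-- The `L²`-closure of the relatively almost periodic functions. -/
structure ClAP (m : MeasurableSpace X) [mX : MeasurableSpace X] [StandardBorelSpace X]
    {μ : Measure X} [IsProbabilityMeasure μ] (S : Sys G μ) (H : AddSubgroup G)
    (f : X → ℝ) : Prop where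
  bm : BM f
  approx : ∀ ε > 0, ∃ F, S.AP m H F ∧ ∫ x, (f x - F x) ^ 2 ∂μ ≤ ε

variable {S : Sys G μ} {H : AddSubgroup G} {f f' : X → ℝ}

lemma AP.clAP {F : X → ℝ} (hF : S.AP m H F) : S.ClAP m H F :=
  ⟨hF.bm, fun ε hε => ⟨F, hF, by simpa using hε.le⟩⟩

lemma ClAP.of_approx (hf : BM f)
    (h : ∀ ε > 0, ∃ g, S.ClAP m H g ∧ ∫ x, (f x - g x) ^ 2 ∂μ ≤ ε) : S.ClAP m H f := by
  refine ⟨hf, fun ε hε => ?_⟩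
  obtain ⟨g, hg, hgε⟩ := h (ε / 4) (by positivity)
  obtain ⟨F, hF, hFε⟩ := hg.approx (ε / 4) (by positivity)
  refine ⟨F, hF, ?_⟩
  have b1 : BM fun x => (f x - g x) ^ 2 := (hf.sub hg.bm).sq
  have b2 : BM fun x => (g x - F x) ^ 2 := (hg.bm.sub hF.bm).sq
  calc _ ≤ ∫ x, 2 * ((f x - g x) ^ 2 + (g x - F x) ^ 2) ∂μ :=
        BM.integral_mono (hf.sub hF.bm).sq ((b1.add b2).const_mul 2) fun x => by
          nlinarith [sq_nonneg ((f x - g x) - (g x - F x))]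
    _ = 2 * (∫ x, (f x - g x) ^ 2 ∂μ + ∫ x, (g x - F x) ^ 2 ∂μ) := by
        rw [integral_const_mul, integral_add b1.integrable b2.integrable]
    _ ≤ ε := by linarith

lemma ClAP.of_tendsto (hf : BM f) {g : ℕ → X → ℝ} (hg : ∀ n, S.ClAP m H (g n))
    (hg1 : ∀ n x, |g n x| ≤ 1) (h : ∀ x, Tendsto (fun n => g n x) atTop (nhds (f x))) :
    S.ClAP m H f := by
  refine ClAP.of_approx hf fun ε hε => ?_
  obtain ⟨C, hC⟩ := hf.bdd
  have ht : Tendsto (fun n => ∫ x, (f x - g n x) ^ 2 ∂μ) atTop (nhds (∫ _, (0 : ℝ) ∂μ)) := by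
    refine tendsto_integral_of_dominated_convergence (fun _ => (C + 1) ^ 2)
      (fun n => (hf.sub (hg n).bm).sq.meas.aestronglyMeasurable) (integrable_const _)
      (fun n => ae_of_all _ fun x => ?_) (ae_of_all _ fun x => ?_)
    · rw [Real.norm_eq_abs, abs_of_nonneg (sq_nonneg _), ← sq_abs]
      have : |f x - g n x| ≤ C + 1 := (abs_sub _ _).trans (add_le_add (hC x) (hg1 n x))
      gcongr
    · have := ((tendsto_const_nhds (x := f x)).sub (h x)).pow 2
      simpa using this
  rw [integral_zero] at ht
  obtain ⟨n, hn⟩ := ((tendsto_order.1 ht).2 ε hε).exists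
  exact ⟨g n, hg n, hn.le⟩

lemma ClAP.comp₂ (hf : S.ClAP m H f) (hf' : S.ClAP m H f') {Φ : ℝ → ℝ → ℝ}
    (hΦm : BM fun x => Φ (f x) (f' x)) {L : ℝ} (hL : 0 < L)
    (hΦ : ∀ a b a' b', |Φ a b - Φ a' b'| ≤ L * (|a - a'| + |b - b'|)) :
    S.ClAP m H (fun x => Φ (f x) (f' x)) := by
  refine ⟨hΦm, fun ε hε => ?_⟩
  obtain ⟨F, hF, h1⟩ := hf.approx (ε / (4 * L ^ 2)) (by positivity)
  obtain ⟨F', hF', h2⟩ := hf'.approx (ε / (4 * L ^ 2)) (by positivity)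
  have hFF := hF.comp₂ hF' hL hΦ
  refine ⟨_, hFF, ?_⟩
  have b1 : BM fun x => (f x - F x) ^ 2 := (hf.bm.sub hF.bm).sq
  have b2 : BM fun x => (f' x - F' x) ^ 2 := (hf'.bm.sub hF'.bm).sq
  calc _ ≤ ∫ x, (2 * L ^ 2) * ((f x - F x) ^ 2 + (f' x - F' x) ^ 2) ∂μ := by
        refine BM.integral_mono (hΦm.sub hFF.bm).sq ((b1.add b2).const_mul _) fun y => ?_
        have h3 := hΦ (f y) (f' y) (F y) (F' y)
        rw [← sq_abs]
        set a := f y - F y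
        set b := f' y - F' y
        calc _ ≤ (L * (|a| + |b|)) ^ 2 := by gcongr
          _ ≤ _ := by
            rw [← sq_abs a, ← sq_abs b]
            nlinarith [mul_nonneg (sq_nonneg L) (sq_nonneg (|a| - |b|))]
    _ = 2 * L ^ 2 * (∫ x, (f x - F x) ^ 2 ∂μ + ∫ x, (f' x - F' x) ^ 2 ∂μ) := by
        rw [integral_const_mul, integral_add b1.integrable b2.integrable]
    _ ≤ 2 * L ^ 2 * (ε / (4 * L ^ 2) + ε / (4 * L ^ 2)) := by gcongr
    _ = ε := by field_simp; ring

lemma ClAP.add (hf : S.ClAP m H f) (hf' : S.ClAP m H f') : S.ClAP m H fun x => f x + f' x :=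
  hf.comp₂ hf' (Φ := fun a b => a + b) (hf.bm.add hf'.bm) one_pos fun a b a' b' => by
    rw [one_mul, show a + b - (a' + b') = (a - a') + (b - b') by ring]
    exact abs_add_le _ _

lemma ClAP.const_mul (hf : S.ClAP m H f) (c : ℝ) : S.ClAP m H fun x => c * f x :=
  hf.comp₂ hf (Φ := fun a _ => c * a) (hf.bm.const_mul c) (L := |c| + 1) (by positivity)
    fun a b a' b' => by
      rw [← mul_sub, abs_mul]
      nlinarith [abs_nonneg c, abs_nonneg (a - a'), abs_nonneg (b - b'),
        mul_nonneg (abs_nonneg c) (abs_nonneg (b - b'))]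

lemma ClAP.comp_T [Countable G] (hm : S.IsFactor m) (hf : S.ClAP m H f) (a : G) :
    S.ClAP m H fun x => f (S.T a x) := by
  refine ⟨hf.bm.comp (S.meas a), fun ε hε => ?_⟩
  obtain ⟨F, hF, h⟩ := hf.approx ε hε
  refine ⟨_, hF.comp_T hm a, ?_⟩
  rwa [S.integral_comp a fun x => (f x - F x) ^ 2]

omit mX [StandardBorelSpace X] in
lemma indicator_union_one (A B : Set X) : ((A ∪ B).indicator fun _ => (1 : ℝ)) =
    fun x => max (A.indicator (fun _ => 1) x) (B.indicator (fun _ => 1) x) := by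
  ext x
  by_cases h1 : x ∈ A <;> by_cases h2 : x ∈ B <;> simp [h1, h2]

omit mX [StandardBorelSpace X] in
lemma abs_indicator_one_le (A : Set X) (x : X) : |A.indicator (fun _ => (1 : ℝ)) x| ≤ 1 := by
  by_cases h : x ∈ A <;> simp [h]

/-- The σ-algebra of sets whose indicator is in the closure of the almost periodic functions. -/
def apAlg [Countable G] (S : Sys G μ) (hm : S.IsFactor m) (H : AddSubgroup G) :
    MeasurableSpace X where
  MeasurableSet' B := MeasurableSet B ∧ S.ClAP m H (B.indicator fun _ => (1 : ℝ))
  measurableSet_empty := ⟨MeasurableSet.empty,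
    (AP.indicator_of_measurable hm (@MeasurableSet.empty X m)).clAP⟩
  measurableSet_compl B hB := by
    refine ⟨hB.1.compl, ?_⟩
    have e : (Bᶜ.indicator fun _ => (1 : ℝ)) = fun x => 1 - B.indicator (fun _ => 1) x := by
      ext x; by_cases h : x ∈ B <;> simp [h]
    rw [e]
    refine hB.2.comp₂ hB.2 (Φ := fun a _ => 1 - a) ((BM.const 1).sub hB.2.bm) one_pos ?_
    intro a b a' b'
    rw [one_mul, show 1 - a - (1 - a') = a' - a by ring, abs_sub_comm]
    exact le_add_of_nonneg_right (abs_nonneg _)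
  measurableSet_iUnion s hs := by
    refine ⟨MeasurableSet.iUnion fun i => (hs i).1, ?_⟩
    have hfin : ∀ n : ℕ, S.ClAP m H ((⋃ i ∈ Finset.range n, s i).indicator fun _ => (1 : ℝ)) := by
      intro n
      induction n with
      | zero => simpa using (AP.indicator_of_measurable hm (@MeasurableSet.empty X m)).clAP
      | succ n ih =>
        have e : (⋃ i ∈ Finset.range (n + 1), s i) = (⋃ i ∈ Finset.range n, s i) ∪ s n := by
          rw [Finset.range_add_one, Finset.set_biUnion_insert, Set.union_comm]
        rw [e, indicator_union_one]
        refine ih.comp₂ (hs n).2 (Φ := max) ?_ one_pos ?_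
        · rw [← indicator_union_one]
          exact BM.indicator (((Finset.range n).measurableSet_biUnion fun i _ => (hs i).1).union
            (hs n).1)
        · intro a b a' b'
          rw [one_mul]
          exact (abs_max_sub_max_le_max _ _ _ _).trans
            (max_le_add_of_nonneg (abs_nonneg _) (abs_nonneg _))
    refine ClAP.of_tendsto (BM.indicator (MeasurableSet.iUnion fun i => (hs i).1)) hfin
      (fun n x => abs_indicator_one_le _ x) fun x => ?_
    refine tendsto_const_nhds.congr' ?_
    by_cases hx : x ∈ ⋃ i, s i
    · obtain ⟨i, hi⟩ := Set.mem_iUnion.1 hx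
      filter_upwards [eventually_gt_atTop i] with n hn
      rw [Set.indicator_of_mem hx, Set.indicator_of_mem]
      exact Set.mem_biUnion (Finset.mem_range.2 hn) hi
    · filter_upwards with n
      rw [Set.indicator_of_notMem hx, Set.indicator_of_notMem]
      simp only [Set.mem_iUnion, not_exists] at hx ⊢
      exact fun i _ => hx i

lemma measurable_of_Ioi_preimage {Y : Type} {z : MeasurableSpace Y} {f : Y → ℝ}
    (h : ∀ c, MeasurableSet[z] (f ⁻¹' Set.Ioi c)) : Measurable[z] f :=
  measurable_of_Ioi h

variable [Countable G] (hm : S.IsFactor m)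

lemma le_apAlg : m ≤ S.apAlg hm H := fun B hB =>
  ⟨hm.le B hB, (AP.indicator_of_measurable hm hB).clAP⟩

lemma isFactor_apAlg : S.IsFactor (S.apAlg hm H) where
  le _ hB := hB.1
  meas g _ hB := ⟨S.meas g hB.1, hB.2.comp_T hm g⟩

lemma ClAP.measurable_apAlg (hf : S.ClAP m H f) : Measurable[S.apAlg hm H] f := by
  refine measurable_of_Ioi_preimage fun c => ?_
  refine ⟨hf.bm.meas measurableSet_Ioi, ?_⟩
  have hb : ∀ n : ℕ, BM fun x => max 0 (min 1 (n * (f x - c))) := fun n =>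
    ⟨by have := hf.bm.meas; fun_prop, 1, fun x => by
      rw [abs_of_nonneg (le_max_left _ _)]
      exact max_le zero_le_one (min_le_left _ _)⟩
  refine ClAP.of_tendsto (BM.indicator (hf.bm.meas measurableSet_Ioi))
    (g := fun n x => max 0 (min 1 (n * (f x - c)))) (fun n => ?_) (fun n x => ?_) fun x => ?_
  · refine hf.comp₂ hf (Φ := fun a _ => max 0 (min 1 (n * (a - c)))) (hb n) (L := n + 1)
      (by positivity) fun a b a' b' => ?_
    have h1 : |max 0 (min 1 ((n : ℝ) * (a - c))) - max 0 (min 1 ((n : ℝ) * (a' - c)))| ≤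
        |(n : ℝ) * (a - c) - n * (a' - c)| := by
      refine (abs_max_sub_max_le_max _ _ _ _).trans ?_
      rw [sub_self, abs_zero, max_eq_right (abs_nonneg _)]
      refine (abs_min_sub_min_le_max _ _ _ _).trans ?_
      rw [sub_self, abs_zero, max_eq_right (abs_nonneg _)]
    refine h1.trans ?_
    rw [← mul_sub, sub_sub_sub_cancel_right, abs_mul, Nat.abs_cast]
    have hn : (0 : ℝ) ≤ n := Nat.cast_nonneg n
    nlinarith [abs_nonneg (a - a'), abs_nonneg (b - b'), mul_nonneg hn (abs_nonneg (b - b'))]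
  · rw [abs_of_nonneg (le_max_left _ _)]
    exact max_le zero_le_one (min_le_left _ _)
  · refine tendsto_const_nhds.congr' ?_
    by_cases hx : c < f x
    · obtain ⟨N, hN⟩ := exists_nat_gt (1 / (f x - c))
      filter_upwards [eventually_ge_atTop N] with n hn
      have h0 : 0 < f x - c := sub_pos.2 hx
      rw [Set.indicator_of_mem (show x ∈ f ⁻¹' Set.Ioi c from hx), min_eq_left, max_eq_right zero_le_one]
      rw [div_lt_iff₀ h0] at hN
      have : (N : ℝ) ≤ n := by exact_mod_cast hn
      nlinarith
    · filter_upwards with n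
      rw [Set.indicator_of_notMem (show x ∉ f ⁻¹' Set.Ioi c from hx), max_eq_left]
      refine (min_le_right _ _).trans ?_
      exact mul_nonpos_of_nonneg_of_nonpos (Nat.cast_nonneg n) (by linarith)

lemma ClAP.of_measurable_apAlg (hf : Measurable[S.apAlg hm H] f) (hf1 : ∀ x, |f x| ≤ 1) :
    S.ClAP m H f := by
  have bf : BM f := .of_le_one (hf.mono (isFactor_apAlg hm).le le_rfl) hf1
  refine ClAP.of_approx bf fun ε hε => ?_
  obtain ⟨M, hM⟩ := exists_nat_gt (max 1 (1 / ε))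
  have hM0 : (1 : ℝ) < M := (le_max_left _ _).trans_lt hM
  have hMe : (1 / M : ℝ) ^ 2 ≤ ε := by
    have h1 := (le_max_right _ _).trans_lt hM
    rw [div_lt_iff₀ hε] at h1
    rw [div_pow, one_pow, div_le_iff₀ (by positivity)]
    nlinarith
  have hsum : ∀ s : Finset ℤ, S.ClAP m H fun x =>
      ∑ i ∈ s, (i / M : ℝ) * ({y | ⌊f y * M⌋ = i}.indicator (fun _ => (1 : ℝ)) x) := by
    intro s
    induction s using Finset.induction_on with
    | empty => simpa using (AP.indicator_of_measurable hm (@MeasurableSet.empty X m)).clAP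
    | insert a s ha ih =>
      simp only [Finset.sum_insert ha]
      refine ClAP.add (ClAP.const_mul ?_ _) ih
      have h2 : Measurable[S.apAlg hm H] fun y => ⌊f y * M⌋ := by
        have h3 : Measurable fun t : ℝ => ⌊t * M⌋ := by fun_prop
        exact h3.comp hf
      exact (h2 (measurableSet_singleton a)).2
  refine ⟨_, hsum (Finset.Icc (-(M : ℤ)) M), ?_⟩
  have hpt : ∀ x, (f x - ∑ i ∈ Finset.Icc (-(M : ℤ)) M,
      (i / M : ℝ) * ({y | ⌊f y * M⌋ = i}.indicator (fun _ => (1 : ℝ)) x)) ^ 2 ≤ (1 / M) ^ 2 := by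
    intro x
    obtain ⟨h1, h2⟩ := abs_le.1 (hf1 x)
    have hmem : ⌊f x * M⌋ ∈ Finset.Icc (-(M : ℤ)) M := by
      rw [Finset.mem_Icc]
      constructor
      · rw [Int.le_floor]; push_cast; nlinarith
      · have : ((⌊f x * M⌋ : ℤ) : ℝ) ≤ M := (Int.floor_le _).trans (by nlinarith)
        exact_mod_cast this
    rw [Finset.sum_eq_single_of_mem _ hmem]
    · rw [Set.indicator_of_mem (by rfl), mul_one]
      have h3 := Int.floor_le (f x * M)
      have h4 := Int.lt_floor_add_one (f x * M)
      have e : f x - (⌊f x * M⌋ : ℤ) / M = (f x * M - ⌊f x * M⌋) / M := by field_simp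
      rw [e]
      have h5 : 0 ≤ f x * M - ⌊f x * M⌋ := by linarith
      have h6 : f x * M - ⌊f x * M⌋ ≤ 1 := by linarith
      gcongr
    · intro i _ hi
      rw [Set.indicator_of_notMem, mul_zero]
      exact fun h => hi h.symm
  calc _ ≤ ∫ _, (1 / M : ℝ) ^ 2 ∂μ :=
        BM.integral_mono (bf.sub (hsum _).bm).sq (.const _) hpt
    _ = (1 / M) ^ 2 := by simp
    _ ≤ ε := hMe

end Sys

end ApAlg

end PolyRec

namespace PolyRec

section Hull

set_option linter.overlappingInstances false

open MeasureTheory ProbabilityTheory Filter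

lemma sq_sum_le_card_mul_sum_same {ι κ : Type} [Fintype ι] [Fintype κ] [DecidableEq κ]
    (l : ι → ℝ) (col : ι → κ) :
    (∑ j, l j) ^ 2 ≤
      Fintype.card κ * ∑ j, ∑ j', if col j = col j' then l j * l j' else 0 := by
  have h1 : ∑ j, l j = ∑ i : κ, ∑ j, if col j = i then l j else 0 := by
    rw [Finset.sum_comm]
    simp
  have h2 : ∑ i : κ, (∑ j, if col j = i then l j else 0) ^ 2 =
      ∑ j, ∑ j', if col j = col j' then l j * l j' else 0 := by
    simp_rw [sq, Finset.sum_mul_sum]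
    rw [Finset.sum_comm]
    refine Finset.sum_congr rfl fun j _ => ?_
    rw [Finset.sum_comm]
    refine Finset.sum_congr rfl fun j' _ => ?_
    simp [eq_comm]
  rw [h1, ← h2]
  exact sq_sum_le_card_mul_sum_sq

variable {G : Type} [AddCommGroup G] {X : Type} {m : MeasurableSpace X}
  [mX : MeasurableSpace X] [StandardBorelSpace X] {μ : Measure X} [IsProbabilityMeasure μ]

omit [StandardBorelSpace X] in
lemma sub_le_measureReal {φ : X → ℝ} (hφ : BM φ) (h1 : ∀ x, |φ x| ≤ 1) {q : ℝ} :
    ∫ x, φ x ^ 2 ∂μ - q ^ 2 ≤ μ.real {x | q ≤ |φ x|} := by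
  have hP : MeasurableSet {x | q ≤ |φ x|} := measurableSet_le measurable_const hφ.meas.abs
  rw [← integral_indicator_one hP, sub_le_iff_le_add]
  have b1 : BM fun x => {x | q ≤ |φ x|}.indicator (fun _ => (1 : ℝ)) x + q ^ 2 :=
    (BM.indicator hP).add (BM.const _)
  refine (BM.integral_mono hφ.sq b1 fun x => ?_).trans_eq ?_
  · by_cases hx : x ∈ {x | q ≤ |φ x|}
    · rw [Set.indicator_of_mem hx]
      have := (sq_le_one_iff_abs_le_one _).2 (h1 x)
      nlinarith [sq_nonneg q]
    · rw [Set.indicator_of_notMem hx, ← sq_abs, zero_add]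
      have : |φ x| < q := not_le.1 hx
      gcongr
  · rw [integral_add (BM.indicator hP).integrable (BM.const _).integrable]
    simp
    rfl

namespace Sys

variable {S : Sys G μ} {H : AddSubgroup G} {f : X → ℝ}

lemma sq_ce_mul_ge {g₁ g₂ k u F₁ F₂ : X → ℝ} {q : ℝ} (h1 : BM g₁) (h2 : BM g₂) (hk : BM k) (hF1 : BM F₁)
    (hF2 : BM F₂) (hu : BM u) (hu1 : ∀ x, |u x| ≤ 1) {x : X} (hq : 0 ≤ q)
    (hx : q ≤ |ce m μ (fun y => g₁ y * u y) x|)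
    (a1 : ce m μ (fun y => (g₁ y - F₁ y) ^ 2) x ≤ q ^ 2 / 64)
    (a2 : ce m μ (fun y => (g₂ y - F₂ y) ^ 2) x ≤ q ^ 2 / 64)
    (a3 : ce m μ (fun y => (F₁ y - k y) ^ 2) x ≤ q ^ 2 / 64)
    (a4 : ce m μ (fun y => (F₂ y - k y) ^ 2) x ≤ q ^ 2 / 64) :
    q ^ 2 / 4 ≤ (ce m μ (fun y => g₂ y * u y) x) ^ 2 := by
  have b1 : BM fun y => (g₁ y - F₁ y) ^ 2 := (h1.sub hF1).sq
  have b2 : BM fun y => (g₂ y - F₂ y) ^ 2 := (h2.sub hF2).sq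
  have b3 : BM fun y => (F₁ y - k y) ^ 2 := (hF1.sub hk).sq
  have b4 : BM fun y => (F₂ y - k y) ^ 2 := (hF2.sub hk).sq
  have h12 : ce m μ (fun y => (g₁ y - g₂ y) ^ 2) x ≤ q ^ 2 / 4 := by
    have := BM.ce_mono (μ := μ) (m := m) (h1.sub h2).sq
      (((b1.add b2).add (b3.add b4)).const_mul 4) (fun y => by
        show (g₁ y - g₂ y) ^ 2 ≤ _
        nlinarith [sq_nonneg ((g₁ y - F₁ y) + (g₂ y - F₂ y)),
          sq_nonneg ((F₁ y - k y) + (F₂ y - k y)),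
          sq_nonneg ((g₁ y - F₁ y) - (g₂ y - F₂ y) - ((F₁ y - k y) - (F₂ y - k y)))]) x
    refine this.trans ?_
    rw [ce_const_mul, BM.ce_add (b1.add b2) (b3.add b4), BM.ce_add b1 b2, BM.ce_add b3 b4]
    linarith
  have h3 : (ce m μ (fun y => (g₁ y - g₂ y) * u y) x) ^ 2 ≤ (q / 2) ^ 2 := by
    refine ((h1.sub h2).sq_integral_mul_le hu hu1).trans (h12.trans_eq ?_)
    ring
  have h4 := abs_le_of_sq_le_sq h3 (by positivity)
  have h5 : ce m μ (fun y => (g₁ y - g₂ y) * u y) x =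
      ce m μ (fun y => g₁ y * u y) x - ce m μ (fun y => g₂ y * u y) x := by
    simp only [sub_mul]
    exact BM.ce_sub (h1.mul hu) (h2.mul hu) x
  rw [h5] at h4
  have h6 : q / 2 ≤ |ce m μ (fun y => g₂ y * u y) x| := by
    have h7 := abs_sub_abs_le_abs_sub (ce m μ (fun y => g₁ y * u y) x)
      (ce m μ (fun y => g₂ y * u y) x)
    linarith
  rw [← sq_abs (ce m μ (fun y => g₂ y * u y) x)]
  calc q ^ 2 / 4 = (q / 2) ^ 2 := by ring
    _ ≤ _ := by gcongr

/-- Functions in the closure of the almost periodic ones have no small averages along `H`. -/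
lemma ClAP.exists_le_sum [Countable G] (hm : S.IsFactor m) (hf : S.ClAP m H f)
    (hf1 : ∀ x, |f x| ≤ 1) {c : ℝ} (hc : 0 < c) :
    ∃ c' > 0, ∀ u : X → ℝ, Measurable u → (∀ x, |u x| ≤ 1) →
      c ≤ ∫ x, (ce m μ (fun y => f y * u y) x) ^ 2 ∂μ →
      ∀ (ι : Type) [Fintype ι] (l : ι → ℝ) (h : ι → G), (∀ j, 0 ≤ l j) → ∑ j, l j = 1 →
      (∀ j, h j ∈ H) → c' ≤ ∑ j, ∑ j', l j * l j' *
        ∫ x, (ce m μ (fun y => f (S.T (h j') y) * u (S.T (h j) y)) x) ^ 2 ∂μ := by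
  classical
  set q : ℝ := Real.sqrt c / 2 with hq
  have hq2 : q ^ 2 = c / 4 := by rw [hq, div_pow, Real.sq_sqrt hc.le]; norm_num
  have hq0 : 0 < q := by have := Real.sqrt_pos.2 hc; positivity
  obtain ⟨F, hF, hfF⟩ := hf.approx (q ^ 2 / 64 * (c / 8)) (by positivity)
  obtain ⟨κ, _, g, B, hg, hB, hBδ, hgB⟩ := hF.approx (q ^ 2 / 64) (by positivity) (c / 8)
    (by positivity)
  have := Fintype.ofFinite κ
  set R : ℝ := Fintype.card κ + 1 with hR
  have hR0 : 0 < R := by positivity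
  refine ⟨c / 16 / R * (c / 2) ^ 2, by positivity, fun u hu hu1 hcu ι _ l h hl hl1 hh => ?_⟩
  have bu : BM u := .of_le_one hu hu1
  have bφ : ∀ j j', BM fun y => f (S.T (h j') y) * u (S.T (h j) y) := fun j j' =>
    (hf.bm.comp (S.meas _)).mul (bu.comp (S.meas _))
  have bce : ∀ j j', BM (ce m μ fun y => f (S.T (h j') y) * u (S.T (h j) y)) := fun j j' =>
    (bφ j j').ce' hm.le
  have hce1 : ∀ j j' x, |ce m μ (fun y => f (S.T (h j') y) * u (S.T (h j) y)) x| ≤ 1 :=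
    fun j j' x => abs_ce_le (fun y => by
      rw [abs_mul]; exact mul_le_one₀ (hf1 _) (abs_nonneg _) (hu1 _)) x
  have bD : ∀ j, BM fun y => (f (S.T (h j) y) - F (S.T (h j) y)) ^ 2 := fun j =>
    ((hf.bm.comp (S.meas _)).sub (hF.bm.comp (S.meas _))).sq
  let P : ι → Set X := fun j =>
    {x | q ≤ |ce m μ (fun y => f (S.T (h j) y) * u (S.T (h j) y)) x|}
  let Z : ι → Set X := fun j =>
    {x | q ^ 2 / 64 < ce m μ (fun y => (f (S.T (h j) y) - F (S.T (h j) y)) ^ 2) x}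
  have hP : ∀ j, MeasurableSet (P j) := fun j =>
    measurableSet_le measurable_const (bce j j).meas.abs
  have hZ : ∀ j, MeasurableSet (Z j) := fun j =>
    measurableSet_lt measurable_const ((bD j).ce' hm.le).meas
  have hB' : MeasurableSet B := hm.le _ hB
  let E : ι → Set X := fun j => (P j ∩ B) \ Z j
  have hE : ∀ j, MeasurableSet (E j) := fun j => ((hP j).inter hB').diff (hZ j)
  have hμE : ∀ j, c / 2 ≤ μ.real (E j) := by
    intro j
    have h1 : c - q ^ 2 ≤ μ.real (P j) := by
      refine le_trans ?_ (sub_le_measureReal (bce j j) (hce1 j j))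
      gcongr
      refine hcu.trans_eq ?_
      have b0 : BM fun y => f y * u y := hf.bm.mul bu
      obtain ⟨C, hC⟩ := b0.bdd
      rw [← S.integral_comp (h j) fun x => (ce m μ (fun y => f y * u y) x) ^ 2]
      refine integral_congr_ae ?_
      filter_upwards [S.ce_comp hm b0.meas hC (h j)] with x hx
      rw [hx]
    have h2 : μ.real (Z j) ≤ c / 8 := by
      have h3 := BM.measureReal_gt_le (μ := μ) ((bD j).ce' (μ := μ) hm.le)
        (fun x => integral_nonneg fun _ => sq_nonneg _) (t := q ^ 2 / 64) (by positivity)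
      refine h3.trans ?_
      rw [(bD j).integral_ce' hm.le, S.integral_comp (h j) fun x => (f x - F x) ^ 2,
        div_le_iff₀ (by positivity)]
      linarith
    have h4 : μ.real (P j) ≤ μ.real (E j) + (μ.real (Z j) + μ.real Bᶜ) := by
      have h5 : P j ⊆ E j ∪ (Z j ∪ Bᶜ) := fun x hx => by
        by_cases h6 : x ∈ B <;> by_cases h7 : x ∈ Z j <;> simp [E, h6, h7, hx]
      refine (measureReal_mono h5).trans ((measureReal_union_le _ _).trans ?_)
      gcongr
      exact measureReal_union_le _ _
    rw [hq2] at h1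
    linarith
  have bI : BM fun x => ∑ j, l j * (E j).indicator (fun _ => (1 : ℝ)) x :=
    BM.sum fun j _ => (BM.indicator (hE j)).const_mul _
  have hI : c / 2 ≤ ∫ x, ∑ j, l j * (E j).indicator (fun _ => (1 : ℝ)) x ∂μ := by
    rw [integral_finsetSum _ fun j _ => ((BM.indicator (hE j)).const_mul _).integrable]
    calc c / 2 = ∑ j, l j * (c / 2) := by rw [← Finset.sum_mul, hl1, one_mul]
      _ ≤ _ := Finset.sum_le_sum fun j _ => by
        rw [integral_const_mul]
        refine mul_le_mul_of_nonneg_left ((hμE j).trans_eq ?_) (hl j)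
        exact (integral_indicator_one (hE j)).symm
  have bs : ∀ j j', BM fun x => l j * l j' *
      (ce m μ (fun y => f (S.T (h j') y) * u (S.T (h j) y)) x) ^ 2 := fun j j' =>
    (bce j j').sq.const_mul _
  have bS : BM fun x => ∑ j, ∑ j', l j * l j' *
      (ce m μ (fun y => f (S.T (h j') y) * u (S.T (h j) y)) x) ^ 2 :=
    BM.sum fun j _ => BM.sum fun j' _ => bs j j'
  calc c / 16 / R * (c / 2) ^ 2
      ≤ c / 16 / R * (∫ x, ∑ j, l j * (E j).indicator (fun _ => (1 : ℝ)) x ∂μ) ^ 2 := by gcongr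
    _ ≤ c / 16 / R * ∫ x, (∑ j, l j * (E j).indicator (fun _ => (1 : ℝ)) x) ^ 2 ∂μ := by
        gcongr
        exact bI.sq_integral_le
    _ = ∫ x, c / 16 / R * (∑ j, l j * (E j).indicator (fun _ => (1 : ℝ)) x) ^ 2 ∂μ :=
        (integral_const_mul _ _).symm
    _ ≤ ∫ x, ∑ j, ∑ j', l j * l j' *
          (ce m μ (fun y => f (S.T (h j') y) * u (S.T (h j) y)) x) ^ 2 ∂μ := by
        refine integral_mono_ae (bI.sq.const_mul _).integrable bS.integrable ?_
        filter_upwards [hgB] with x hx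
        have hnn : ∀ j j', 0 ≤ l j * l j' *
            (ce m μ (fun y => f (S.T (h j') y) * u (S.T (h j) y)) x) ^ 2 := fun j j' =>
          mul_nonneg (mul_nonneg (hl j) (hl j')) (sq_nonneg _)
        by_cases hxB : x ∈ B
        · choose col hcol using fun j => hx hxB (h j) (hh j)
          have h1 := sq_sum_le_card_mul_sum_same
            (fun j => l j * (E j).indicator (fun _ => (1 : ℝ)) x) col
          have hind : ∀ j, 0 ≤ (E j).indicator (fun _ => (1 : ℝ)) x := fun j =>
            Set.indicator_nonneg (fun _ _ => zero_le_one) _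
          set s : ℝ := ∑ j, ∑ j', if col j = col j' then
            l j * (E j).indicator (fun _ => (1 : ℝ)) x *
              (l j' * (E j').indicator (fun _ => (1 : ℝ)) x) else 0 with hs
          have hs0 : 0 ≤ s := Finset.sum_nonneg fun j _ => Finset.sum_nonneg fun j' _ => by
            split_ifs
            · exact mul_nonneg (mul_nonneg (hl j) (hind j)) (mul_nonneg (hl j') (hind j'))
            · exact le_rfl
          have h2 : (∑ j, l j * (E j).indicator (fun _ => (1 : ℝ)) x) ^ 2 ≤ R * s := by
            refine h1.trans ?_
            gcongr
            rw [hR]; linarith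
          calc _ ≤ c / 16 / R * (R * s) := by gcongr
            _ = c / 16 * s := by field_simp
            _ ≤ _ := by
              rw [hs, Finset.mul_sum]
              refine Finset.sum_le_sum fun j _ => ?_
              rw [Finset.mul_sum]
              refine Finset.sum_le_sum fun j' _ => ?_
              by_cases hjj : col j = col j'
              · rw [if_pos hjj]
                by_cases hj : x ∈ E j
                · by_cases hj' : x ∈ E j'
                  · rw [Set.indicator_of_mem hj, Set.indicator_of_mem hj', mul_one, mul_one,
                      mul_comm]
                    refine mul_le_mul_of_nonneg_left ?_ (mul_nonneg (hl j) (hl j'))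
                    have h3 := sq_ce_mul_ge (m := m) (μ := μ)
                      (hf.bm.comp (S.meas (h j)))
                      (hf.bm.comp (S.meas (h j'))) (hg (col j)) (hF.bm.comp (S.meas (h j)))
                      (hF.bm.comp (S.meas (h j'))) (bu.comp (S.meas (h j))) (fun _ => hu1 _)
                      hq0.le hj.1.1 (not_lt.1 hj.2) (not_lt.1 hj'.2) (hcol j)
                      (hjj ▸ hcol j')
                    rw [hq2] at h3
                    linarith
                  · rw [Set.indicator_of_notMem hj']
                    simpa using hnn j j'
                · rw [Set.indicator_of_notMem hj]
                  simpa using hnn j j'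
              · rw [if_neg hjj, mul_zero]
                exact hnn j j'
        · have h0 : ∀ j, (E j).indicator (fun _ => (1 : ℝ)) x = 0 := fun j =>
            Set.indicator_of_notMem (fun hx => hxB hx.1.2) _
          simp only [h0, mul_zero, Finset.sum_const_zero]
          simpa using Finset.sum_nonneg fun j _ => Finset.sum_nonneg fun j' _ => hnn j j'
    _ = _ := by
        rw [integral_finsetSum _ fun j _ => (BM.sum fun j' _ => bs j j').integrable]
        refine Finset.sum_congr rfl fun j _ => ?_
        rw [integral_finsetSum _ fun j' _ => (bs j j').integrable]
        exact Finset.sum_congr rfl fun j' _ => integral_const_mul _ _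

end Sys

end Hull

end PolyRec

namespace PolyRec

lemma exists_complement {G : Type} [AddCommGroup G] [Module.Finite ℤ G] (H : AddSubgroup G)
    (hH : ∀ (k : ℕ) (g : G), 1 ≤ k → k • g ∈ H → g ∈ H) :
    ∃ p : G →+ G, (∀ g, g - p g ∈ H) ∧ ∀ g ∈ H, p g = 0 := by
  have htf : IsAddTorsionFree (G ⧸ H.toIntSubmodule) := by
    refine ⟨fun n hn a b hab => ?_⟩
    induction a using Submodule.Quotient.induction_on with | _ a
    induction b using Submodule.Quotient.induction_on with | _ b
    refine (Submodule.Quotient.eq _).2 ?_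
    refine hH n (a - b) (Nat.one_le_iff_ne_zero.2 hn) ?_
    have h1 : n • a - n • b ∈ H.toIntSubmodule := (Submodule.Quotient.eq _).1 hab
    rw [nsmul_sub]
    exact h1
  obtain ⟨s, hs⟩ := Module.projective_lifting_property H.toIntSubmodule.mkQ
    (LinearMap.id : (G ⧸ H.toIntSubmodule) →ₗ[ℤ] _) (Submodule.mkQ_surjective _)
  refine ⟨(s ∘ₗ H.toIntSubmodule.mkQ).toAddMonoidHom, fun g => ?_, fun g hg => ?_⟩
  · have h1 : H.toIntSubmodule.mkQ (s (H.toIntSubmodule.mkQ g)) = H.toIntSubmodule.mkQ g :=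
      DFunLike.congr_fun hs _
    exact (Submodule.Quotient.eq _).1 h1.symm
  · have h1 : H.toIntSubmodule.mkQ g = 0 := (Submodule.Quotient.mk_eq_zero _).2 hg
    show s (H.toIntSubmodule.mkQ g) = 0
    rw [h1, map_zero]

section Structure

set_option linter.overlappingInstances false

open MeasureTheory ProbabilityTheory Filter

variable {G : Type} [AddCommGroup G] {X : Type} {m : MeasurableSpace X}
  [mX : MeasurableSpace X] [StandardBorelSpace X] {μ : Measure X} [IsProbabilityMeasure μ]

omit [StandardBorelSpace X] [IsProbabilityMeasure μ] in
lemma tendsto_average_of_sq_le {a b : ℕ → ℝ} (ha : ∀ n, 0 ≤ a n) (hab : ∀ n, a n ^ 2 ≤ b n)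
    (hb : Tendsto (fun N : ℕ => (∑ n ∈ Finset.range N, b n) / N) atTop (nhds 0)) :
    Tendsto (fun N : ℕ => (∑ n ∈ Finset.range N, a n) / N) atTop (nhds 0) := by
  have hs := hb.sqrt
  rw [Real.sqrt_zero] at hs
  refine squeeze_zero (fun N => ?_) (fun N => Real.le_sqrt_of_sq_le ?_) hs
  · exact div_nonneg (Finset.sum_nonneg fun n _ => ha n) (Nat.cast_nonneg _)
  · rcases Nat.eq_zero_or_pos N with rfl | hN
    · simp
    have hN' : (0 : ℝ) < N := by exact_mod_cast hN
    have h1 : (∑ n ∈ Finset.range N, a n) ^ 2 ≤ N * ∑ n ∈ Finset.range N, b n := by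
      refine (sq_sum_le_card_mul_sum_sq).trans ?_
      rw [Finset.card_range]
      gcongr with n _
      exact hab n
    rw [div_pow, div_le_div_iff₀ (by positivity) hN']
    nlinarith

namespace Sys

variable {S : Sys G μ} {f : X → ℝ}

lemma integral_ce_sq_pos (hm : m ≤ mX) (hf : Measurable f) (hf1 : ∀ x, |f x| ≤ 1)
    (h0 : ¬ f =ᵐ[μ] 0) : 0 < ∫ x, (ce m μ (fun y => f y * f y) x) ^ 2 ∂μ := by
  have bf : BM fun y => f y * f y := (BM.of_le_one hf hf1).mul (BM.of_le_one hf hf1)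
  have h1 : 0 < ∫ x, f x * f x ∂μ := by
    refine lt_of_le_of_ne (integral_nonneg fun x => mul_self_nonneg _) fun h => h0 ?_
    have := (integral_eq_zero_iff_of_nonneg (fun x => mul_self_nonneg (f x)) bf.integrable).1 h.symm
    filter_upwards [this] with x hx
    exact mul_self_eq_zero.1 hx
  rw [← bf.integral_ce' hm] at h1
  have := (bf.ce' (μ := μ) hm).sq_integral_le (μ := μ)
  nlinarith

lemma not_zeroMem_bot (hm : S.IsFactor m) (hf : Measurable f) (hf1 : ∀ x, |f x| ≤ 1)
    (h0 : ¬ f =ᵐ[μ] 0) : ¬ S.ZeroMem m ⊥ f := by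
  intro h
  have hA := integral_ce_sq_pos (μ := μ) (m := m) hm.le hf hf1 h0
  set A := ∫ x, (ce m μ (fun y => f y * f y) x) ^ 2 ∂μ
  obtain ⟨ι, _, l, h, hl, hl1, hh, hle⟩ := h (A / 2) (by positivity)
  have hh' : ∀ j, h j = 0 := fun j => AddSubgroup.mem_bot.1 (hh j)
  simp only [hh', S.zero] at hle
  simp_rw [← Finset.sum_mul, ← Finset.mul_sum, hl1, mul_one, hl1, one_mul] at hle
  linarith

/-- The extension `z` of `m` is relatively compact along `H` and relatively weakly mixing along
the range of `p`, a complement of `H`. -/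
structure IsPrimitive (m z : MeasurableSpace X) [mX : MeasurableSpace X] [StandardBorelSpace X]
    {μ : Measure X} [IsProbabilityMeasure μ] (S : Sys G μ) (H : AddSubgroup G) (p : G →+ G) :
    Prop where
  factor : S.IsFactor z
  le : m ≤ z
  not_le : ¬ z ≤ m
  clAP : ∀ u, Measurable[z] u → (∀ x, |u x| ≤ 1) → S.ClAP m H u
  sub_mem : ∀ g, g - p g ∈ H
  map_eq_zero : ∀ g ∈ H, p g = 0
  mixing : S.RelMixing m z p.range

/-- Furstenberg–Katznelson: a factor over which there are non-trivial functions has a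
non-trivial extension which is relatively compact along a subgroup and relatively weakly mixing
along a complement. -/
theorem exists_extension [Countable G] [Module.Finite ℤ G] (hm : S.IsFactor m)
    (hf : Measurable f) (hf1 : ∀ x, |f x| ≤ 1) (hce : ce m μ f =ᵐ[μ] 0) (h0 : ¬ f =ᵐ[μ] 0) :
    ∃ (H : AddSubgroup G) (z : MeasurableSpace X) (p : G →+ G),
      IsPrimitive m z (mX := mX) S H p := by
  let NT : Set (AddSubgroup G) := {H | ∃ f : X → ℝ, Measurable f ∧ (∀ x, |f x| ≤ 1) ∧
    ce m μ f =ᵐ[μ] 0 ∧ ¬ S.ZeroMem m H f}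
  have hwf : WellFoundedGT (AddSubgroup G) :=
    (AddSubgroup.toIntSubmodule (M := G)).strictMono.wellFoundedGT
  obtain ⟨H, ⟨f, hf, hf1, hce, hH⟩, hmax⟩ := hwf.wf.has_min NT
    ⟨⊥, f, hf, hf1, hce, not_zeroMem_bot hm hf hf1 h0⟩
  replace hmax : ∀ H', H < H' → ∀ f : X → ℝ, Measurable f → (∀ x, |f x| ≤ 1) →
      ce m μ f =ᵐ[μ] 0 → S.ZeroMem m H' f := by
    intro H' hH' f hf hf1 hce
    by_contra h
    exact hmax H' ⟨f, hf, hf1, hce, h⟩ hH'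
  obtain ⟨k, hk, hk1, hinv, hpos, happ⟩ := S.exists_kernel hm hf hf1 hH
  set F := fiberInt m μ fun q => k q * f q.2 with hFdef
  have hF : S.AP m H F := AP.of_kernel hm hk hk1 hinv hf hf1 fun ε hε => by
    obtain ⟨ι, i, l, h, h1, h2, h3⟩ := happ ε hε
    exact ⟨ι, i, l, h, h1, h2, h3⟩
  have hF1 : ∀ x, |F x| ≤ 1 := fun x => by
    have := norm_integral_le_of_norm_le_const (μ := condExpKernel μ m x)
      (f := fun y => k (x, y) * f y) (C := 1) (ae_of_all _ fun y => by
        rw [Real.norm_eq_abs, abs_mul]; exact mul_le_one₀ (hk1 _) (abs_nonneg _) (hf1 _))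
    simpa [hFdef, fiberInt] using this
  have bf : BM f := .of_le_one hf hf1
  have hFf : 0 < ∫ x, F x * f x ∂μ := by
    refine hpos.trans_eq ?_
    have bk : BM fun q => k q * S.tens f 0 q :=
      (BM.of_le_one hk hk1).mul (.of_le_one (S.measurable_tens hf 0) (S.abs_tens_le hf1 0))
    obtain ⟨C, hC⟩ := bk.bdd
    rw [integral_relSq hm.le bk.meas hC]
    refine integral_congr_ae (ae_of_all _ fun x => ?_)
    simp only [tens, S.zero, hFdef, fiberInt]
    rw [← integral_mul_const]
    congr 1
    ext y
    ring
  have hzF : S.IsFactor (S.apAlg hm H) := isFactor_apAlg hm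
  have hmz : m ≤ S.apAlg hm H := le_apAlg hm
  have hFz : Measurable[S.apAlg hm H] F := hF.clAP.measurable_apAlg hm
  have hcl : ∀ u, Measurable[S.apAlg hm H] u → (∀ x, |u x| ≤ 1) → S.ClAP m H u := fun u hu hu1 =>
    ClAP.of_measurable_apAlg hm hu hu1
  have horth : ∀ u, Measurable[m] u → (∀ x, |u x| ≤ 1) → ∫ x, u x * f x ∂μ = 0 := by
    intro u hu hu1
    rw [← integral_mul_ce hm.le hf hf1 hu hu1]
    refine integral_eq_zero_of_ae ?_
    filter_upwards [hce] with x hx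
    simp [hx]
  have htend : ∀ u, Measurable[S.apAlg hm H] u → (∀ x, |u x| ≤ 1) → ce m μ u =ᵐ[μ] 0 → ∀ g ∉ H,
      Tendsto (fun N : ℕ => (∑ n ∈ Finset.range N,
        ∫ x, (ce m μ (fun y => u y * u (S.T (n • g) y)) x) ^ 2 ∂μ) / N) atTop (nhds 0) := by
    intro u hu hu1 hcu g hg
    have hu' : Measurable u := hu.mono hzF.le le_rfl
    have hlt : H < H ⊔ AddSubgroup.zmultiples g := by
      refine lt_of_le_of_ne le_sup_left fun h => hg ?_
      rw [h]
      exact AddSubgroup.mem_sup_right (AddSubgroup.mem_zmultiples g)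
    exact ZeroMem.tendsto hm hu' hu1 (hmax _ hlt u hu' hu1 hcu) fun c hc =>
      (hcl u hu hu1).exists_le_sum hm hu1 hc
  have htor : ∀ (j : ℕ) (g : G), 1 ≤ j → j • g ∈ H → g ∈ H := by
    intro j g hj hjg
    by_contra hg
    have hcF : Measurable[m] (ce m μ F) := measurable_ce hF.bm.meas
    have hcF1 : ∀ x, |ce m μ F x| ≤ 1 := abs_ce_le hF1
    let u : X → ℝ := fun x => 1 / 2 * (F x - ce m μ F x)
    have hu : Measurable[S.apAlg hm H] u :=
      (Measurable.sub hFz (hcF.mono hmz le_rfl)).const_mul _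
    have hu' : Measurable u := hu.mono hzF.le le_rfl
    have hu1 : ∀ x, |u x| ≤ 1 := fun x => by
      have h1 := abs_sub (F x) (ce m μ F x)
      have h2 := hF1 x
      have h3 := hcF1 x
      simp only [u]
      rw [abs_mul, abs_of_pos (by norm_num : (0 : ℝ) < 1 / 2)]
      linarith
    have bc : BM (ce m μ F) := hF.bm.ce' hm.le
    have hcu : ce m μ u =ᵐ[μ] 0 := by
      filter_upwards [ce_of_measurable hm.le hcF hcF1] with x hx
      simp only [u]
      rw [ce_const_mul, BM.ce_sub hF.bm bc, hx, sub_self, mul_zero]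
      rfl
    have huf : 0 < ∫ x, u x * f x ∂μ := by
      have e : ∫ x, u x * f x ∂μ = 1 / 2 * (∫ x, F x * f x ∂μ - ∫ x, ce m μ F x * f x ∂μ) := by
        rw [← integral_sub (hF.bm.mul bf).integrable (bc.mul bf).integrable, ← integral_const_mul]
        refine integral_congr_ae (ae_of_all _ fun x => ?_)
        simp only [u]
        ring
      rw [e, horth _ hcF hcF1]
      linarith
    have hu0 : ¬ u =ᵐ[μ] 0 := fun h => by
      refine huf.ne' (integral_eq_zero_of_ae ?_)
      filter_upwards [h] with x hx
      simp [hx]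
    obtain ⟨c', hc', hPH⟩ := (hcl u hu hu1).exists_le_sum hm hu1
      (integral_ce_sq_pos (μ := μ) (m := m) hm.le hu' hu1 hu0)
    exact false_of_tendsto hm hu' hu1 hj hjg (htend u hu hu1 hcu g hg) hc'
      (hPH u hu' hu1 le_rfl)
  obtain ⟨p, hp1, hp2⟩ := exists_complement H htor
  refine ⟨H, S.apAlg hm H, p, hzF, hmz, fun hzm => ?_, hcl, hp1, hp2, ?_⟩
  · exact hFf.ne' (horth F (hFz.mono hzm le_rfl) hF1)
  · intro u hu hu1 hcu g hg hg0
    have hgH : g ∉ H := by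
      obtain ⟨a, rfl⟩ := hg
      intro h
      refine hg0 ?_
      have h1 : p a - p (p a) = 0 := by rw [← map_sub]; exact hp2 _ (hp1 a)
      rw [hp2 _ h, sub_zero] at h1
      exact h1
    have hu' : Measurable u := hu.mono hzF.le le_rfl
    refine tendsto_average_of_sq_le (fun n => integral_nonneg fun _ => abs_nonneg _) (fun n => ?_)
      (htend u hu hu1 hcu g hgH)
    have bu : BM u := .of_le_one hu' hu1
    have b1 : BM (ce m μ fun x => u x * u (S.T (n • g) x)) :=
      (bu.mul (bu.comp (S.meas _))).ce' hm.le
    refine b1.abs.sq_integral_le.trans_eq ?_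
    simp only [sq_abs]

end Sys

end Structure

end PolyRec

namespace PolyRec

section Syndetic

/-- Sets of natural numbers with bounded gaps. -/
def Synd (A : Set ℕ) : Prop := ∃ L, ∀ m, ∃ n ∈ A, m < n ∧ n ≤ m + L

lemma Synd.mono {A B : Set ℕ} (hA : Synd A) (h : A ⊆ B) : Synd B := by
  obtain ⟨L, hL⟩ := hA
  refine ⟨L, fun m => ?_⟩
  obtain ⟨n, hn, h1⟩ := hL m
  exact ⟨n, h hn, h1⟩

/-- A collection of syndetic sets behaving like the return times of a point to its
neighbourhoods in a minimal system. -/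
structure IsBase (𝓑 : Set (Set ℕ)) : Prop where
  inter : ∀ A ∈ 𝓑, ∀ B ∈ 𝓑, A ∩ B ∈ 𝓑
  shift : ∀ A ∈ 𝓑, ∀ n ∈ A, ∃ B ∈ 𝓑, ∀ m ∈ B, n + m ∈ A
  synd : ∀ A ∈ 𝓑, Synd A

lemma le_sum_of_synd {P : Set ℕ} {L₀ m : ℕ} {g : ℕ → ℝ} {c : ℝ} (hg : ∀ n, 0 ≤ g n)
    (hP : ∀ m, ∃ n ∈ P, m < n ∧ n ≤ m + L₀) :
    ∀ K : ℕ, (∀ n ∈ P, m < n → n ≤ m + K * L₀ → c ≤ g n) →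
      K * c ≤ ∑ i ∈ Finset.range (K * L₀), g (m + 1 + i) := by
  intro K
  induction K with
  | zero => intro _; simp
  | succ K ih =>
    intro h
    have h1 := ih fun n hn h2 h3 => h n hn h2 (h3.trans (by gcongr; omega))
    obtain ⟨n, hn, h2, h3⟩ := hP (m + K * L₀)
    have h4 := h n hn (by omega) (by rw [Nat.succ_mul]; omega)
    rw [Nat.succ_mul, Finset.sum_range_add]
    have h5 : g n ≤ ∑ x ∈ Finset.range L₀, g (m + 1 + (K * L₀ + x)) := by
      have h6 := Finset.single_le_sum (f := fun x => g (m + 1 + (K * L₀ + x)))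
        (s := Finset.range L₀) (fun i _ => hg _)
        (Finset.mem_range.2 (show n - (m + K * L₀) - 1 < L₀ by omega))
      have h7 : m + 1 + (K * L₀ + (n - (m + K * L₀) - 1)) = n := by omega
      simp only [h7] at h6
      exact h6
    push_cast
    linarith

/-- If `b` is small on average along all long intervals and `R` is not syndetic, then there is
`n` in a syndetic set for which `S + n` avoids `R` and `b` is small on `S + n`. -/
lemma exists_small_of_not_synd {b : ℕ → ℝ} (hb0 : ∀ n, 0 ≤ b n)
    (hb : ∀ ε > 0, ∃ L : ℕ, ∀ N ≥ L, ∀ M, ∑ n ∈ Finset.range N, b (M + n) ≤ N * ε)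
    {P R : Set ℕ} (hP : Synd P) (hR : ¬ Synd R) (S : Finset ℕ) {c : ℝ} (hc : 0 < c) :
    ∃ n ∈ P, 1 ≤ n ∧ (∀ s ∈ S, s + n ∉ R) ∧ ∑ s ∈ S, b (s + n) < c := by
  obtain ⟨L₀, hL₀⟩ := hP
  have hL₀1 : 1 ≤ L₀ := by
    obtain ⟨n, -, h1, h2⟩ := hL₀ 0
    omega
  have hL₀' : (0 : ℝ) < L₀ := by exact_mod_cast hL₀1
  set ε : ℝ := c / (2 * (S.card + 1) * L₀) with hε
  have hε0 : 0 < ε := by positivity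
  obtain ⟨L, hL⟩ := hb ε hε0
  set K := L + 1 with hK
  set N := K * L₀ with hN
  have hNL : L ≤ N := by
    have : K * 1 ≤ N := Nat.mul_le_mul_left _ hL₀1
    omega
  simp only [Synd] at hR
  push Not at hR
  obtain ⟨m, hm⟩ := hR (N + S.sup id)
  by_contra! hcon
  have h1 : (K : ℝ) * c ≤ ∑ i ∈ Finset.range N, ∑ s ∈ S, b (s + (m + 1 + i)) := by
    refine le_sum_of_synd (g := fun n => ∑ s ∈ S, b (s + n))
      (fun n => Finset.sum_nonneg fun _ _ => hb0 _) hL₀ K fun n hn h2 h3 => ?_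
    refine hcon n hn (by omega) fun s hs hsR => ?_
    have h4 : s ≤ S.sup id := Finset.le_sup (f := id) hs
    have := hm _ hsR (by omega)
    omega
  have h2 : ∑ i ∈ Finset.range N, ∑ s ∈ S, b (s + (m + 1 + i)) ≤ S.card * (N * ε) := by
    rw [Finset.sum_comm, ← nsmul_eq_mul]
    refine Finset.sum_le_card_nsmul _ _ _ fun s _ => ?_
    have := hL N hNL (s + (m + 1))
    simpa only [add_assoc] using this
  have h3 : (S.card : ℝ) * (N * ε) < K * c := by
    have hK0 : (0 : ℝ) < K := by positivity
    have e : (N : ℝ) = K * L₀ := by simp [hN]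
    have e2 : (S.card : ℝ) * (N * ε) = K * c * (S.card / (2 * (S.card + 1))) := by
      rw [e, hε]
      field_simp
    rw [e2]
    refine mul_lt_of_lt_one_right (by positivity) ?_
    rw [div_lt_one (by positivity)]
    have : (0 : ℝ) ≤ S.card := by positivity
    linarith
  linarith

end Syndetic

section Recurrence

set_option linter.overlappingInstances false

open MeasureTheory ProbabilityTheory Filter

variable {G : Type} [AddCommGroup G] {X : Type}

namespace Sys

/-- The set of points which, after time `n`, lie in `E` along each of the sequences in `V`. -/
def ret [MeasurableSpace X] {μ : Measure X} (S : Sys G μ) (V : Finset (ℕ → G)) (E : Set X) (n : ℕ) :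
    Set X := {x | ∀ v ∈ V, S.T (v n) x ∈ E}

lemma ret_anti [MeasurableSpace X] {μ : Measure X} (S : Sys G μ) {V W : Finset (ℕ → G)} {E E' : Set X} (hV : V ⊆ W)
    (hE : E' ⊆ E) (n : ℕ) : S.ret W E' n ⊆ S.ret V E n :=
  fun _ hx v hv => hE (hx v (hV hv))

/-- Uniform polynomial recurrence along the sets of `𝓑` for the sets in `m`. -/
def SZ (m : MeasurableSpace X) [mX : MeasurableSpace X] {μ : Measure X} (S : Sys G μ)
    (𝓑 : Set (Set ℕ)) : Prop :=
  ∀ E, MeasurableSet[m] E → 0 < μ E → ∀ V : Finset (ℕ → G), (∀ v ∈ V, IsPoly v ∧ v 0 = 0) →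
    ∀ A ∈ 𝓑, ∃ c > 0, Synd {n | n ∈ A ∧ c ≤ μ.real (S.ret V E n)}

/-- Polynomial recurrence along the sets of `𝓑` for the sets in `m`. -/
def PosSZ (m : MeasurableSpace X) [mX : MeasurableSpace X] {μ : Measure X} (S : Sys G μ)
    (𝓑 : Set (Set ℕ)) : Prop :=
  ∀ E, MeasurableSet[m] E → 0 < μ E → ∀ V : Finset (ℕ → G), (∀ v ∈ V, IsPoly v ∧ v 0 = 0) →
    ∀ A ∈ 𝓑, Synd {n | n ∈ A ∧ 0 < μ.real (S.ret V E n)}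

variable {m z : MeasurableSpace X} [mX : MeasurableSpace X]
  {μ : Measure X} [IsProbabilityMeasure μ] {S : Sys G μ}

omit [IsProbabilityMeasure μ] in
lemma measurableSet_ret (hm : S.IsFactor m) {E : Set X} (hE : MeasurableSet[m] E)
    (V : Finset (ℕ → G)) (n : ℕ) : MeasurableSet[m] (S.ret V E n) := by
  have : S.ret V E n = ⋂ v ∈ V, S.T (v n) ⁻¹' E := by
    ext x; simp [ret]
  rw [this]
  exact MeasurableSet.biInter V.countable_toSet fun v _ => hm.meas _ hE

lemma PosSZ.sz {𝓑 : Set (Set ℕ)} (hz : S.IsFactor z) (h : S.PosSZ z 𝓑) : S.SZ z 𝓑 := by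
  classical
  intro E hE hE0 V hV A hA
  set V₀ := insert 0 V with hV₀
  have hV₀' : ∀ v ∈ V₀, IsPoly v ∧ v 0 = 0 := by
    intro v hv
    rcases Finset.mem_insert.1 hv with rfl | hv
    · exact ⟨IsPoly.zero, rfl⟩
    · exact hV v hv
  by_contra! hcon
  obtain ⟨δ, hδ0, hδ⟩ := ENNReal.exists_pos_sum_of_countable hE0.ne' ℕ
  have hm' : ∀ k : ℕ, ∃ m, ∀ n ∈ A, m < n → n ≤ m + k →
      μ.real (S.ret V₀ E n) < δ k / (k + 1) := by
    intro k
    have h1 := hcon (δ k / (k + 1)) (by have := hδ0 k; positivity)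
    simp only [Synd] at h1
    push Not at h1
    obtain ⟨M, hM⟩ := h1 k
    refine ⟨M, fun n hn h2 h3 => ?_⟩
    by_contra! h4
    have := hM n ⟨hn, h4.trans (measureReal_mono (S.ret_anti (Finset.subset_insert _ _) le_rfl n))⟩ h2
    omega
  choose M hM using hm'
  set J : ℕ → Finset ℕ := fun k => (Finset.Ioc (M k) (M k + k)).filter (· ∈ A) with hJ
  set Z : Set X := ⋃ k, ⋃ n ∈ J k, S.ret V₀ E n with hZ
  have hZm : MeasurableSet[z] Z :=
    MeasurableSet.iUnion fun k => MeasurableSet.biUnion (J k).countable_toSet fun n _ =>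
      measurableSet_ret hz hE _ _
  have hZμ : μ Z < μ E := by
    refine lt_of_le_of_lt ((measure_iUnion_le _).trans (ENNReal.tsum_le_tsum fun k => ?_)) hδ
    have h1 : μ.real (⋃ n ∈ J k, S.ret V₀ E n) ≤ δ k := by
      refine (measureReal_biUnion_finset_le _ _).trans ?_
      have h2 : ∑ n ∈ J k, μ.real (S.ret V₀ E n) ≤ (J k).card • (δ k / (k + 1) : ℝ) := by
        refine Finset.sum_le_card_nsmul _ _ _ fun n hn => ?_
        simp only [hJ, Finset.mem_filter, Finset.mem_Ioc] at hn
        exact (hM k n hn.2 hn.1.1 hn.1.2).le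
      refine h2.trans ?_
      have h3 : (J k).card ≤ k + 1 := by
        refine (Finset.card_filter_le _ _).trans ?_
        simp
      have h4 : ((J k).card : ℝ) ≤ k + 1 := by exact_mod_cast h3
      rw [nsmul_eq_mul, mul_div_assoc']
      rw [div_le_iff₀ (by positivity), mul_comm]
      exact mul_le_mul_of_nonneg_left h4 (δ k).coe_nonneg
    rw [← ofReal_measureReal (measure_ne_top _ _)]
    refine (ENNReal.ofReal_le_ofReal h1).trans ?_
    simp
  have hEZ : 0 < μ (E \ Z) := by
    refine lt_of_lt_of_le (tsub_pos_of_lt hZμ) le_measure_sdiff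
  obtain ⟨L, hL⟩ := h (E \ Z) (hE.diff hZm) hEZ V₀ hV₀' A hA
  obtain ⟨n, ⟨hnA, hn0⟩, hn1, hn2⟩ := hL (M L)
  have hempty : S.ret V₀ (E \ Z) n = ∅ := by
    rw [Set.eq_empty_iff_forall_notMem]
    intro x hx
    have h1 : S.T 0 x ∈ E \ Z := hx 0 (Finset.mem_insert_self _ _)
    rw [S.zero] at h1
    refine h1.2 (Set.mem_iUnion.2 ⟨L, Set.mem_iUnion₂.2 ⟨n, ?_, ?_⟩⟩)
    · simp only [hJ, Finset.mem_filter, Finset.mem_Ioc]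
      exact ⟨⟨hn1, hn2⟩, hnA⟩
    · exact S.ret_anti le_rfl Set.sdiff_subset n hx
  rw [hempty] at hn0
  simp at hn0

end Sys

end Recurrence

end PolyRec

namespace PolyRec

section Step

set_option linter.overlappingInstances false

open MeasureTheory ProbabilityTheory Filter

variable {G : Type} [AddCommGroup G] {X : Type}

/-- The indicator function of a set, with real values. -/
noncomputable def ind (E : Set X) : X → ℝ := E.indicator fun _ => 1

open Classical in
lemma ind_apply (E : Set X) (x : X) : ind E x = if x ∈ E then 1 else 0 := Set.indicator_apply _ _ _

lemma ind_nonneg (E : Set X) (x : X) : 0 ≤ ind E x := by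
  classical
  rw [ind_apply]; split_ifs <;> norm_num

lemma ind_le_one (E : Set X) (x : X) : ind E x ≤ 1 := by
  classical
  rw [ind_apply]; split_ifs <;> norm_num

lemma abs_ind_le (E : Set X) (x : X) : |ind E x| ≤ 1 := by
  rw [abs_of_nonneg (ind_nonneg E x)]; exact ind_le_one E x

lemma abs_ind_sub (E : Set X) (x y : X) : |ind E x - ind E y| = (ind E x - ind E y) ^ 2 := by
  classical
  rw [ind_apply, ind_apply]; split_ifs <;> norm_num

lemma measurable_ind {m : MeasurableSpace X} {E : Set X} (hE : MeasurableSet[m] E) :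
    Measurable[m] (ind E) := Measurable.indicator (m := m) measurable_const hE

lemma BM.ind [MeasurableSpace X] {E : Set X} (hE : MeasurableSet E) : BM (ind E) :=
  BM.of_le_one (measurable_ind hE) (abs_ind_le E)

lemma measureReal_pos_iff [MeasurableSpace X] {μ : Measure X} [IsFiniteMeasure μ] {E : Set X} :
    0 < μ.real E ↔ 0 < μ E := by
  rw [Measure.real, ENNReal.toReal_pos_iff]
  exact and_iff_left (measure_lt_top _ _)

lemma integral_ind [MeasurableSpace X] {μ : Measure X} {E : Set X} (hE : MeasurableSet E) :
    ∫ x, ind E x ∂μ = μ.real E := by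
  rw [PolyRec.ind, integral_indicator_const _ hE, smul_eq_mul, mul_one]

lemma ind_mul_prod_le {ι J : Type*} [Fintype ι] (E : Set X) (V : Finset J) {x : X} {w : ι → X}
    {v v' : J → X} (h : ∀ j ∈ V, v' j = x ∨ ∃ i, v' j = w i) :
    ind E x * ∏ i, ind E (w i) ≤
      ∏ j ∈ V, ind E (v j) + ∑ j ∈ V, |ind E (v j) - ind E (v' j)| := by
  classical
  have hs : 0 ≤ ∑ j ∈ V, |ind E (v j) - ind E (v' j)| := Finset.sum_nonneg fun _ _ => abs_nonneg _
  have hp : 0 ≤ ∏ j ∈ V, ind E (v j) := Finset.prod_nonneg fun _ _ => ind_nonneg _ _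
  by_cases hx : x ∈ E ∧ ∀ i, w i ∈ E
  · have h1 : ind E x * ∏ i, ind E (w i) = 1 := by
      rw [ind_apply, if_pos hx.1, Finset.prod_eq_one, one_mul]
      intro i _
      rw [ind_apply, if_pos (hx.2 i)]
    rw [h1]
    by_cases hv : ∀ j ∈ V, v j ∈ E
    · rw [Finset.prod_eq_one fun j hj => by rw [ind_apply, if_pos (hv j hj)]]
      linarith
    · push Not at hv
      obtain ⟨j, hj, hjE⟩ := hv
      have h2 : v' j ∈ E := by
        rcases h j hj with h2 | ⟨i, h2⟩
        · rw [h2]; exact hx.1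
        · rw [h2]; exact hx.2 i
      have h3 : |ind E (v j) - ind E (v' j)| = 1 := by
        rw [ind_apply, ind_apply, if_neg hjE, if_pos h2]; norm_num
      have h4 := Finset.single_le_sum (f := fun j => |ind E (v j) - ind E (v' j)|)
        (fun i _ => abs_nonneg _) hj
      simp only [h3] at h4
      linarith
  · have h1 : ind E x * ∏ i, ind E (w i) = 0 := by
      by_cases hx1 : x ∈ E
      · push Not at hx
        obtain ⟨i, hi⟩ := hx hx1
        rw [Finset.prod_eq_zero (Finset.mem_univ i), mul_zero]
        rw [ind_apply, if_neg hi]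
      · rw [ind_apply, if_neg hx1, zero_mul]
    rw [h1]
    linarith

lemma integral_abs_sub_le [MeasurableSpace X] {ν : Measure X} [IsProbabilityMeasure ν]
    {e₁ e₂ F₁ F₂ h : X → ℝ} {θ : ℝ} (b₁ : BM e₁) (b₂ : BM e₂) (c₁ : BM F₁) (c₂ : BM F₂) (bh : BM h)
    (h0 : ∀ x, |e₁ x - e₂ x| = (e₁ x - e₂ x) ^ 2)
    (h1 : ∫ x, (e₁ x - F₁ x) ^ 2 ∂ν ≤ θ) (h2 : ∫ x, (F₁ x - h x) ^ 2 ∂ν ≤ θ)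
    (h3 : ∫ x, (F₂ x - h x) ^ 2 ∂ν ≤ θ) (h4 : ∫ x, (e₂ x - F₂ x) ^ 2 ∂ν ≤ θ) :
    ∫ x, |e₁ x - e₂ x| ∂ν ≤ 16 * θ := by
  have d1 := (b₁.sub c₁).sq
  have d2 := (c₁.sub bh).sq
  have d3 := (c₂.sub bh).sq
  have d4 := (b₂.sub c₂).sq
  have h5 : ∫ x, |e₁ x - e₂ x| ∂ν ≤ ∫ x, 4 * ((((e₁ x - F₁ x) ^ 2 + (F₁ x - h x) ^ 2) +
      (F₂ x - h x) ^ 2) + (e₂ x - F₂ x) ^ 2) ∂ν := by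
    refine BM.integral_mono (b₁.sub b₂).abs ((((d1.add d2).add d3).add d4).const_mul 4) fun x => ?_
    rw [h0 x]
    nlinarith [sq_nonneg (e₁ x - F₁ x - (F₁ x - h x)), sq_nonneg (e₁ x - F₁ x + (F₂ x - h x)),
      sq_nonneg (e₁ x - F₁ x + (e₂ x - F₂ x)), sq_nonneg (F₁ x - h x + (F₂ x - h x)),
      sq_nonneg (F₁ x - h x + (e₂ x - F₂ x)), sq_nonneg (F₂ x - h x - (e₂ x - F₂ x))]
  rw [integral_const_mul, integral_add ((d1.add d2).add d3).integrable d4.integrable,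
    integral_add (d1.add d2).integrable d3.integrable, integral_add d1.integrable d2.integrable] at h5
  linarith

namespace Sys

variable {m z : MeasurableSpace X} [mX : MeasurableSpace X] [StandardBorelSpace X]
  {μ : Measure X} [IsProbabilityMeasure μ] {S : Sys G μ}

/-- A set `D` of the base over which `E` is substantial and uniformly close to an almost periodic
function. -/
structure Core (m : MeasurableSpace X) [mX : MeasurableSpace X] [StandardBorelSpace X]
    {μ : Measure X} [IsProbabilityMeasure μ] (S : Sys G μ) (H : AddSubgroup G) (E : Set X)
    (c θ : ℝ) (κ : Type) (F : X → ℝ) (g : κ → X → ℝ) (D : Set X) : Prop where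
  bmF : BM F
  bmg : ∀ i, BM (g i)
  meas : MeasurableSet[m] D
  pos : 0 < μ D
  le_ce : ∀ y ∈ D, c ≤ ce m μ (ind E) y
  ce_le : ∀ y ∈ D, ce m μ (fun x => (ind E x - F x) ^ 2) y ≤ θ
  ap : ∀ᵐ y ∂μ, y ∈ D → ∀ h ∈ H, ∃ i, ce m μ (fun x => (F (S.T h x) - g i x) ^ 2) y ≤ θ

lemma ClAP.exists_core {H : AddSubgroup G} (hm : S.IsFactor m) {E : Set X}
    (hE : MeasurableSet E) (hE0 : 0 < μ.real E) (hcl : S.ClAP m H (ind E)) {θ : ℝ} (hθ : 0 < θ) :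
    ∃ (κ : Type) (_ : Finite κ) (F : X → ℝ) (g : κ → X → ℝ) (D : Set X),
      Core m (mX := mX) S H E (μ.real E / 2) θ κ F g D := by
  set r := μ.real E with hr
  obtain ⟨F, hF, hFE⟩ := hcl.approx (θ * (r / 8)) (by positivity)
  obtain ⟨κ, hκ, g, B, hg, hB, hBr, hgB⟩ := hF.approx θ hθ (r / 8) (by positivity)
  have bE : BM (ind E) := BM.ind hE
  have bd : BM fun x => (ind E x - F x) ^ 2 := (bE.sub hF.bm).sq
  set D₁ : Set X := {y | r / 2 ≤ ce m μ (ind E) y} with hD₁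
  set D₂ : Set X := {y | θ < ce m μ (fun x => (ind E x - F x) ^ 2) y} with hD₂
  have mD₁ : MeasurableSet[m] D₁ := measurable_ce bE.meas measurableSet_Ici
  have mD₂ : MeasurableSet[m] D₂ := measurable_ce bd.meas measurableSet_Ioi
  have h1 : r ≤ μ.real D₁ + r / 2 := by
    have e1 : ∫ x, ce m μ (ind E) x ∂μ = r := by rw [bE.integral_ce' hm.le, integral_ind hE]
    have e2 : ∫ x, ce m μ (ind E) x ∂μ ≤ ∫ x, (ind D₁ x + r / 2) ∂μ := by
      refine BM.integral_mono (bE.ce' hm.le) ((BM.ind (hm.le _ mD₁)).add (BM.const _)) fun x => ?_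
      by_cases hx : x ∈ D₁
      · have := (abs_le.1 (abs_ce_le (μ := μ) (m := m) (abs_ind_le E) x)).2
        rw [show ind D₁ x = 1 from Set.indicator_of_mem hx _]
        linarith
      · rw [show ind D₁ x = 0 from Set.indicator_of_notMem hx _]
        have : ¬ r / 2 ≤ ce m μ (ind E) x := hx
        linarith
    rw [integral_add (BM.ind (hm.le _ mD₁)).integrable (BM.const _).integrable,
      integral_ind (hm.le _ mD₁)] at e2
    simp only [integral_const, probReal_univ, one_smul] at e2
    linarith
  have h2 : μ.real D₂ ≤ r / 8 := by
    have := (bd.ce' (μ := μ) (m := m) hm.le).measureReal_gt_le (μ := μ)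
      (fun x => integral_nonneg fun _ => sq_nonneg _) hθ
    rw [bd.integral_ce' hm.le] at this
    refine this.trans ?_
    rw [div_le_iff₀ hθ]
    linarith
  refine ⟨κ, hκ, F, g, (D₁ \ D₂) ∩ B, hF.bm, hg, (mD₁.diff mD₂).inter hB, ?_,
    fun y hy => hy.1.1, fun y hy => not_lt.1 hy.1.2, ?_⟩
  · rw [← measureReal_pos_iff]
    have h3 : μ.real D₁ ≤ μ.real ((D₁ \ D₂) ∩ B) + μ.real D₂ + μ.real Bᶜ := by
      refine (measureReal_mono (s₂ := (((D₁ \ D₂) ∩ B) ∪ D₂) ∪ Bᶜ) fun x hx => ?_).trans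
        ((measureReal_union_le _ _).trans (add_le_add_left (measureReal_union_le _ _) _))
      by_cases hx2 : x ∈ D₂
      · exact .inl (.inr hx2)
      · by_cases hx3 : x ∈ B
        · exact .inl (.inl ⟨⟨hx, hx2⟩, hx3⟩)
        · exact .inr hx3
    linarith
  · filter_upwards [hgB] with y hy hyD
    exact hy hyD.2

end Sys

end Step

end PolyRec

namespace PolyRec

section Step

set_option linter.overlappingInstances false

open MeasureTheory ProbabilityTheory Filter

variable {G : Type} [AddCommGroup G] {X : Type}

lemma BM.prod [MeasurableSpace X] {ι : Type*} {s : Finset ι} {f : ι → X → ℝ}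
    (hf : ∀ i ∈ s, BM (f i)) : BM fun x => ∏ i ∈ s, f i x := by
  classical
  induction s using Finset.induction_on with
  | empty => simpa using BM.const (X := X) 1
  | insert a s ha ih =>
    simp only [Finset.prod_insert ha]
    exact (hf a (by simp)).mul (ih fun i hi => hf i (by simp [hi]))

namespace Sys

/-- The difference between a multiple correlation relative to `m` and its expected value. -/
noncomputable def defect (m : MeasurableSpace X) [mX : MeasurableSpace X] [StandardBorelSpace X]
    {μ : Measure X} [IsProbabilityMeasure μ] (S : Sys G μ) {ι : Type} [Fintype ι]
    (w : ι → ℕ → G) (E : Set X) (n : ℕ) : X → ℝ :=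
  ce m μ fun x => ind E x * (∏ i, ind E (S.T (w i n) x) - ∏ i, ce m μ (ind E) (S.T (w i n) x))

variable {m z : MeasurableSpace X} [mX : MeasurableSpace X] [StandardBorelSpace X]
  {μ : Measure X} [IsProbabilityMeasure μ] {S : Sys G μ}

omit [StandardBorelSpace X] [IsProbabilityMeasure μ] in
lemma ind_ret (V : Finset (ℕ → G)) (E : Set X) (n : ℕ) (x : X) :
    ind (S.ret V E n) x = ∏ v ∈ V, ind E (S.T (v n) x) := by
  classical
  by_cases hx : x ∈ S.ret V E n
  · rw [ind_apply, if_pos hx, Finset.prod_eq_one]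
    intro v hv
    rw [ind_apply, if_pos (hx v hv)]
  · rw [ind_apply, if_neg hx]
    have hx' : ¬ ∀ v ∈ V, S.T (v n) x ∈ E := hx
    push Not at hx'
    obtain ⟨v, hv, hvE⟩ := hx'
    rw [Finset.prod_eq_zero hv]
    rw [ind_apply, if_neg hvE]

lemma defect_ae_eq (hm : S.IsFactor m) {ι : Type} [Fintype ι] (w : ι → ℕ → G) {E : Set X}
    (hE : MeasurableSet E) (n : ℕ) :
    S.defect m w E n =ᵐ[μ] fun x =>
      ce m μ (fun x => ind E x * ∏ i, ind E (S.T (w i n) x)) x -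
        (∏ i, ce m μ (ind E) (S.T (w i n) x)) * ce m μ (ind E) x := by
  have bE : BM (ind E) := .ind hE
  have b1 : BM fun x => ∏ i, ind E (S.T (w i n) x) := .prod fun i _ => bE.comp (S.meas _)
  have hc : Measurable[m] (ce m μ (ind E)) := measurable_ce bE.meas
  have hc1 : ∀ x, |ce m μ (ind E) x| ≤ 1 := abs_ce_le (abs_ind_le E)
  have hp : Measurable[m] fun x => ∏ i, ce m μ (ind E) (S.T (w i n) x) :=
    Finset.measurable_prod (m := m) _ fun i _ => hc.comp (hm.meas _)
  have hp1 : ∀ x, |∏ i, ce m μ (ind E) (S.T (w i n) x)| ≤ 1 := fun x => by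
    rw [Finset.abs_prod]
    exact Finset.prod_le_one (fun _ _ => abs_nonneg _) fun i _ => hc1 _
  have b2 : BM fun x => ∏ i, ce m μ (ind E) (S.T (w i n) x) := .of_le_one (hp.mono hm.le le_rfl) hp1
  filter_upwards [ce_mul hm.le bE.meas (abs_ind_le E) hp hp1] with x hx
  rw [← hx, ← BM.ce_sub (bE.mul b1) (b2.mul bE)]
  unfold defect
  congr 1
  ext y
  ring

/-- The fibre measure over `y` pushed to the fibre over `T g y`. -/
lemma ce_apply_eq {y : X} {a : G} (hker : condExpKernel μ m (S.T a y) =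
    (condExpKernel μ m y).map (S.T a)) {f : X → ℝ} (hf : BM f) :
    ce m μ f (S.T a y) = ∫ x, f (S.T a x) ∂(condExpKernel μ m y) := by
  unfold ce
  rw [hker, integral_map (S.meas a).aemeasurable hf.meas.aestronglyMeasurable]

variable {H : AddSubgroup G} {E D : Set X} {c θ t : ℝ} {κ : Type} {F : X → ℝ} {g : κ → X → ℝ}

lemma Core.nonempty (hC : Core m S H E c θ κ F g D) : Nonempty κ := by
  have h1 : ∃ᵐ y ∂μ, y ∈ D := by
    rw [frequently_ae_mem_iff]
    exact hC.pos.ne'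
  obtain ⟨y, hy, hy'⟩ := (h1.and_eventually hC.ap).exists
  obtain ⟨i, -⟩ := hy' hy 0 H.zero_mem
  exact ⟨i⟩

lemma Core.exists_coloring (hC : Core m S H E c θ κ F g D) {p : G →+ G}
    (hp : ∀ a, a - p a ∈ H) {y : X}
    (hker : ∀ a, condExpKernel μ m (S.T a y) = (condExpKernel μ m y).map (S.T a))
    (hap : ∀ a, S.T a y ∈ D → ∀ h ∈ H, ∃ i,
      ce m μ (fun x => (F (S.T h x) - g i x) ^ 2) (S.T a y) ≤ θ)
    {Q : Finset G} (hQ : ∀ q ∈ Q, S.T q y ∈ D) :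
    ∃ col : G → κ, ∀ q ∈ Q, ∀ q' ∈ Q, p q = p q' → col q = col q' → ∃ h, BM h ∧
      ∫ x, (F (S.T q x) - h x) ^ 2 ∂(condExpKernel μ m y) ≤ θ ∧
      ∫ x, (F (S.T q' x) - h x) ^ 2 ∂(condExpKernel μ m y) ≤ θ := by
  classical
  have := hC.nonempty
  let r : G → G := fun b => if h : ∃ q ∈ Q, p q = b then h.choose else 0
  have hr : ∀ q ∈ Q, r (p q) ∈ Q ∧ p (r (p q)) = p q := fun q hq => by
    have h : ∃ q' ∈ Q, p q' = p q := ⟨q, hq, rfl⟩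
    simp only [r, dif_pos h]
    exact h.choose_spec
  have h1 : ∀ q : G, q ∈ Q → ∃ i, ∫ x, (F (S.T q x) - g i (S.T (r (p q)) x)) ^ 2
      ∂(condExpKernel μ m y) ≤ θ := by
    intro q hq
    obtain ⟨hr1, hr2⟩ := hr q hq
    have hH : q - r (p q) ∈ H := by
      have := H.sub_mem (hp q) (hp (r (p q)))
      rw [hr2] at this
      simpa using this
    obtain ⟨i, hi⟩ := hap _ (hQ _ hr1) _ hH
    refine ⟨i, ?_⟩
    rw [ce_apply_eq (hker _) ((hC.bmF.comp (S.meas _)).sub (hC.bmg i)).sq] at hi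
    simpa only [← S.add, sub_add_cancel] using hi
  choose! col hcol using h1
  refine ⟨col, fun q hq q' hq' hqq hcc => ⟨_, (hC.bmg (col q)).comp (S.meas (r (p q))),
    hcol q hq, ?_⟩⟩
  rw [hqq, hcc]
  exact hcol q' hq'

lemma Core.le_ce_ret (hC : Core m S H E c θ κ F g D) (hc : 0 ≤ c) (hE : MeasurableSet E) {y : X}
    (hker : ∀ a, condExpKernel μ m (S.T a y) = (condExpKernel μ m y).map (S.T a))
    {ι : Type} [Fintype ι] {w : ι → ℕ → G} {V : Finset (ℕ → G)} {p : G → G} {a : G} {s : ℕ}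
    (ha : S.T a y ∈ D) (haw : ∀ i, S.T (a + w i s) y ∈ D) (hav : ∀ v ∈ V, S.T (a + v s) y ∈ D)
    (hp : ∀ v ∈ V, p (v s) = 0 ∨ ∃ i, p (v s) = w i s)
    (hh : ∀ v ∈ V, ∃ h, BM h ∧
      ∫ x, (F (S.T (a + v s) x) - h x) ^ 2 ∂(condExpKernel μ m y) ≤ θ ∧
      ∫ x, (F (S.T (a + p (v s)) x) - h x) ^ 2 ∂(condExpKernel μ m y) ≤ θ)
    (hd : S.defect m w E s (S.T a y) =
      ce m μ (fun x => ind E x * ∏ i, ind E (S.T (w i s) x)) (S.T a y) -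
        (∏ i, ce m μ (ind E) (S.T (w i s) (S.T a y))) * ce m μ (ind E) (S.T a y))
    (ht : -t ≤ S.defect m w E s (S.T a y)) :
    c ^ (Fintype.card ι + 1) - t - V.card * (16 * θ) ≤ ce m μ (ind (S.ret V E s)) (S.T a y) := by
  set ν := condExpKernel μ m y with hν
  have bE : BM (ind E) := .ind hE
  have b1 : BM fun x => ind E x * ∏ i, ind E (S.T (w i s) x) :=
    bE.mul (.prod fun i _ => bE.comp (S.meas _))
  have b2 : BM fun x => ∏ v ∈ V, ind E (S.T (v s) x) := .prod fun i _ => bE.comp (S.meas _)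
  have h1 : c ^ (Fintype.card ι + 1) ≤
      (∏ i, ce m μ (ind E) (S.T (w i s) (S.T a y))) * ce m μ (ind E) (S.T a y) := by
    have h2 : c ^ Fintype.card ι ≤ ∏ i, ce m μ (ind E) (S.T (w i s) (S.T a y)) := by
      rw [← Finset.card_univ, ← Finset.prod_const]
      refine Finset.prod_le_prod (fun _ _ => hc) fun i _ => ?_
      rw [← S.add, add_comm]
      exact hC.le_ce _ (haw i)
    rw [pow_succ]
    exact mul_le_mul h2 (hC.le_ce _ ha) hc ((pow_nonneg hc _).trans h2)
  have hret : ce m μ (ind (S.ret V E s)) (S.T a y) =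
      ∫ x, ∏ v ∈ V, ind E (S.T (a + v s) x) ∂ν := by
    have e : ind (S.ret V E s) = fun x => ∏ v ∈ V, ind E (S.T (v s) x) := funext (ind_ret V E s)
    rw [e, ce_apply_eq (hker a) b2]
    simp only [← S.add, add_comm a, hν]
  have hE1 : ce m μ (fun x => ind E x * ∏ i, ind E (S.T (w i s) x)) (S.T a y) =
      ∫ x, ind E (S.T a x) * ∏ i, ind E (S.T (a + w i s) x) ∂ν := by
    rw [ce_apply_eq (hker a) b1]
    simp only [← S.add, add_comm a, hν]
  have hdiff : ∀ v ∈ V,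
      ∫ x, |ind E (S.T (a + v s) x) - ind E (S.T (a + p (v s)) x)| ∂ν ≤ 16 * θ := by
    intro v hv
    have hav' : S.T (a + p (v s)) y ∈ D := by
      rcases hp v hv with h | ⟨i, h⟩
      · rw [h, add_zero]; exact ha
      · rw [h]; exact haw i
    have key : ∀ b, S.T b y ∈ D → ∫ x, (ind E (S.T b x) - F (S.T b x)) ^ 2 ∂ν ≤ θ := by
      intro b hb
      have := hC.ce_le _ hb
      rwa [ce_apply_eq (hker b) (bE.sub hC.bmF).sq] at this
    obtain ⟨h, bh, h3, h4⟩ := hh v hv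
    exact integral_abs_sub_le (bE.comp (S.meas _)) (bE.comp (S.meas _)) (hC.bmF.comp (S.meas _))
      (hC.bmF.comp (S.meas _)) bh (fun x => abs_ind_sub E _ _) (key _ (hav v hv)) h3 h4
      (key _ hav')
  have bd : ∀ v ∈ V, BM fun x => |ind E (S.T (a + v s) x) - ind E (S.T (a + p (v s)) x)| :=
    fun v _ => ((bE.comp (S.meas _)).sub (bE.comp (S.meas _))).abs
  have b3 : BM fun x => ∏ v ∈ V, ind E (S.T (a + v s) x) := .prod fun i _ => bE.comp (S.meas _)
  have hle : ∫ x, ind E (S.T a x) * ∏ i, ind E (S.T (a + w i s) x) ∂ν ≤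
      ∫ x, (∏ v ∈ V, ind E (S.T (a + v s) x) +
        ∑ v ∈ V, |ind E (S.T (a + v s) x) - ind E (S.T (a + p (v s)) x)|) ∂ν := by
    refine BM.integral_mono ((bE.comp (S.meas _)).mul (.prod fun i _ => bE.comp (S.meas _)))
      (b3.add (.sum bd)) fun x => ?_
    refine ind_mul_prod_le E V (v := fun v => S.T (a + v s) x)
      (v' := fun v => S.T (a + p (v s)) x) (w := fun i => S.T (a + w i s) x) fun v hv => ?_
    rcases hp v hv with h | ⟨i, h⟩
    · left; simp only [h, add_zero]
    · right; exact ⟨i, by simp only [h]⟩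
  rw [integral_add b3.integrable (BM.sum bd).integrable,
    integral_finsetSum _ fun v hv => (bd v hv).integrable] at hle
  have hsum := Finset.sum_le_card_nsmul _ _ _ hdiff
  rw [nsmul_eq_mul] at hsum
  rw [hret]
  linarith

end Sys

end Step

end PolyRec

namespace PolyRec

section Step

set_option linter.overlappingInstances false

open MeasureTheory ProbabilityTheory Filter

variable {G : Type} [AddCommGroup G] {X : Type}

namespace Sys

/-- The invariant kept up by the second player of the polynomial van der Waerden game, who
tries to collect differences in `A \ R` while staying in `D₀` and avoiding bad sets. -/
def Inv (m : MeasurableSpace X) [mX : MeasurableSpace X] {μ : Measure X} (S : Sys G μ)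
    (𝓑 : Set (Set ℕ)) (A R : Set ℕ) (D₀ : Set X) (Bad : ℕ → Set X) (N : Finset ℕ)
    (Q : Finset G) : Prop :=
  ∃ D, MeasurableSet[m] D ∧ 0 < μ D ∧ (∃ A' ∈ 𝓑, ∀ s ∈ N, ∀ n ∈ A', s + n ∈ A) ∧
    (∀ a ∈ Q, ∀ y ∈ D, S.T a y ∈ D₀ ∧ ∀ s ∈ N, s ≠ 0 → S.T a y ∉ Bad s) ∧
    ∀ s ∈ N, s ≠ 0 → s ∈ A ∧ s ∉ R

variable {m z : MeasurableSpace X} [mX : MeasurableSpace X]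
  {μ : Measure X} [IsProbabilityMeasure μ] {S : Sys G μ} {𝓑 : Set (Set ℕ)} {A R : Set ℕ}
  {D₀ : Set X} {Bad : ℕ → Set X} {N : Finset ℕ} {Q : Finset G}

lemma Inv.step (hm : S.IsFactor m) (h𝓑 : IsBase 𝓑) (hSZ : S.SZ m 𝓑)
    (hBad : ∀ n, MeasurableSet[m] (Bad n))
    (hb : ∀ ε > 0, ∃ L : ℕ, ∀ N ≥ L, ∀ M,
      ∑ n ∈ Finset.range N, μ.real (Bad (M + n)) ≤ N * ε)
    (hR : ¬ Synd R) (hI : Inv m S 𝓑 A R D₀ Bad N Q) {U : Finset (ℕ → G)}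
    (hU : ∀ u ∈ U, IsPoly u ∧ u 0 = 0) :
    ∃ n, 1 ≤ n ∧ Inv m S 𝓑 A R D₀ Bad (nextS N n) (nextQ Q U n) := by
  obtain ⟨D, hD, hD0, ⟨A', hA', hNA⟩, hQ, hN⟩ := hI
  obtain ⟨c, hc, hP⟩ := hSZ D hD hD0 U hU A' hA'
  obtain ⟨n, ⟨hnA, hnc⟩, hn1, hnR, hnb⟩ := exists_small_of_not_synd
    (b := fun n => μ.real (Bad n)) (fun _ => measureReal_nonneg) hb hP hR N
    (c := c / (Q.card * U.card + 1)) (by positivity)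
  obtain ⟨A'', hA'', hnA''⟩ := h𝓑.shift A' hA' n hnA
  set Z : Set X := ⋃ i ∈ N ×ˢ Q ×ˢ U, S.T (i.2.1 + i.2.2 n) ⁻¹' Bad (i.1 + n) with hZ
  have hZm : MeasurableSet[m] Z :=
    MeasurableSet.biUnion (Finset.countable_toSet _) fun i _ => hm.meas _ (hBad _)
  have hZμ : μ.real Z < c := by
    have h1 : μ.real Z ≤ ∑ i ∈ N ×ˢ Q ×ˢ U, μ.real (Bad (i.1 + n)) := by
      refine (measureReal_biUnion_finset_le _ _).trans (Finset.sum_le_sum fun i _ => ?_)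
      rw [(S.mp _).measureReal_preimage (hm.le _ (hBad _)).nullMeasurableSet]
    rw [Finset.sum_product] at h1
    simp only [Finset.sum_const, Finset.card_product, nsmul_eq_mul, ← Finset.mul_sum] at h1
    push_cast at h1
    refine h1.trans_lt ?_
    rw [lt_div_iff₀ (by positivity)] at hnb
    have h2 : 0 ≤ ∑ s ∈ N, μ.real (Bad (s + n)) := Finset.sum_nonneg fun _ _ => measureReal_nonneg
    linarith
  refine ⟨n, hn1, S.ret U D n \ Z, (measurableSet_ret hm hD U n).diff hZm, ?_,
    ⟨A'' ∩ A', h𝓑.inter _ hA'' _ hA', ?_⟩, ?_, ?_⟩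
  · rw [← measureReal_pos_iff]
    have h1 : μ.real (S.ret U D n) ≤ μ.real (S.ret U D n \ Z) + μ.real Z := by
      refine (measureReal_mono (s₂ := (S.ret U D n \ Z) ∪ Z) fun x hx => ?_).trans
        (measureReal_union_le _ _)
      by_cases h : x ∈ Z
      · exact .inr h
      · exact .inl ⟨hx, h⟩
    linarith
  · intro s hs k hk
    rcases mem_nextS.1 hs with hs | ⟨s', hs', rfl⟩
    · exact hNA s hs k hk.2
    · rw [add_assoc]
      exact hNA s' hs' _ (hnA'' k hk.1)
  · intro a ha y hy
    obtain ⟨q, hq, u, hu, rfl⟩ := mem_nextQ.1 ha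
    have h1 := hQ q hq _ (hy.1 u hu)
    rw [← S.add] at h1
    refine ⟨h1.1, fun s hs hs0 => ?_⟩
    rcases mem_nextS.1 hs with hs | ⟨s', hs', rfl⟩
    · exact h1.2 s hs hs0
    · intro hbad
      refine hy.2 (Set.mem_iUnion₂.2 ⟨(s', q, u), ?_, hbad⟩)
      simp [hs', hq, hu]
  · intro s hs hs0
    rcases mem_nextS.1 hs with hs | ⟨s', hs', rfl⟩
    · exact hN s hs hs0
    · exact ⟨hNA s' hs' n hnA, hnR s' hs'⟩

variable [StandardBorelSpace X]

lemma exists_generic [Countable G] (hm : S.IsFactor m) {E D : Set X} (hE : MeasurableSet E)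
    {H : AddSubgroup G} {c θ : ℝ} {κ : Type} {F : X → ℝ} {g : κ → X → ℝ}
    (hC : Core m S H E c θ κ F g D₀) (hD0 : 0 < μ D) {ι : Type} [Fintype ι]
    (w : ι → ℕ → G) (V : Finset (ℕ → G)) :
    ∃ y ∈ D, (∀ a, condExpKernel μ m (S.T a y) = (condExpKernel μ m y).map (S.T a)) ∧
      (∀ a, S.T a y ∈ D₀ → ∀ h ∈ H, ∃ i,
        ce m μ (fun x => (F (S.T h x) - g i x) ^ 2) (S.T a y) ≤ θ) ∧
      (∀ a s, S.defect m w E s (S.T a y) =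
        ce m μ (fun x => ind E x * ∏ i, ind E (S.T (w i s) x)) (S.T a y) -
          (∏ i, ce m μ (ind E) (S.T (w i s) (S.T a y))) * ce m μ (ind E) (S.T a y)) ∧
      ∀ a s, μ.real (S.ret V E s) = 0 → ce m μ (ind (S.ret V E s)) (S.T a y) = 0 := by
  have h1 := S.ker_map hm
  have h2 := ae_all_iff.2 fun a => S.ae_comp a hC.ap
  have h3 := ae_all_iff.2 fun a => ae_all_iff.2 fun s => S.ae_comp a (defect_ae_eq hm w hE s)
  have h4 : ∀ᵐ y ∂μ, ∀ a s, μ.real (S.ret V E s) = 0 →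
      ce m μ (ind (S.ret V E s)) (S.T a y) = 0 := by
    refine ae_all_iff.2 fun a => ae_all_iff.2 fun s => ?_
    by_cases h0 : μ.real (S.ret V E s) = 0
    · have h5 : ind (S.ret V E s) =ᵐ[μ] 0 :=
        indicator_meas_zero ((measureReal_eq_zero_iff (measure_ne_top _ _)).1 h0)
      filter_upwards [S.ae_comp a (ce_congr hm.le h5)] with y hy _
      rw [hy]
      simp [ce]
    · exact ae_of_all _ fun y h => absurd h h0
  have h5 : ∃ᵐ y ∂μ, y ∈ D := by
    rw [frequently_ae_mem_iff]
    exact hD0.ne'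
  obtain ⟨y, hy, h⟩ := (h5.and_eventually (h1.and (h2.and (h3.and h4)))).exists
  exact ⟨y, hy, h⟩

theorem IsPrimitive.posSZ [Countable G] [IsAddTorsionFree G] {H : AddSubgroup G} {p : G →+ G}
    (hm : S.IsFactor m) (hz : IsPrimitive m z (mX := mX) S H p) (h𝓑 : IsBase 𝓑)
    (hSZ : S.SZ m 𝓑) : S.PosSZ z 𝓑 := by
  classical
  intro E hEz hE0 V hV A hA
  by_contra hR
  have hE : MeasurableSet E := hz.factor.le _ hEz
  have hr0 : 0 < μ.real E := measureReal_pos_iff.2 hE0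
  have hpp : ∀ g, p (p g) = p g := fun g => by
    have := hz.map_eq_zero _ (hz.sub_mem g)
    rw [map_sub, sub_eq_zero] at this
    exact this.symm
  set W : Finset (ℕ → G) := (V.image fun v n => p (v n)).erase 0 with hW
  have hWV : ∀ u ∈ W, IsPoly u ∧ u 0 = 0 ∧ u ≠ 0 ∧ ∀ n, u n ∈ p.range := by
    intro u hu
    obtain ⟨hu0, hu⟩ := Finset.mem_erase.1 hu
    obtain ⟨v, hv, rfl⟩ := Finset.mem_image.1 hu
    exact ⟨(hV v hv).1.comp p, by simp [(hV v hv).2], hu0, fun n => ⟨_, rfl⟩⟩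
  set V' : Finset (ℕ → G) := (V ∪ W).erase 0 with hV'
  have hV'' : ∀ v ∈ V', IsPoly v ∧ v 0 = 0 ∧ v ≠ 0 := by
    intro v hv
    obtain ⟨hv0, hv⟩ := Finset.mem_erase.1 hv
    rcases Finset.mem_union.1 hv with hv | hv
    · exact ⟨(hV v hv).1, (hV v hv).2, hv0⟩
    · exact ⟨(hWV v hv).1, (hWV v hv).2.1, hv0⟩
  let w : W → ℕ → G := fun i => i.1
  have hw : GoodFamily p.range w := by
    refine ⟨fun i => (hWV _ i.2).1, fun i => (hWV _ i.2).2.2.2, fun i =>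
      dlt_ne_zero_of_ne_zero (hWV _ i.2).2.1 (hWV _ i.2).2.2.1, fun i j hij => ?_⟩
    refine dlt_ne_zero_of_ne_zero ?_ fun h => hij (Subtype.ext (sub_eq_zero.1 h))
    show i.1 0 - j.1 0 = 0
    rw [(hWV _ i.2).2.1, (hWV _ j.2).2.1, sub_zero]
  set c := μ.real E / 2 with hc
  have hc0 : 0 < c := by positivity
  set P := c ^ (Fintype.card W + 1) with hP
  have hP0 : 0 < P := by positivity
  set t := P / 4 with ht
  have ht0 : 0 < t := by positivity
  set θ := P / (64 * (V.card + 1)) with hθ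
  have hθ0 : 0 < θ := by positivity
  obtain ⟨κ, _, F, g, D₀, hC⟩ := ClAP.exists_core hm hE hr0
    (hz.clAP _ (measurable_ind hEz) (abs_ind_le E)) hθ0
  set Bad : ℕ → Set X := fun n => {x | t ^ 2 < S.defect m w E n x ^ 2} with hBad
  have bE : BM (ind E) := .ind hE
  have hin : ∀ n, BM fun x => ind E x *
      (∏ i, ind E (S.T (w i n) x) - ∏ i, ce m μ (ind E) (S.T (w i n) x)) := fun n =>
    bE.mul ((BM.prod fun i _ => bE.comp (S.meas _)).sub
      (.prod fun i _ => (bE.ce' hm.le).comp (S.meas _)))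
  have hdm : ∀ n, Measurable[m] (S.defect m w E n) := fun n => measurable_ce (hin n).meas
  have hBadm : ∀ n, MeasurableSet[m] (Bad n) := fun n =>
    ((hdm n).pow_const 2) measurableSet_Ioi
  have hb : ∀ ε > 0, ∃ L : ℕ, ∀ N ≥ L, ∀ M,
      ∑ n ∈ Finset.range N, μ.real (Bad (M + n)) ≤ N * ε := by
    intro ε hε
    obtain ⟨L, hL⟩ := hw.average_defect_le hm hz.factor hz.le hz.mixing
      (measurable_ind hEz) (abs_ind_le E) (f := fun _ => ind E) (fun _ => measurable_ind hEz)
      (fun _ => abs_ind_le E) (ε := ε * t ^ 2) (by positivity)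
    refine ⟨L, fun N hN M => ?_⟩
    have h1 := hL N hN M
    have h2 : ∀ n ∈ Finset.range N, μ.real (Bad (M + n)) ≤
        (∫ x, S.defect m w E (M + n) x ^ 2 ∂μ) / t ^ 2 := fun n _ =>
      (((hin _).ce' hm.le).sq).measureReal_gt_le (fun _ => sq_nonneg _) (by positivity)
    refine (Finset.sum_le_sum h2).trans ?_
    rw [← Finset.sum_div, div_le_iff₀ (by positivity), mul_assoc]
    exact h1
  set R : Set ℕ := {n | n ∈ A ∧ 0 < μ.real (S.ret V E n)} with hRdef
  obtain ⟨N, Q, ⟨D, hD, hD0, -, hQ, hN⟩, hmono⟩ :=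
    (win_mono V' (fun v hv => (hV'' v hv).1) (fun v hv => (hV'' v hv).2) κ).exists_of_invariant
      (I := Inv m S 𝓑 A R D₀ Bad)
      ⟨D₀, hC.meas, hC.pos, ⟨A, hA, by simp⟩, by simp [S.zero], by simp⟩
      fun N Q U hI hU _ => hI.step hm h𝓑 hSZ hBadm hb hR hU
  obtain ⟨y, hyD, hker, hap, hdef, hret⟩ := exists_generic hm hE hC hD0 w V
  obtain ⟨col, hcol⟩ := hC.exists_coloring hz.sub_mem hker hap fun q hq => (hQ q hq y hyD).1
  obtain ⟨a, ha, s, hs, hs0, hv⟩ := hmono col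
  have hall : ∀ u, (u ∈ V ∨ u ∈ W ∨ u = 0) → a + u s ∈ Q ∧ col (a + u s) = col a := by
    intro u hu
    by_cases hu0 : u = 0
    · rw [hu0, Pi.zero_apply, add_zero]; exact ⟨ha, rfl⟩
    · refine hv u (Finset.mem_erase.2 ⟨hu0, Finset.mem_union.2 ?_⟩)
      tauto
  have hpv : ∀ v ∈ V, (fun n => p (v n)) ∈ W ∨ (fun n => p (v n)) = 0 := by
    intro v hv
    by_cases h0 : (fun n => p (v n)) = 0
    · exact .inr h0
    · exact .inl (Finset.mem_erase.2 ⟨h0, Finset.mem_image_of_mem _ hv⟩)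
  obtain ⟨hsA, hsR⟩ := hN s hs hs0
  have hzero : μ.real (S.ret V E s) = 0 := by
    by_contra h
    exact hsR ⟨hsA, lt_of_le_of_ne measureReal_nonneg (Ne.symm h)⟩
  have hbad := (hQ a ha y hyD).2 s hs hs0
  have hd : -t ≤ S.defect m w E s (S.T a y) := by
    have h1 : ¬ t ^ 2 < S.defect m w E s (S.T a y) ^ 2 := hbad
    exact (abs_le_of_sq_le_sq' (not_lt.1 h1) ht0.le).1
  have key := hC.le_ce_ret hc0.le hE hker (w := w) (V := V) (p := p) (a := a) (s := s)
    (hQ a ha y hyD).1 (fun i => (hQ _ (hall _ (.inr (.inl i.2))).1 y hyD).1)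
    (fun v hv => (hQ _ (hall v (.inl hv)).1 y hyD).1) ?_ ?_ (hdef a s) hd
  · rw [hret a s hzero] at key
    have h1 : (V.card : ℝ) * (16 * θ) ≤ P / 4 := by
      rw [hθ, mul_div_assoc', mul_div_assoc', div_le_div_iff₀ (by positivity) (by norm_num)]
      nlinarith
    linarith
  · intro v hv
    rcases hpv v hv with h | h
    · exact .inr ⟨⟨_, h⟩, rfl⟩
    · exact .inl (congrFun h s)
  · intro v hv
    have h1 := hall v (.inl hv)
    have h2 := hall (fun n => p (v n)) (.inr (hpv v hv))
    exact hcol _ h1.1 _ h2.1 (by rw [map_add, map_add, hpp]) (h1.2.trans h2.2.symm)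

end Sys

end Step

end PolyRec

namespace PolyRec

section Zorn

set_option linter.overlappingInstances false

open MeasureTheory ProbabilityTheory Filter

lemma exists_approx_of_isChain {X : Type} {c : Set (MeasurableSpace X)} (hc : IsChain (· ≤ ·) c)
    (hne : c.Nonempty) [mX : MeasurableSpace X] {μ : Measure X} [IsFiniteMeasure μ]
    (hle : sSup c ≤ mX) {E : Set X} (hE : MeasurableSet[sSup c] E) {ε : ℝ} (hε : 0 < ε) :
    ∃ m ∈ c, ∃ E', MeasurableSet[m] E' ∧ μ (symmDiff E E') < ENNReal.ofReal ε := by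
  set 𝒜 : Set (Set X) := {s | ∃ m ∈ c, MeasurableSet[m] s} with h𝒜
  have halg : IsSetAlgebra 𝒜 := by
    refine ⟨?_, ?_, ?_⟩
    · obtain ⟨m, hm⟩ := hne
      exact ⟨m, hm, @MeasurableSet.empty _ m⟩
    · rintro s ⟨m, hm, hs⟩
      exact ⟨m, hm, hs.compl⟩
    · rintro s t ⟨m, hm, hs⟩ ⟨m', hm', ht⟩
      rcases hc.total hm hm' with h | h
      · exact ⟨m', hm', (h _ hs).union ht⟩
      · exact ⟨m, hm, hs.union (h _ ht)⟩
  have hgen : sSup c = MeasurableSpace.generateFrom 𝒜 := by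
    ext s
    exact MeasurableSpace.measurableSet_sSup
  have hd := @Measure.MeasureDense.of_generateFrom_isSetAlgebra_finite X (sSup c)
    (μ.trim hle) 𝒜 (isFiniteMeasure_trim hle) halg hgen
  obtain ⟨t, ⟨m, hm, ht⟩, hlt⟩ := @Measure.MeasureDense.approx X (sSup c) _ _ hd E hE
    (by rw [trim_measurableSet_eq hle hE]; exact @measure_ne_top X mX μ _ E) ε hε
  refine ⟨m, hm, t, ht, ?_⟩
  have h1 : MeasurableSet[sSup c] t := le_sSup hm _ ht
  rwa [trim_measurableSet_eq hle (by
    exact (hE.diff h1).union (h1.diff hE))] at hlt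

variable {G : Type} [AddCommGroup G] {X : Type}

namespace Sys

variable {m z : MeasurableSpace X} [mX : MeasurableSpace X] [StandardBorelSpace X]
  {μ : Measure X} [IsProbabilityMeasure μ] {S : Sys G μ} {𝓑 : Set (Set ℕ)}

/-- On a set where `E` has conditional probability close to one along `g`, most points return. -/
lemma le_measureReal_inter_preimage (hm : S.IsFactor m) {E D : Set X} (hE : MeasurableSet E)
    (hD : MeasurableSet[m] D) {η : ℝ} {g : G} (h : ∀ x ∈ D, 1 - η ≤ ce m μ (ind E) (S.T g x)) :
    μ.real (D \ S.T g ⁻¹' E) ≤ η * μ.real D := by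
  have hD' := hm.le _ hD
  have hEg := S.meas g hE
  have h0 : (fun x => ind D x * ind (S.T g ⁻¹' E) x) = ind (D ∩ S.T g ⁻¹' E) := by
    classical
    ext x
    rw [ind_apply, ind_apply, ind_apply]
    by_cases h1 : x ∈ D <;> by_cases h2 : x ∈ S.T g ⁻¹' E <;> simp [h1, h2]
  have h1 : ∫ x, ind D x * ce m μ (ind (S.T g ⁻¹' E)) x ∂μ = μ.real (D ∩ S.T g ⁻¹' E) := by
    rw [integral_mul_ce hm.le (measurable_ind hEg) (abs_ind_le _) (measurable_ind hD)
      (abs_ind_le _), h0, integral_ind (hD'.inter hEg)]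
  have h2 : ce m μ (ind (S.T g ⁻¹' E)) =ᵐ[μ] fun x => ce m μ (ind E) (S.T g x) :=
    S.ce_comp hm (measurable_ind hE) (abs_ind_le _) g
  have h3 : ∫ x, ind D x * ce m μ (ind (S.T g ⁻¹' E)) x ∂μ =
      ∫ x, ind D x * ce m μ (ind E) (S.T g x) ∂μ := by
    refine integral_congr_ae ?_
    filter_upwards [h2] with x hx
    rw [hx]
  have h4 : ∫ x, (1 - η) * ind D x ∂μ ≤ ∫ x, ind D x * ce m μ (ind E) (S.T g x) ∂μ := by
    refine BM.integral_mono ((BM.ind hD').const_mul _) ((BM.ind hD').mul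
      (((BM.ind hE).ce' hm.le).comp (S.meas g))) fun x => ?_
    classical
    by_cases hx : x ∈ D
    · rw [ind_apply, if_pos hx]; simpa using h x hx
    · rw [ind_apply, if_neg hx]; simp
  rw [integral_const_mul, integral_ind hD', ← h3, h1] at h4
  have h5 := measureReal_inter_add_sdiff (μ := μ) (s := D) hEg
  linarith

/-- Recurrence passes to sets well approximated by sets in a factor with recurrence. -/
lemma SZ.synd_of_approx (hm : S.IsFactor m) (hSZ : S.SZ m 𝓑) {E E' : Set X}
    (hE : MeasurableSet E) (hE' : MeasurableSet[m] E') {V : Finset (ℕ → G)}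
    (hV : ∀ v ∈ V, IsPoly v ∧ v 0 = 0) {A : Set ℕ} (hA : A ∈ 𝓑) {η : ℝ}
    (hη : η = 1 / (2 * (V.card + 1))) (h : μ.real (E' \ E) < η * μ.real E') :
    Synd {n | n ∈ A ∧ 0 < μ.real (S.ret V E n)} := by
  set f := ce m μ (ind E) with hf
  have hfm : Measurable[m] f := measurable_ce (measurable_ind hE)
  set B : Set X := {x | 1 - η < f x} with hB
  have hBm : MeasurableSet[m] B := measurableSet_lt (by exact measurable_const) hfm
  have hE'X := hm.le _ hE'
  have hBpos : 0 < μ B := by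
    rw [pos_iff_ne_zero]
    intro h0
    have h1 : ∀ᵐ x ∂μ, f x ≤ 1 - η := by
      rw [ae_iff]
      simpa [hB] using h0
    have h2 : ∫ x, ind E' x * f x ∂μ = μ.real (E' ∩ E) := by
      rw [integral_mul_ce hm.le (measurable_ind hE) (abs_ind_le _) (measurable_ind hE')
        (abs_ind_le _), ← integral_ind (hE'X.inter hE)]
      classical
      congr 1
      ext x
      rw [ind_apply, ind_apply, ind_apply]
      by_cases h1 : x ∈ E' <;> by_cases h2 : x ∈ E <;> simp [h1, h2]
    have h3 : ∫ x, ind E' x * f x ∂μ ≤ ∫ x, ind E' x * (1 - η) ∂μ := by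
      refine integral_mono_ae ((BM.ind hE'X).mul ((BM.ind hE).ce' hm.le)).integrable
        ((BM.ind hE'X).mul (BM.const _)).integrable ?_
      filter_upwards [h1] with x hx
      exact mul_le_mul_of_nonneg_left hx (ind_nonneg _ _)
    rw [integral_mul_const, integral_ind hE'X, h2] at h3
    have h5 := measureReal_inter_add_sdiff (μ := μ) (s := E') hE
    linarith
  obtain ⟨c, hc, hs⟩ := hSZ B hBm hBpos V hV A hA
  refine hs.mono fun n hn => ⟨hn.1, ?_⟩
  have hcn : c ≤ μ.real (S.ret V B n) := hn.2
  set D := S.ret V B n with hD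
  have hDm : MeasurableSet[m] D := measurableSet_ret hm hBm V n
  have hDX := hm.le _ hDm
  have h1 : ∀ v ∈ V, μ.real (D \ S.T (v n) ⁻¹' E) ≤ η * μ.real D := fun v hv =>
    le_measureReal_inter_preimage hm hE hDm fun x hx => (hx v hv).le
  have h2 : D ⊆ S.ret V E n ∪ ⋃ v ∈ V, D \ S.T (v n) ⁻¹' E := by
    intro x hx
    by_cases hx' : x ∈ S.ret V E n
    · exact .inl hx'
    · right
      have : ∃ v ∈ V, S.T (v n) x ∉ E := by
        by_contra! h3
        exact hx' h3
      obtain ⟨v, hv, h3⟩ := this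
      exact Set.mem_iUnion₂.2 ⟨v, hv, hx, h3⟩
  have h3 : μ.real D ≤ μ.real (S.ret V E n) + V.card * (η * μ.real D) := by
    refine (measureReal_mono h2).trans ((measureReal_union_le _ _).trans ?_)
    gcongr
    refine (measureReal_biUnion_finset_le _ _).trans ?_
    rw [← nsmul_eq_mul]
    exact Finset.sum_le_card_nsmul _ _ _ h1
  have h4 : V.card * η < 1 := by
    rw [hη, mul_one_div, div_lt_one (by positivity)]
    have : (0 : ℝ) ≤ V.card := by positivity
    linarith
  have h5 : 0 < (1 - V.card * η) * μ.real D := mul_pos (by linarith) (by linarith)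
  linarith

/-- The factors for which recurrence has been established. -/
def Good {X : Type} [mX : MeasurableSpace X] {μ : Measure X} (S : Sys G μ) (𝓑 : Set (Set ℕ)) :
    Set (MeasurableSpace X) :=
  {m | Sys.IsFactor m (mX := mX) S ∧ Sys.SZ m (mX := mX) S 𝓑}

omit [StandardBorelSpace X] [IsProbabilityMeasure μ] in
lemma isFactor_sSup {c : Set (MeasurableSpace X)} (hc : c ⊆ S.Good 𝓑) :
    S.IsFactor (sSup c) := by
  refine ⟨sSup_le fun m hm => Sys.IsFactor.le (mX := mX) (hc hm).1, fun g => ?_⟩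
  rw [measurable_iff_le_map]
  refine sSup_le fun m hm => ?_
  have h := @Sys.IsFactor.meas G _ X m mX μ S (hc hm).1 g
  rw [measurable_iff_le_map] at h
  exact h.trans (MeasurableSpace.map_mono (le_sSup hm))

omit [StandardBorelSpace X] [IsProbabilityMeasure μ] in
lemma isFactor_bot : S.IsFactor (⊥ : MeasurableSpace X) :=
  ⟨bot_le, fun g => by
    rw [measurable_iff_le_map]
    exact bot_le⟩

omit [StandardBorelSpace X] in
lemma sz_bot (h𝓑 : IsBase 𝓑) : S.SZ ⊥ 𝓑 := by
  intro E hE hE0 V _ A hA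
  refine ⟨1, one_pos, (h𝓑.synd A hA).mono fun n hn => ⟨hn, ?_⟩⟩
  rcases MeasurableSpace.measurableSet_bot_iff.1 hE with rfl | rfl
  · simp at hE0
  · have : S.ret V Set.univ n = Set.univ := by
      ext x; simp [ret]
    rw [this]
    simp

lemma sz_sSup {c : Set (MeasurableSpace X)} (hc : IsChain (· ≤ ·) c) (hne : c.Nonempty)
    (hcS : c ⊆ S.Good 𝓑) : S.SZ (sSup c) 𝓑 := by
  have hF : S.IsFactor (sSup c) := isFactor_sSup hcS
  refine PosSZ.sz hF fun E hE hE0 V hV A hA => ?_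
  have hEX := hF.le _ hE
  have ha : 0 < μ.real E := measureReal_pos_iff.2 hE0
  set η : ℝ := 1 / (2 * (V.card + 1)) with hη
  have hη0 : 0 < η := by positivity
  have hη1 : η ≤ 1 := by
    rw [hη, div_le_one (by positivity)]
    have : (0 : ℝ) ≤ V.card := by positivity
    linarith
  obtain ⟨m, hm, E', hE', hlt⟩ := exists_approx_of_isChain hc hne (μ := μ) hF.le hE
    (ε := η * μ.real E / 2) (by positivity)
  refine SZ.synd_of_approx (m := m) (mX := mX) (hcS hm).1 (hcS hm).2 hEX hE' hV hA hη ?_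
  have hlt' : μ.real (symmDiff E E') < η * μ.real E / 2 := by
    rw [Measure.real]
    exact (ENNReal.lt_ofReal_iff_toReal_lt (measure_ne_top _ _)).1 hlt
  have h1 : μ.real (E' \ E) ≤ μ.real (symmDiff E E') :=
    measureReal_mono Set.subset_union_right
  have h2 : μ.real E ≤ μ.real E' + μ.real (symmDiff E E') := by
    refine (measureReal_mono (s₂ := E' ∪ symmDiff E E') ?_).trans (measureReal_union_le _ _)
    intro x hx
    by_cases h : x ∈ E'
    · exact .inl h
    · exact .inr (.inl ⟨hx, h⟩)
  have h3 := mul_le_mul_of_nonneg_left h2 hη0.le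
  have h4 := mul_le_mul_of_nonneg_right hη1
    (measureReal_nonneg (μ := μ) (s := symmDiff E E'))
  linarith

omit [StandardBorelSpace X] [IsProbabilityMeasure μ] in
lemma measureReal_ret_congr {E E' : Set X} (h : ∀ᵐ x ∂μ, x ∈ E ↔ x ∈ E') (V : Finset (ℕ → G))
    (n : ℕ) : μ.real (S.ret V E n) = μ.real (S.ret V E' n) := by
  refine measureReal_congr ?_
  have h1 : ∀ᵐ x ∂μ, ∀ v ∈ V, S.T (v n) x ∈ E ↔ S.T (v n) x ∈ E' :=
    (ae_ball_iff V.countable_toSet).2 fun v _ => S.ae_comp (v n) h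
  filter_upwards [h1] with x hx
  exact propext (forall₂_congr hx)

omit mX in
lemma exists_isChain_ub {c : Set (MeasurableSpace X)} {s : Set (MeasurableSpace X)}
    (h : sSup c ∈ s) : ∃ ub ∈ s, ∀ z ∈ c, z ≤ ub := ⟨_, h, fun _ hm => le_sSup hm⟩

lemma sSup_mem_good {c : Set (MeasurableSpace X)} (hcs : c ⊆ S.Good 𝓑)
    (hc : IsChain (· ≤ ·) c) (hne : c.Nonempty) : sSup c ∈ S.Good 𝓑 :=
  ⟨isFactor_sSup hcs, sz_sSup hc hne hcs⟩

lemma IsPrimitive.false_of_maximal [Countable G] [IsAddTorsionFree G] (h𝓑 : IsBase 𝓑)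
    {H : AddSubgroup G} {p : G →+ G} (hp : IsPrimitive m z (mX := mX) S H p)
    (hm : S.IsFactor m) (hSZ : S.SZ m 𝓑) (hmax : Maximal (· ∈ S.Good 𝓑) m) : False :=
  hp.not_le (hmax.le_of_ge ⟨hp.factor, PosSZ.sz hp.factor (hp.posSZ hm h𝓑 hSZ)⟩ hp.le)

lemma exists_maximal_good (h𝓑 : IsBase 𝓑) : ∃ m, Maximal (· ∈ S.Good 𝓑) m := by
  have h := zorn_le_nonempty₀ (S.Good 𝓑) (fun c hcs hc _ hy =>
    exists_isChain_ub (sSup_mem_good (mX := mX) hcs hc ⟨_, hy⟩)) ⊥ ⟨isFactor_bot, sz_bot h𝓑⟩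
  obtain ⟨m, -, hm⟩ := h
  exact ⟨m, hm⟩

lemma sz_of_maximal [Countable G] [Module.Finite ℤ G] [IsAddTorsionFree G] (h𝓑 : IsBase 𝓑)
    (hm : S.IsFactor m) (hSZ : S.SZ m 𝓑) (hmax : Maximal (· ∈ S.Good 𝓑) m) : S.SZ mX 𝓑 := by
  intro E hE hE0 V hV A hA
  have hfE : Measurable (ce m μ (ind E)) := measurable_ce' hm.le (measurable_ind hE)
  have h1 : ind E =ᵐ[μ] ce m μ (ind E) := by
    by_contra h0
    set f : X → ℝ := fun x => ind E x - ce m μ (ind E) x with hf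
    have hfb : ∀ x, |f x| ≤ 1 := fun x => by
      have h2 : 0 ≤ ce m μ (ind E) x := integral_nonneg fun y => ind_nonneg E y
      have h3 := (abs_le.1 (abs_ce_le (m := m) (μ := μ) (abs_ind_le E) x)).2
      have h4 := ind_nonneg E x
      have h5 := ind_le_one E x
      rw [abs_le]
      constructor <;> simp only [hf] <;> linarith
    have hce : ce m μ f =ᵐ[μ] 0 := by
      have h2 := ce_of_measurable (μ := μ) hm.le
        (measurable_ce (m := m) (μ := μ) (measurable_ind hE)) (abs_ce_le (abs_ind_le E))
      filter_upwards [h2] with x hx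
      rw [hf, BM.ce_sub (BM.ind hE) ((BM.ind hE).ce' hm.le), hx]
      simp
    obtain ⟨H, z, p, hp⟩ := exists_extension hm ((measurable_ind hE).sub hfE) hfb hce fun h2 =>
      h0 (by filter_upwards [h2] with x hx; exact sub_eq_zero.1 hx)
    exact IsPrimitive.false_of_maximal (mX := mX) h𝓑 hp hm hSZ hmax
  set E' : Set X := {x | 1 / 2 < ce m μ (ind E) x} with hE'
  have hE'm : MeasurableSet[m] E' :=
    measurableSet_lt (by exact measurable_const) (measurable_ce (measurable_ind hE))
  have hEE' : ∀ᵐ x ∂μ, x ∈ E ↔ x ∈ E' := by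
    classical
    filter_upwards [h1] with x hx
    have : x ∈ E' ↔ 1 / 2 < ind E x := by rw [hx]; rfl
    rw [this, ind_apply]
    split_ifs with h
    · simp only [h, true_iff]; norm_num
    · simp only [h, false_iff]; norm_num
  have hE'0 : 0 < μ E' := by
    rwa [← measure_congr (show E =ᵐ[μ] E' by
      filter_upwards [hEE'] with x hx; exact propext hx)]
  obtain ⟨c, hc, hs⟩ := hSZ E' hE'm hE'0 V hV A hA
  refine ⟨c, hc, ?_⟩
  simpa only [measureReal_ret_congr hEE' V] using hs

/-- Polynomial multiple recurrence along the sets of a base, for invertible systems. -/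
theorem sz_self [Countable G] [Module.Finite ℤ G] [IsAddTorsionFree G] (h𝓑 : IsBase 𝓑) :
    S.SZ mX 𝓑 := by
  obtain ⟨m, hm⟩ := exists_maximal_good (S := S) h𝓑
  exact sz_of_maximal (m := m) (mX := mX) h𝓑 hm.prop.1 hm.prop.2 hm

end Sys

end Zorn

end PolyRec

namespace PolyRec

section PolyCoord

lemma IsPoly.pi {ι : Type*} [Fintype ι] {G : ι → Type*} [∀ i, AddCommGroup (G i)]
    {v : ℕ → ∀ i, G i} (h : ∀ i, IsPoly fun n => v n i) : IsPoly v := by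
  choose d hd using h
  have key : ∀ (D : ℕ) (v : ℕ → ∀ i, G i) (i : ι) (n : ℕ),
      dlt^[D] v n i = dlt^[D] (fun n => v n i) n := by
    intro D
    induction D with
    | zero => intros; rfl
    | succ D ih =>
      intro v i n
      rw [Function.iterate_succ_apply, Function.iterate_succ_apply, ih]
      rfl
  refine ⟨∑ i, d i, ?_⟩
  ext n i
  rw [key, dlt_iter_mono (hd i) (Finset.single_le_sum (f := d) (fun _ _ => Nat.zero_le _)
    (Finset.mem_univ i))]
  rfl

lemma isPoly_of_eval {p : Polynomial ℚ} {e : ℕ → ℕ} (he : ∀ n : ℕ, (e n : ℚ) = p.eval (n : ℚ)) :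
    IsPoly fun n => (e n : ℤ) := by
  have key : ∀ (D : ℕ) (f : ℚ → ℚ) (v : ℕ → ℤ), (∀ n : ℕ, (v n : ℚ) = f n) →
      ∀ n : ℕ, ((dlt^[D] v n : ℤ) : ℚ) = (fwdDiff 1)^[D] f n := by
    intro D
    induction D with
    | zero => intro f v h n; exact h n
    | succ D ih =>
      intro f v h n
      rw [Function.iterate_succ_apply, Function.iterate_succ_apply]
      refine ih _ _ (fun n => ?_) n
      have h1 := h (n + 1)
      push_cast at h1
      simp only [dlt, fwdDiff, Int.cast_sub, h1, h]
  refine ⟨p.natDegree + 1, ?_⟩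
  ext n
  have h := key (p.natDegree + 1) p.eval (fun n => (e n : ℤ)) (fun n => by
    rw [← he]; norm_cast) n
  rw [p.fwdDiff_iter_degree_add_one_eq_zero, Pi.zero_apply] at h
  exact_mod_cast h

end PolyCoord

section Invertible

open MeasureTheory Filter Topology

/-- Configurations which are `true` along a finite set. -/
def cyl {G : Type} (s : Finset G) : Set (G → Bool) := {ω | ∀ g ∈ s, ω g = true}

lemma isClopen_cyl {G : Type} (s : Finset G) : IsClopen (cyl s) := by
  have : cyl s = ⋂ g ∈ s, (fun ω : G → Bool => ω g) ⁻¹' {true} := by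
    ext ω; simp [cyl]
  rw [this]
  exact isClopen_biInter_finset fun g _ =>
    (isClopen_discrete _).preimage (continuous_apply g)

lemma measurableSet_cyl {G : Type} [Countable G] (s : Finset G) : MeasurableSet (cyl s) :=
  (isClopen_cyl s).isClosed.measurableSet

lemma ext_of_cyl {G : Type} [Countable G] {μ ν : Measure (G → Bool)} [IsProbabilityMeasure μ]
    [IsProbabilityMeasure ν] (h : ∀ s, μ (cyl s) = ν (cyl s)) : μ = ν := by
  classical
  refine ext_of_generate_finite (Set.range cyl) (le_antisymm ?_ ?_) ?_ ?_ (by simp)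
  · refine iSup_le fun g => ?_
    rw [← measurable_iff_comap_le]
    refine @measurable_to_bool _ (MeasurableSpace.generateFrom _) _ ?_
    refine MeasurableSpace.measurableSet_generateFrom ⟨{g}, ?_⟩
    ext ω; simp [cyl]
  · refine MeasurableSpace.generateFrom_le ?_
    rintro _ ⟨s, rfl⟩
    exact measurableSet_cyl s
  · rintro _ ⟨s, rfl⟩ _ ⟨t, rfl⟩ -
    refine ⟨s ∪ t, ?_⟩
    ext ω
    simp only [cyl, Set.mem_ofPred_eq, Set.mem_inter_iff, Finset.mem_union]
    grind
  · rintro _ ⟨s, rfl⟩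
    exact h s

variable {Y : Type} [MeasurableSpace Y] {μ₀ : Measure Y} [IsProbabilityMeasure μ₀]
  {ι : Type} [Fintype ι] {a : (ι → ℕ) → Y → Y} {E₀ : Set Y}

/-- The set of points visiting `E₀` at all times in `s + w`. -/
def visits (a : (ι → ℕ) → Y → Y) (E₀ : Set Y) (s : Finset (ι → ℤ)) (w : ι → ℤ) : Set Y :=
  {y | ∀ g ∈ s, a (fun i => (g i + w i).toNat) y ∈ E₀}

omit [IsProbabilityMeasure μ₀] [Fintype ι] in
lemma measurableSet_visits (ha : ∀ e, MeasurePreserving (a e) μ₀ μ₀) (hE₀ : MeasurableSet E₀)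
    (s : Finset (ι → ℤ)) (w : ι → ℤ) : MeasurableSet (visits a E₀ s w) := by
  have : visits a E₀ s w = ⋂ g ∈ s, a (fun i => (g i + w i).toNat) ⁻¹' E₀ := by
    ext y; simp [visits]
  rw [this]
  exact Finset.measurableSet_biInter _ fun g _ => (ha _).measurable hE₀

omit [IsProbabilityMeasure μ₀] [Fintype ι] in
lemma measure_visits_add (ha : ∀ e, MeasurePreserving (a e) μ₀ μ₀) (hE₀ : MeasurableSet E₀)
    (hadd : ∀ e e' y, a (e + e') y = a e (a e' y)) {s : Finset (ι → ℤ)} {w u : ι → ℤ}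
    (hw : ∀ g ∈ s, 0 ≤ g + w) (hu : 0 ≤ u) : μ₀ (visits a E₀ s (w + u)) = μ₀ (visits a E₀ s w) := by
  have : visits a E₀ s (w + u) = a (fun i => (u i).toNat) ⁻¹' visits a E₀ s w := by
    ext y
    refine forall₂_congr fun g hg => ?_
    rw [← hadd]
    have : (fun i => (g i + (w + u) i).toNat) =
        (fun i => (g i + w i).toNat) + fun i => (u i).toNat := by
      ext i
      have h1 : 0 ≤ g i + w i := hw g hg i
      have h2 : 0 ≤ u i := hu i
      simp only [Pi.add_apply]
      omega
    rw [this]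
  rw [this, (ha _).measure_preimage (measurableSet_visits ha hE₀ s w).nullMeasurableSet]

omit [IsProbabilityMeasure μ₀] [Fintype ι] in
lemma measure_visits_eq (ha : ∀ e, MeasurePreserving (a e) μ₀ μ₀) (hE₀ : MeasurableSet E₀)
    (hadd : ∀ e e' y, a (e + e') y = a e (a e' y)) {s : Finset (ι → ℤ)} {w w' : ι → ℤ}
    (hw : ∀ g ∈ s, 0 ≤ g + w) (hw' : ∀ g ∈ s, 0 ≤ g + w') :
    μ₀ (visits a E₀ s w) = μ₀ (visits a E₀ s w') := by
  rw [← measure_visits_add ha hE₀ hadd hw (sub_nonneg.2 (le_sup_left : w ≤ w ⊔ w')),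
    ← measure_visits_add ha hE₀ hadd hw' (sub_nonneg.2 (le_sup_right : w' ≤ w ⊔ w'))]
  simp

open Classical in
/-- The coding of a point through its visits to `E₀`, started at time `-N`. -/
noncomputable def coding (a : (ι → ℕ) → Y → Y) (E₀ : Set Y) (N : ℕ) (y : Y) : (ι → ℤ) → Bool :=
  fun g => decide (a (fun i => (g i + N).toNat) y ∈ E₀)

omit [MeasurableSpace Y] [Fintype ι] in
lemma coding_preimage_cyl (N : ℕ) (s : Finset (ι → ℤ)) :
    coding a E₀ N ⁻¹' cyl s = visits a E₀ s (fun _ => N) := by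
  ext y; simp [coding, cyl, visits]

omit [IsProbabilityMeasure μ₀] [Fintype ι] in
lemma measurable_coding (ha : ∀ e, MeasurePreserving (a e) μ₀ μ₀) (hE₀ : MeasurableSet E₀)
    (N : ℕ) : Measurable (coding a E₀ N) := by
  refine measurable_pi_lambda _ fun g => measurable_to_bool ?_
  have : (fun y => coding a E₀ N y g) ⁻¹' {true} = a (fun i => (g i + N).toNat) ⁻¹' E₀ := by
    ext y; simp [coding]
  rw [this]
  exact (ha _).measurable hE₀

lemma exists_nat_bound (s : Finset (ι → ℤ)) : ∃ N₀ : ℕ, ∀ g ∈ s, ∀ i, 0 ≤ g i + N₀ := by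
  refine ⟨∑ g ∈ s, ∑ i, (g i).natAbs, fun g hg i => ?_⟩
  have h1 : (g i).natAbs ≤ ∑ i, (g i).natAbs :=
    Finset.single_le_sum (f := fun i => (g i).natAbs) (fun _ _ => Nat.zero_le _)
      (Finset.mem_univ i)
  have h2 : ∑ i, (g i).natAbs ≤ ∑ g ∈ s, ∑ i, (g i).natAbs :=
    Finset.single_le_sum (f := fun g : ι → ℤ => ∑ i, (g i).natAbs) (fun _ _ => Nat.zero_le _) hg
  have h3 := h1.trans h2
  omega

/-- Furstenberg's correspondence: a probability measure on configurations recording the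
measures of the joint visits. -/
lemma exists_correspondence (ha : ∀ e, MeasurePreserving (a e) μ₀ μ₀) (hE₀ : MeasurableSet E₀)
    (hadd : ∀ e e' y, a (e + e') y = a e (a e' y)) :
    ∃ P : Measure ((ι → ℤ) → Bool), IsProbabilityMeasure P ∧
      ∀ s w, (∀ g ∈ s, 0 ≤ g + w) → P (cyl s) = μ₀ (visits a E₀ s w) := by
  set Q : ℕ → ProbabilityMeasure ((ι → ℤ) → Bool) := fun N =>
    ⟨μ₀.map (coding a E₀ N), Measure.isProbabilityMeasure_map
      (measurable_coding ha hE₀ N).aemeasurable⟩ with hQ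
  set u : Ultrafilter (ProbabilityMeasure ((ι → ℤ) → Bool)) :=
    (hyperfilter ℕ).map Q with hu
  have hlim : Tendsto Q (hyperfilter ℕ : Filter ℕ) (𝓝 u.lim) := u.le_nhds_lim
  refine ⟨u.lim, inferInstance, fun s w hw => ?_⟩
  have h1 := ProbabilityMeasure.tendsto_measure_of_null_frontier_of_tendsto' hlim (E := cyl s)
    (by rw [(isClopen_cyl s).frontier_eq]; exact measure_empty)
  refine tendsto_nhds_unique h1 (tendsto_const_nhds.congr' ?_)
  obtain ⟨N₀, hN₀⟩ := exists_nat_bound s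
  have h2 : ∀ᶠ N in (hyperfilter ℕ : Filter ℕ), N₀ ≤ N :=
    (eventually_ge_atTop N₀).filter_mono Nat.hyperfilter_le_atTop
  filter_upwards [h2] with N hN
  simp only [hQ, ProbabilityMeasure.coe_mk]
  rw [Measure.map_apply (measurable_coding ha hE₀ N) (measurableSet_cyl s), coding_preimage_cyl]
  refine measure_visits_eq ha hE₀ hadd hw fun g hg i => ?_
  have := hN₀ g hg i
  simp only [Pi.zero_apply, Pi.add_apply]
  omega

/-- A commuting family of measure-preserving maps can be replaced by an invertible system on a
standard Borel space, without changing the measures of the sets of multiple returns. -/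
lemma exists_invertible (ha : ∀ e, MeasurePreserving (a e) μ₀ μ₀) (hE₀ : MeasurableSet E₀)
    (hadd : ∀ e e' y, a (e + e') y = a e (a e' y)) :
    ∃ (P : Measure ((ι → ℤ) → Bool)) (_ : IsProbabilityMeasure P) (S : Sys (ι → ℤ) P)
      (E : Set ((ι → ℤ) → Bool)), MeasurableSet E ∧
      ∀ (s : Finset (ι → ℤ)), (∀ g ∈ s, 0 ≤ g) →
        P {ω | ∀ g ∈ s, S.T g ω ∈ E} = μ₀ {y | ∀ g ∈ s, a (fun i => (g i).toNat) y ∈ E₀} := by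
  classical
  obtain ⟨P, hP, hPs⟩ := exists_correspondence (μ₀ := μ₀) ha hE₀ hadd
  have hT : ∀ h : ι → ℤ, Measurable fun (ω : (ι → ℤ) → Bool) g => ω (g + h) := fun h =>
    measurable_pi_lambda _ fun g => measurable_pi_apply _
  let S : Sys (ι → ℤ) P :=
    { T := fun h ω g => ω (g + h)
      mp := fun h => ⟨hT h, by
        have : IsProbabilityMeasure (P.map fun (ω : (ι → ℤ) → Bool) g => ω (g + h)) :=
          Measure.isProbabilityMeasure_map (hT h).aemeasurable
        refine ext_of_cyl fun s => ?_
        rw [Measure.map_apply (hT h) (measurableSet_cyl s)]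
        have h1 : (fun (ω : (ι → ℤ) → Bool) g => ω (g + h)) ⁻¹' cyl s =
            cyl (s.image (· + h)) := by
          ext ω
          change (∀ g ∈ s, ω (g + h) = true) ↔ ∀ g ∈ s.image (· + h), ω g = true
          rw [Finset.forall_mem_image]
        obtain ⟨N, hN⟩ := exists_nat_bound (s ∪ s.image (· + h))
        rw [h1, hPs s ((fun _ => (N : ℤ)) + h) ?_, hPs _ (fun _ => N) ?_]
        · congr 1
          ext y
          simp only [visits, Set.mem_ofPred_eq, Finset.forall_mem_image, Pi.add_apply]
          refine forall₂_congr fun g _ => ?_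
          have : (fun i => (g i + h i + (N : ℤ)).toNat) = fun i => (g i + (N + h i)).toNat := by
            ext i; congr 1; ring
          rw [this]
        · intro g hg i
          exact hN g (Finset.mem_union_right _ hg) i
        · intro g hg i
          have := hN _ (Finset.mem_union_right _ (Finset.mem_image_of_mem _ hg)) i
          simp only [Pi.add_apply, Pi.zero_apply] at this ⊢
          linarith⟩
      zero := fun ω => by ext g; simp
      add := fun g h ω => by ext x; simp [add_assoc] }
  refine ⟨P, hP, S, {ω | ω 0 = true}, ?_, fun s hs => ?_⟩
  · have : {ω : (ι → ℤ) → Bool | ω 0 = true} = cyl {0} := by ext; simp [cyl]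
    rw [this]
    exact measurableSet_cyl _
  · have h1 : {ω | ∀ g ∈ s, S.T g ω ∈ {ω : (ι → ℤ) → Bool | ω 0 = true}} = cyl s := by
      ext ω; simp [S, cyl]
    rw [h1, hPs s 0 (by simpa using hs)]
    simp [visits]

end Invertible

end PolyRec

namespace PolyRec

section Words

/-- A word (the set of positions of its ones, and its length) together with a gap bound. -/
structure Pat where
  word : Set ℕ
  len : ℕ
  gap : ℕ

/-- The pattern occurs in `z` at position `s`. -/
def Pat.At (φ : Pat) (z : Set ℕ) (s : ℕ) : Prop := ∀ i < φ.len, s + i ∈ z ↔ i ∈ φ.word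

/-- Every point of `[a, b)` is close to an occurrence of the pattern inside `[a, b)`. -/
def Pat.Tiled (φ : Pat) (z : Set ℕ) (a b : ℕ) : Prop :=
  ∀ c, a ≤ c → c < b →
    ∃ s, a ≤ s ∧ s + φ.len ≤ b ∧ s ≤ c + φ.gap ∧ c ≤ s + φ.gap ∧ φ.At z s

namespace Pat

variable {φ : Pat} {z z' : Set ℕ} {a b c : ℕ}

lemma Tiled.congr (h : φ.Tiled z a b) (hz : ∀ n, a ≤ n → n < b → (n ∈ z ↔ n ∈ z')) :
    φ.Tiled z' a b := by
  intro c hac hcb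
  obtain ⟨s, h1, h2, h3, h4, h5⟩ := h c hac hcb
  exact ⟨s, h1, h2, h3, h4, fun i hi => (hz _ (by omega) (by omega)).symm.trans (h5 i hi)⟩

lemma Tiled.append (h : φ.Tiled z a b) (h' : φ.Tiled z b c) (hab : a ≤ b) (hbc : b ≤ c) :
    φ.Tiled z a c := by
  intro d had hdc
  rcases lt_or_ge d b with hd | hd
  · obtain ⟨s, h1, h2, h3, h4, h5⟩ := h d had hd
    exact ⟨s, h1, h2.trans hbc, h3, h4, h5⟩
  · obtain ⟨s, h1, h2, h3, h4, h5⟩ := h' d hd hdc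
    exact ⟨s, hab.trans h1, h2, h3, h4, h5⟩

lemma Tiled.shift (h : φ.Tiled z 0 b) (s : ℕ) (hz : ∀ i < b, s + i ∈ z' ↔ i ∈ z) :
    φ.Tiled z' s (s + b) := by
  intro c hac hcb
  obtain ⟨t, h1, h2, h3, h4, h5⟩ := h (c - s) (Nat.zero_le _) (by omega)
  refine ⟨s + t, by omega, by omega, by omega, by omega, fun i hi => ?_⟩
  rw [add_assoc, hz _ (by omega)]
  exact h5 i hi

lemma tiled_of_at {s : ℕ} (hs : φ.At z s) (has : a ≤ s) (hsb : s + φ.len ≤ b)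
    (hab : b ≤ a + φ.gap) : φ.Tiled z a b :=
  fun c _ _ => ⟨s, has, hsb, by omega, by omega, hs⟩

end Pat

/-- A partially built word, with the patterns it has to respect. -/
structure Stage (A : Set ℕ) where
  pats : Set Pat
  word : Set ℕ
  len : ℕ
  fill : ℕ
  len_pos : 0 < len
  zero_mem : 0 ∈ word
  sub : ∀ i ∈ word, i < len → i ≠ 0 → i ∈ A
  tiled : ∀ φ ∈ pats, φ.Tiled word 0 len
  exists_fill : ∀ a b, a + fill ≤ b → ∃ z : Set ℕ, (∀ n ∈ z, a ≤ n → n < b → n ∈ A) ∧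
    ∀ φ ∈ pats, φ.Tiled z a b

variable {A : Set ℕ}

/-- The initial stage. -/
def Stage.init (A : Set ℕ) : Stage A where
  pats := ∅
  word := {0}
  len := 1
  fill := 0
  len_pos := one_pos
  zero_mem := rfl
  sub := fun _ hi _ h0 => absurd hi h0
  tiled := fun _ h => h.elim
  exists_fill := fun _ _ _ => ⟨∅, fun _ h => h.elim, fun _ h => h.elim⟩

lemma Stage.exists_fill_insert
    (hA : ∀ F : Finset ℕ, (∀ f ∈ F, f ∈ A) → Synd {s | s ∈ A ∧ ∀ f ∈ F, s + f ∈ A})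
    (σ : Stage A) : ∃ L : ℕ, σ.len ≤ L ∧ ∀ a b, a + L ≤ b →
      ∃ z : Set ℕ, (∀ n ∈ z, a ≤ n → n < b → n ∈ A) ∧
        ∀ φ ∈ insert ⟨σ.word, σ.len, 2 * L⟩ σ.pats, φ.Tiled z a b := by
  classical
  obtain ⟨g, hg⟩ := hA ((Finset.range σ.len).filter fun i => i ∈ σ.word ∧ i ≠ 0) (by
    intro f hf
    simp only [Finset.mem_filter, Finset.mem_range] at hf
    exact σ.sub f hf.2.1 hf.1 hf.2.2)
  set L := 2 * σ.fill + g + σ.len with hL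
  refine ⟨L, by omega, ?_⟩
  have hsmall : ∀ a b, a + L ≤ b → b ≤ a + 2 * L →
      ∃ z : Set ℕ, (∀ n ∈ z, a ≤ n → n < b → n ∈ A) ∧
        ∀ φ ∈ insert ⟨σ.word, σ.len, 2 * L⟩ σ.pats, φ.Tiled z a b := by
    intro a b hab hba
    obtain ⟨s, ⟨hsA, hsF⟩, hs1, hs2⟩ := hg (a + σ.fill)
    obtain ⟨z₁, hz₁, ht₁⟩ := σ.exists_fill a s (by omega)
    obtain ⟨z₂, hz₂, ht₂⟩ := σ.exists_fill (s + σ.len) b (by omega)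
    set z : Set ℕ := {n | if n < s then n ∈ z₁ else if n < s + σ.len then n - s ∈ σ.word
      else n ∈ z₂} with hz
    have e1 : ∀ n, n < s → (n ∈ z ↔ n ∈ z₁) := fun n hn => by
      simp only [hz, Set.mem_ofPred_eq, if_pos hn]
    have e2 : ∀ i < σ.len, s + i ∈ z ↔ i ∈ σ.word := fun i hi => by
      simp only [hz, Set.mem_ofPred_eq]
      rw [if_neg (by omega), if_pos (by omega), Nat.add_sub_cancel_left]
    have e3 : ∀ n, s + σ.len ≤ n → (n ∈ z ↔ n ∈ z₂) := fun n hn => by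
      simp only [hz, Set.mem_ofPred_eq]
      rw [if_neg (by omega), if_neg (by omega)]
    refine ⟨z, fun n hn han hnb => ?_, ?_⟩
    · rcases lt_or_ge n s with h | h
      · exact hz₁ n ((e1 n h).1 hn) han h
      rcases lt_or_ge n (s + σ.len) with h' | h'
      · obtain ⟨i, rfl⟩ := Nat.exists_eq_add_of_le h
        have hi : i < σ.len := by omega
        have hiw := (e2 i hi).1 hn
        by_cases hi0 : i = 0
        · rw [hi0]; exact hsA
        · exact hsF i (by simp [hi, hiw, hi0])
      · exact hz₂ n ((e3 n h').1 hn) h' hnb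
    · intro φ hφ
      rcases Set.mem_insert_iff.1 hφ with rfl | hφ
      · exact Pat.tiled_of_at (s := s) e2 (by omega) (by simp only; omega) (by simp only; omega)
      · refine ((((ht₁ φ hφ).congr fun n _ h => (e1 n h).symm).append
          ((σ.tiled φ hφ).shift s e2) (by omega) (by omega)).append
          ((ht₂ φ hφ).congr fun n h _ => (e3 n h).symm) (by omega) (by omega))
  intro a b hab
  obtain ⟨d, hd⟩ : ∃ d, b - a = d := ⟨_, rfl⟩
  induction d using Nat.strong_induction_on generalizing a with
  | _ d ih =>
    rcases le_or_gt b (a + 2 * L) with h | h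
    · exact hsmall a b hab h
    have hlen := σ.len_pos
    obtain ⟨z₁, hz₁, ht₁⟩ := hsmall a (a + L) le_rfl (by omega)
    obtain ⟨z₂, hz₂, ht₂⟩ := ih (b - (a + L)) (by omega) (a + L) (by omega) rfl
    set z : Set ℕ := {n | if n < a + L then n ∈ z₁ else n ∈ z₂} with hz
    have e1 : ∀ n, n < a + L → (n ∈ z ↔ n ∈ z₁) := fun n hn => by
      simp only [hz, Set.mem_ofPred_eq, if_pos hn]
    have e2 : ∀ n, a + L ≤ n → (n ∈ z ↔ n ∈ z₂) := fun n hn => by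
      simp only [hz, Set.mem_ofPred_eq, if_neg (not_lt.2 hn)]
    refine ⟨z, fun n hn han hnb => ?_, fun φ hφ => ?_⟩
    · rcases lt_or_ge n (a + L) with h' | h'
      · exact hz₁ n ((e1 n h').1 hn) han h'
      · exact hz₂ n ((e2 n h').1 hn) h' hnb
    · exact ((ht₁ φ hφ).congr fun n _ h => (e1 n h).symm).append
        ((ht₂ φ hφ).congr fun n h _ => (e2 n h).symm) (by omega) (by omega)

/-- One stage extends another and takes its word into account. -/
structure Stage.Ext (σ τ : Stage A) : Prop where
  len_lt : σ.len < τ.len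
  word_iff : ∀ i < σ.len, i ∈ τ.word ↔ i ∈ σ.word
  pats_sub : σ.pats ⊆ τ.pats
  exists_gap : ∃ L, (⟨σ.word, σ.len, L⟩ : Pat) ∈ τ.pats

lemma Stage.exists_ext
    (hA : ∀ F : Finset ℕ, (∀ f ∈ F, f ∈ A) → Synd {s | s ∈ A ∧ ∀ f ∈ F, s + f ∈ A})
    (σ : Stage A) : ∃ τ : Stage A, σ.Ext τ := by
  classical
  obtain ⟨L, hL, hfill⟩ := σ.exists_fill_insert hA
  have hlen := σ.len_pos
  obtain ⟨z, hz, ht⟩ := hfill σ.len (σ.len + L) le_rfl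
  set w : Set ℕ := {n | if n < σ.len then n ∈ σ.word else n ∈ z} with hw
  have e1 : ∀ n, n < σ.len → (n ∈ w ↔ n ∈ σ.word) := fun n hn => by
    simp only [hw, Set.mem_ofPred_eq, if_pos hn]
  have e2 : ∀ n, σ.len ≤ n → (n ∈ w ↔ n ∈ z) := fun n hn => by
    simp only [hw, Set.mem_ofPred_eq, if_neg (not_lt.2 hn)]
  refine ⟨⟨insert ⟨σ.word, σ.len, 2 * L⟩ σ.pats, w, σ.len + L, L, by omega,
    (e1 0 hlen).2 σ.zero_mem, ?_, ?_, hfill⟩, ?_⟩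
  · intro i hi hil hi0
    rcases lt_or_ge i σ.len with h | h
    · exact σ.sub i ((e1 i h).1 hi) h hi0
    · exact hz i ((e2 i h).1 hi) h hil
  · intro φ hφ
    refine Pat.Tiled.append ?_ ((ht φ hφ).congr fun n h _ => (e2 n h).symm) (by omega) (by omega)
    rcases Set.mem_insert_iff.1 hφ with rfl | hφ
    · refine Pat.tiled_of_at (s := 0) (fun i hi => ?_) le_rfl (by simp) (by simp only; omega)
      rw [zero_add]
      exact e1 i hi
    · exact (σ.tiled φ hφ).congr fun n _ h => (e1 n h).symm
  · exact ⟨by simp only; omega, e1, Set.subset_insert _ _, 2 * L, Set.mem_insert _ _⟩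

/-- A set which is syndetically often met along with all translates by its finite subsets
supports a uniformly recurrent sequence. -/
lemma exists_recurrent_word
    (hA : ∀ F : Finset ℕ, (∀ f ∈ F, f ∈ A) → Synd {s | s ∈ A ∧ ∀ f ∈ F, s + f ∈ A}) :
    ∃ z : Set ℕ, 0 ∈ z ∧ (∀ n ∈ z, n ≠ 0 → n ∈ A) ∧
      ∀ k, ∃ L, ∀ c, ∃ s, c ≤ s ∧ s ≤ c + L ∧ ∀ i < k, s + i ∈ z ↔ i ∈ z := by
  choose next hnext using Stage.exists_ext hA
  set σ : ℕ → Stage A := fun k => next^[k] (Stage.init A) with hσ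
  have hs : ∀ k, (σ k).Ext (σ (k + 1)) := fun k => by
    simp only [hσ, Function.iterate_succ_apply']
    exact hnext _
  have hlen : ∀ k, k < (σ k).len := by
    intro k
    induction k with
    | zero => exact (σ 0).len_pos
    | succ k ih => exact lt_of_le_of_lt ih (hs k).len_lt
  have hmono : ∀ k d, (σ k).len ≤ (σ (k + d)).len ∧ (σ k).pats ⊆ (σ (k + d)).pats ∧
      ∀ i < (σ k).len, i ∈ (σ (k + d)).word ↔ i ∈ (σ k).word := by
    intro k d
    induction d with
    | zero => exact ⟨le_rfl, le_rfl, fun _ _ => Iff.rfl⟩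
    | succ d ih =>
      have h := hs (k + d)
      exact ⟨ih.1.trans h.len_lt.le, ih.2.1.trans h.pats_sub, fun i hi =>
        (h.word_iff i (hi.trans_le ih.1)).trans (ih.2.2 i hi)⟩
  set z : Set ℕ := {n | n ∈ (σ n).word} with hz
  have hzk : ∀ k, ∀ i < (σ k).len, i ∈ z ↔ i ∈ (σ k).word := by
    intro k i hi
    have h1 := (hmono i k).2.2 i (hlen i)
    have h2 := (hmono k i).2.2 i hi
    rw [add_comm] at h2
    exact h1.symm.trans h2
  refine ⟨z, (σ 0).zero_mem, fun n hn h0 => (σ n).sub n hn (hlen n) h0, fun k => ?_⟩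
  obtain ⟨L, hL⟩ := (hs k).exists_gap
  refine ⟨2 * L, fun c => ?_⟩
  have ht := (σ (k + 1 + (c + L))).tiled _ ((hmono (k + 1) (c + L)).2.1 hL) (c + L)
    (Nat.zero_le _) (lt_of_le_of_lt (by omega) (hlen _))
  obtain ⟨s, -, h2, h3, h4, h5⟩ := ht
  simp only at h2 h3 h4
  refine ⟨s, by omega, by omega, fun i hi => ?_⟩
  have hik : i < (σ k).len := hi.trans (hlen k)
  rw [hzk k i hik, hzk (k + 1 + (c + L)) (s + i) (by omega)]
  exact h5 i hik

end Words

end PolyRec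

namespace PolyRec

section Subshift

/-- A set of pointwise recurrence works for all metrizable minimal systems. -/
lemma exists_return {C : Set ℕ+} (hC : PointwiseRecurrent C) {X : Type} [TopologicalSpace X]
    [CompactSpace X] [TopologicalSpace.MetrizableSpace X] {T : X → X} (hT : Continuous T)
    (hm : MinimalMap T) {x : X} {U : Set X} (hU : IsOpen U) (hx : x ∈ U) :
    ∃ a ∈ C, T^[(a : ℕ)] x ∈ U := by
  let _ := TopologicalSpace.metrizableSpaceMetric X
  have : Nonempty X := ⟨x⟩
  exact hC ⟨X, T, hT, hm⟩ x U hU hx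

/-- The shift on binary sequences. -/
def shiftMap (ω : ℕ → Bool) : ℕ → Bool := fun n => ω (n + 1)

lemma continuous_shiftMap : Continuous shiftMap :=
  continuous_pi fun n => continuous_apply (n + 1)

lemma shiftMap_iterate (m : ℕ) (ω : ℕ → Bool) (n : ℕ) : shiftMap^[m] ω n = ω (n + m) := by
  induction m generalizing n with
  | zero => rfl
  | succ m ih =>
    rw [Function.iterate_succ_apply', shiftMap, ih]
    congr 1
    omega

lemma exists_initial_subset {U : Set (ℕ → Bool)} (hU : IsOpen U) {ω : ℕ → Bool} (hω : ω ∈ U) :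
    ∃ k, ∀ ω' : ℕ → Bool, (∀ i < k, ω' i = ω i) → ω' ∈ U := by
  obtain ⟨I, u, h1, h2⟩ := isOpen_pi_iff.1 hU ω hω
  refine ⟨I.sup id + 1, fun ω' h => h2 fun i hi => ?_⟩
  rw [h i (Nat.lt_succ_of_le (Finset.le_sup (f := id) hi))]
  exact (h1 i hi).2

/-- The sequences all of whose initial segments occur in `z`. -/
def language (z : ℕ → Bool) : Set (ℕ → Bool) := {ω | ∀ k, ∃ m, ∀ i < k, ω i = z (i + m)}

lemma isClosed_language (z : ℕ → Bool) : IsClosed (language z) := by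
  have : language z = ⋂ k, (fun ω : ℕ → Bool => fun i : Fin k => ω i) ⁻¹'
      {a | ∃ m, ∀ i : Fin k, a i = z (i + m)} := by
    ext ω
    simp only [language, Set.mem_ofPred_eq, Set.mem_iInter, Set.mem_preimage]
    exact forall_congr' fun k => exists_congr fun m =>
      ⟨fun h i => h i i.2, fun h i hi => h ⟨i, hi⟩⟩
  rw [this]
  exact isClosed_iInter fun k => (isClosed_discrete _).preimage
    (continuous_pi fun i => continuous_apply _)

lemma mapsTo_language (z : ℕ → Bool) : Set.MapsTo shiftMap (language z) (language z) := by
  intro ω hω k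
  obtain ⟨m, hm⟩ := hω (k + 1)
  refine ⟨m + 1, fun i hi => ?_⟩
  rw [shiftMap, hm (i + 1) (by omega)]
  congr 1
  omega

/-- Uniformly recurrent sequences generate minimal subshifts. -/
lemma minimalMap_language {z : ℕ → Bool}
    (hz : ∀ k, ∃ L, ∀ c, ∃ s, c ≤ s ∧ s ≤ c + L ∧ ∀ i < k, z (s + i) = z i) :
    MinimalMap ((mapsTo_language z).restrict shiftMap _ _) := by
  intro x
  rw [dense_iff_inter_open]
  rintro U hU ⟨y, hy⟩
  obtain ⟨U', hU', rfl⟩ := isOpen_induced_iff.1 hU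
  obtain ⟨k, hk⟩ := exists_initial_subset hU' hy
  obtain ⟨m, hm⟩ := y.2 k
  obtain ⟨L, hL⟩ := hz (k + m)
  obtain ⟨m', hm'⟩ := x.2 (1 + L + k + m)
  obtain ⟨s, h1, h2, h3⟩ := hL (m' + 1)
  obtain ⟨n, hn⟩ : ∃ n : ℕ+, (n : ℕ) = s - m' + m := ⟨⟨_, by omega⟩, rfl⟩
  refine ⟨_, ?_, n, rfl⟩
  simp only [Set.mem_preimage]
  rw [Set.MapsTo.iterate_restrict, Set.MapsTo.val_restrict_apply, hn]
  refine hk _ fun i hi => ?_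
  rw [shiftMap_iterate, hm i hi, hm' _ (by omega), ← h3 (i + m) (by omega)]
  congr 1
  omega

/-- Sets of pointwise recurrence meet every set which is syndetically often met along with all
translates by its finite subsets. -/
lemma PointwiseRecurrent.exists_mem {C : Set ℕ+} (hC : PointwiseRecurrent C) {A : Set ℕ}
    (hA : ∀ F : Finset ℕ, (∀ f ∈ F, f ∈ A) → Synd {s | s ∈ A ∧ ∀ f ∈ F, s + f ∈ A}) :
    ∃ n ∈ C, (n : ℕ) ∈ A := by
  classical
  obtain ⟨z, h0, hzA, hz⟩ := exists_recurrent_word hA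
  set w : ℕ → Bool := fun n => decide (n ∈ z) with hw
  have hwr : ∀ k, ∃ L, ∀ c, ∃ s, c ≤ s ∧ s ≤ c + L ∧ ∀ i < k, w (s + i) = w i := by
    intro k
    obtain ⟨L, hL⟩ := hz k
    refine ⟨L, fun c => ?_⟩
    obtain ⟨s, h1, h2, h3⟩ := hL c
    exact ⟨s, h1, h2, fun i hi => by simp only [hw, h3 i hi]⟩
  have hcpt : CompactSpace (language w) :=
    isCompact_iff_compactSpace.1 (isClosed_language w).isCompact
  have hopen : IsOpen {ω : language w | ω.1 0 = true} := by
    have hc : Continuous fun ω : language w => ω.1 0 :=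
      (continuous_apply 0).comp continuous_subtype_val
    exact (isOpen_discrete {true}).preimage hc
  obtain ⟨n, hn, h1⟩ := exists_return hC (X := language w)
    (continuous_shiftMap.restrict (mapsTo_language w)) (minimalMap_language hwr)
    (x := ⟨w, fun k => ⟨0, fun i _ => rfl⟩⟩) hopen
    (by simpa [hw] using h0)
  refine ⟨n, hn, hzA _ ?_ n.ne_zero⟩
  rw [Set.mem_ofPred_eq, Set.MapsTo.iterate_restrict, Set.MapsTo.val_restrict_apply,
    shiftMap_iterate] at h1
  simpa [hw] using h1

end Subshift

section ReturnTimes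

/-- The sets of return times of a point to its neighbourhoods. -/
def returnBase (S : MinSystem) (x : S.X) : Set (Set ℕ) :=
  {R | ∃ U, IsOpen U ∧ x ∈ U ∧ R = {n | S.T^[n] x ∈ U}}

lemma isBase_returnBase (S : MinSystem) (x : S.X) : IsBase (returnBase S x) where
  inter := by
    rintro _ ⟨U, hU, hxU, rfl⟩ _ ⟨V, hV, hxV, rfl⟩
    exact ⟨U ∩ V, hU.inter hV, ⟨hxU, hxV⟩, rfl⟩
  shift := by
    rintro _ ⟨U, hU, hxU, rfl⟩ n hn
    refine ⟨_, ⟨S.T^[n] ⁻¹' U, hU.preimage (S.cont.iterate n), hn, rfl⟩, fun m hm => ?_⟩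
    rw [Set.mem_ofPred_eq, Function.iterate_add_apply]
    exact hm
  synd := by
    rintro _ ⟨U, hU, hxU, rfl⟩
    obtain ⟨t, ht⟩ := isCompact_univ.elim_finite_subcover
      (fun n : ℕ+ => S.T^[(n : ℕ)] ⁻¹' U) (fun n => hU.preimage (S.cont.iterate n))
      (fun y _ => by
        obtain ⟨_, h1, n, rfl⟩ := dense_iff_inter_open.1 (S.minimal y) U hU ⟨x, hxU⟩
        exact Set.mem_iUnion.2 ⟨n, h1⟩)
    refine ⟨t.sup fun n => (n : ℕ), fun m => ?_⟩
    obtain ⟨n, hn, h1⟩ := Set.mem_iUnion₂.1 (ht (Set.mem_univ (S.T^[m] x)))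
    have h2 := Finset.le_sup (f := fun n : ℕ+ => (n : ℕ)) hn
    have h3 := n.pos
    refine ⟨n + m, ?_, by omega, by omega⟩
    rw [Set.mem_ofPred_eq, Function.iterate_add_apply]
    exact h1

end ReturnTimes

section Product

open MeasureTheory

variable {G : Type} [AddCommGroup G] {X : Type} [MeasurableSpace X] {μ : Measure X}
  [IsProbabilityMeasure μ]

/-- The power of a system, with the power of the group acting coordinatewise. -/
noncomputable def Sys.power (S : Sys G μ) (ι : Type) [Fintype ι] :
    Sys (ι → G) (Measure.pi fun _ : ι => μ) where
  T g x i := S.T (g i) (x i)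
  mp g := measurePreserving_pi _ _ fun i => S.mp (g i)
  zero x := by ext i; exact S.zero _
  add g h x := by ext i; exact S.add _ _ _

/-- Recurrence persists along finitely many translates. -/
lemma Sys.synd_ret_add [StandardBorelSpace X] [Countable G] [Module.Finite ℤ G]
    [IsAddTorsionFree G] (S : Sys G μ) {𝓑 : Set (Set ℕ)} (h𝓑 : IsBase 𝓑) {E : Set X}
    (hE : MeasurableSet E) {V : Finset (ℕ → G)} (hV : ∀ v ∈ V, IsPoly v) {F : Finset ℕ}
    (hF : ∀ f ∈ F, 0 < μ (S.ret V E f)) {A : Set ℕ} (hA : A ∈ 𝓑) :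
    Synd {s | s ∈ A ∧ ∀ f ∈ F, 0 < μ (S.ret V E (s + f))} := by
  classical
  set E' : Set (F → X) := Set.univ.pi fun f => S.ret V E f with hE'
  have hm : ∀ n, MeasurableSet (S.ret V E n) := fun n => by
    have : S.ret V E n = ⋂ v ∈ V, S.T (v n) ⁻¹' E := by ext; simp [Sys.ret]
    rw [this]
    exact Finset.measurableSet_biInter _ fun v _ => (S.mp _).measurable hE
  have hE'm : MeasurableSet E' := MeasurableSet.univ_pi fun f => hm f
  have hE'0 : 0 < (Measure.pi fun _ : F => μ) E' := by
    rw [hE', Measure.pi_pi]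
    exact CanonicallyOrderedAdd.prod_pos.2 fun f _ => hF f f.2
  obtain ⟨c, hc, hs⟩ := (S.power F).sz_self h𝓑 E' hE'm hE'0
    (V.image fun v n (f : F) => v (n + f) - v f) (fun w hw => by
      obtain ⟨v, hv, rfl⟩ := Finset.mem_image.1 hw
      refine ⟨IsPoly.pi fun f => ((hV v hv).tau f).sub (IsPoly.const (v f)), ?_⟩
      ext f
      simp) A hA
  refine hs.mono fun s hs => ⟨hs.1, fun f hf => ?_⟩
  have h1 : 0 < (Measure.pi fun _ : F => μ) _ := measureReal_pos_iff.1 (hc.trans_le hs.2)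
  refine h1.trans_le ?_
  rw [← (measurePreserving_eval (fun _ : F => μ) ⟨f, hf⟩).measure_preimage
    (hm (s + f)).nullMeasurableSet]
  refine measure_mono fun x hx v hv => ?_
  have h2 := hx _ (Finset.mem_image_of_mem _ hv) ⟨f, hf⟩ (Set.mem_univ _) v hv
  simp only [Sys.power, ← S.add, add_sub_cancel] at h2
  exact h2

/-- Polynomial recurrence along the intersection of a set of return times with a set of
pointwise recurrence. -/
lemma Sys.exists_ret_pos [StandardBorelSpace X] [Countable G] [Module.Finite ℤ G]
    [IsAddTorsionFree G] (S : Sys G μ) {E : Set X} (hE : MeasurableSet E) (hE0 : 0 < μ E)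
    {V : Finset (ℕ → G)} (hV : ∀ v ∈ V, IsPoly v ∧ v 0 = 0) (D : MinSystem) {x : D.X}
    {U : Set D.X} (hU : IsOpen U) (hx : x ∈ U) {C : Set ℕ+} (hC : PointwiseRecurrent C) :
    ∃ n ∈ C, n ∈ retTimes D.T x U ∧ 0 < μ (S.ret V E n) := by
  have h0 : 0 < μ (S.ret V E 0) := hE0.trans_le (measure_mono fun y hy v hv => by
    rw [(hV v hv).2, S.zero]
    exact hy)
  refine PointwiseRecurrent.exists_mem (A := {n | D.T^[n] x ∈ U ∧ 0 < μ (S.ret V E n)}) hC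
    fun F hF => ?_
  refine (S.synd_ret_add (isBase_returnBase D x) hE (fun v hv => (hV v hv).1)
    (F := insert 0 F) (A := {n | D.T^[n] x ∈ ⋂ f ∈ insert 0 F, D.T^[f] ⁻¹' U})
    (fun f hf => ?_) ⟨_, isOpen_biInter_finset fun f _ => hU.preimage (D.cont.iterate f), ?_,
      rfl⟩).mono fun s hs => ?_
  · rcases Finset.mem_insert.1 hf with rfl | hf
    · exact h0
    · exact (hF f hf).2
  · refine Set.mem_iInter₂.2 fun f hf => ?_
    rcases Finset.mem_insert.1 hf with rfl | hf
    · exact hx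
    · exact (hF f hf).1
  · have key : ∀ f ∈ insert 0 F, D.T^[s + f] x ∈ U ∧ 0 < μ (S.ret V E (s + f)) := by
      refine fun f hf => ⟨?_, hs.2 f hf⟩
      rw [add_comm, Function.iterate_add_apply]
      exact Set.mem_iInter₂.1 hs.1 f hf
    exact ⟨key 0 (Finset.mem_insert_self _ _), fun f hf => key f (Finset.mem_insert_of_mem hf)⟩

end Product

section MultiComp

open MeasureTheory

variable {X : Type}

lemma multiComp_succ {k : ℕ} (T : Fin (k + 1) → X → X) (e : Fin (k + 1) → ℕ) :
    multiComp T e = (T 0)^[e 0] ∘ multiComp (fun i => T i.succ) fun i => e i.succ := by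
  simp only [multiComp, List.ofFn_succ, List.foldr_cons]

lemma multiComp_commute {k : ℕ} {T : Fin k → X → X} {f : X → X}
    (h : ∀ i, Function.Commute f (T i)) (e : Fin k → ℕ) : Function.Commute f (multiComp T e) := by
  induction k with
  | zero => exact Function.Commute.id_right
  | succ k ih =>
    rw [multiComp_succ]
    exact ((h 0).iterate_right _).comp_right (ih (fun i => h i.succ) _)

lemma multiComp_add {k : ℕ} {T : Fin k → X → X} (h : ∀ i j, Function.Commute (T i) (T j))
    (e e' : Fin k → ℕ) (x : X) : multiComp T (e + e') x = multiComp T e (multiComp T e' x) := by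
  induction k generalizing x with
  | zero => rfl
  | succ k ih =>
    simp only [multiComp_succ, Function.comp_apply, Pi.add_apply]
    rw [Function.iterate_add_apply]
    have h1 := ih (T := fun i => T i.succ) (fun i j => h _ _) (fun i => e i.succ)
      (fun i => e' i.succ) x
    have h2 := (multiComp_commute (f := (T 0)^[e' 0]) (T := fun i => T i.succ)
      (fun i => (h 0 i.succ).iterate_left _) fun i => e i.succ).eq
    rw [← h2]
    exact congrArg _ (congrArg _ h1)

lemma measurePreserving_multiComp [MeasurableSpace X] {μ : Measure X} {k : ℕ}
    {T : Fin k → X → X} (h : ∀ i, MeasurePreserving (T i) μ μ) (e : Fin k → ℕ) :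
    MeasurePreserving (multiComp T e) μ μ := by
  induction k with
  | zero => exact MeasurePreserving.id μ
  | succ k ih =>
    rw [multiComp_succ]
    exact ((h 0).iterate _).comp (ih (fun i => h i.succ) _)

end MultiComp

end PolyRec

open MeasureTheory in
/-- **Theorem H.** Dynamically central piecewise syndetic sets are sets of polynomial
multiple measurable recurrence for commuting transformations.  The polynomials
`p i j ∈ ℚ[x]` satisfy `p i j (0) = 0` and map `ℕ₀` into `ℕ₀`; the latter is witnessed by
the functions `e i j : ℕ → ℕ` with `(e i j n : ℚ) = (p i j).eval n`. -/
theorem dynCentralPS_polynomial_recurrence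
    (A : Set ℕ+) (hA : DynCentralPS A)
    (k ℓ : ℕ) (hk : 0 < k) (hℓ : 0 < ℓ)
    (X : Type) [MeasurableSpace X] (μ : Measure X) [IsProbabilityMeasure μ]
    (T : Fin k → X → X)
    (hmp : ∀ i, MeasurePreserving (T i) μ μ)
    (hcomm : ∀ i j, T i ∘ T j = T j ∘ T i)
    (E : Set X) (hE : MeasurableSet E) (hEpos : 0 < μ E)
    (p : Fin k → Fin ℓ → Polynomial ℚ)
    (e : Fin k → Fin ℓ → ℕ → ℕ)
    (hp0 : ∀ i j, (p i j).eval 0 = 0)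
    (he : ∀ i j (n : ℕ), ((e i j n : ℚ)) = (p i j).eval (n : ℚ)) :
    ∃ n ∈ A,
      0 < μ (⋂ j : Fin ℓ, (multiComp T fun i => e i j ((n : ℕ+) : ℕ)) ⁻¹' E) := by
  classical
  obtain ⟨B, C, ⟨D, x, U, hU, hx, hB⟩, hC, rfl⟩ := hA
  obtain ⟨P, hP, S, E', hE', hPs⟩ := PolyRec.exists_invertible (μ₀ := μ)
    (PolyRec.measurePreserving_multiComp hmp) hE
    (PolyRec.multiComp_add fun i j => Function.semiconj_iff_comp_eq.2 (hcomm i j))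
  have he0 : ∀ i j, e i j 0 = 0 := fun i j => by
    have := he i j 0
    rw [Nat.cast_zero, hp0] at this
    exact_mod_cast this
  have hmT0 : multiComp T 0 = id := by
    have : ∀ {k : ℕ} (T : Fin k → X → X), multiComp T 0 = id := by
      intro k
      induction k with
      | zero => intro T; rfl
      | succ k ih =>
        intro T
        rw [PolyRec.multiComp_succ]
        exact ih _
    exact this T
  have hE'0 : 0 < P E' := by
    have h := hPs {0} (by simp)
    simp only [Finset.mem_singleton, forall_eq, S.zero, Pi.zero_apply, Int.toNat_zero] at h
    change P E' = μ {y | multiComp T 0 y ∈ E} at h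
    rw [h, hmT0]
    exact hEpos
  obtain ⟨n, hnC, hnU, hn⟩ := S.exists_ret_pos hE' hE'0
    (V := Finset.univ.image fun (j : Fin ℓ) n i => (e i j n : ℤ)) (fun v hv => by
      obtain ⟨j, -, rfl⟩ := Finset.mem_image.1 hv
      refine ⟨PolyRec.IsPoly.pi fun i => PolyRec.isPoly_of_eval (he i j), ?_⟩
      ext i
      simp [he0]) D hU hx hC
  refine ⟨n, ⟨hB hnU, hnC⟩, ?_⟩
  have h := hPs (Finset.univ.image fun (j : Fin ℓ) i => (e i j n : ℤ)) (by
    intro g hg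
    obtain ⟨j, -, rfl⟩ := Finset.mem_image.1 hg
    intro i
    simp)
  convert hn using 1
  convert h.symm using 2
  · ext y
    simp
  · ext ω
    simp [PolyRec.Sys.ret]
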